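/- For every real number p > 1 there exist a constant c > 0 and R₀ > 1 such that for all R ≥ R₀ one has ∫_R^{2R} |E*(t)|^p dt ≥ c · R^{p+1} (log R)^{p/2}. -/

import Mathlib

open Real MeasureTheory

/-- Number of visible lattice points (coprime coordinates) in the ball of radius `R`. -/
noncomputable def Nstar (R : ℝ) : ℕ :=
  Set.ncard {v : ℤ × ℤ × ℤ | v ≠ 0 ∧
    Int.gcd (Int.gcd v.1 v.2.1 : ℤ) v.2.2 = 1 ∧
    (v.1 : ℝ)^2 + (v.2.1 : ℝ)^2 + (v.2.2 : ℝ)^2 ≤ R^2}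

/-- The error term `E*(R) = 𝒩*(R) − (4π/(3ζ(3))) R³`. -/
noncomputable def Estar (R : ℝ) : ℝ :=
  (Nstar R : ℝ) - (4 * π / (3 * (riemannZeta 3).re)) * R^3

/-- A nonnegative function with `F (p ^ k * n) ≤ (k + 1) ^ 2 * F n` for `p ∤ n` is `O(n ^ ε)`. -/
theorem le_rpow_of_prime_pow_mul_le (F : ℕ → ℝ) (h0 : ∀ n, 0 ≤ F n)
    (hp : ∀ p k n : ℕ, p.Prime → ¬ p ∣ n → n ≠ 0 → F (p ^ k * n) ≤ ((k : ℝ) + 1) ^ 2 * F n)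
    (ε : ℝ) (hε : 0 < ε) : ∃ C > (0:ℝ), ∀ n : ℕ, n ≠ 0 → F n ≤ C * (n : ℝ) ^ ε := by
  obtain ⟨C₁, hC₁, hC₁'⟩ : ∃ C₁ : ℝ, 1 ≤ C₁ ∧ ∀ k : ℕ, ((k : ℝ) + 1) ^ 2 ≤ C₁ * ((2:ℝ) ^ ε) ^ k := by
    have h2 : (1:ℝ) < 2 ^ ε := Real.one_lt_rpow (by norm_num) hε
    have ht := tendsto_pow_const_div_const_pow_of_one_lt 2 h2
    have ht' : Filter.Tendsto (fun k : ℕ => ((k : ℝ) + 1) ^ 2 / ((2:ℝ) ^ ε) ^ (k + 1)) Filter.atTop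
        (nhds 0) := by
      have := ht.comp (Filter.tendsto_add_atTop_nat 1)
      refine this.congr fun k => ?_
      simp
    obtain ⟨B, hB⟩ := ht'.bddAbove_range
    refine ⟨max 1 (B * 2 ^ ε), le_max_left _ _, fun k => ?_⟩
    have hk := hB ⟨k, rfl⟩
    have hpos : (0:ℝ) < ((2:ℝ) ^ ε) ^ (k + 1) := by positivity
    simp only [div_le_iff₀ hpos] at hk
    calc ((k : ℝ) + 1) ^ 2 ≤ B * ((2:ℝ) ^ ε) ^ (k + 1) := hk
      _ = (B * 2 ^ ε) * ((2:ℝ) ^ ε) ^ k := by ring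
      _ ≤ _ := by gcongr; exact le_max_right _ _
  obtain ⟨P, hP⟩ : ∃ P : ℕ, ∀ p : ℕ, P ≤ p → (4:ℝ) ≤ (p : ℝ) ^ ε := by
    have := (tendsto_rpow_atTop hε).comp tendsto_natCast_atTop_atTop
    obtain ⟨P, hP⟩ := Filter.eventually_atTop.1 (this.eventually_ge_atTop 4)
    exact ⟨P, fun p h => hP p h⟩
  set c : ℕ → ℝ := fun p => if p < P then C₁ else 1 with hc
  have hc1 : ∀ p, 1 ≤ c p := fun p => by simp only [hc]; split_ifs <;> simp [hC₁]
  have key : ∀ n : ℕ, n ≠ 0 → F n ≤ F 1 * (∏ p ∈ n.primeFactors, c p) * (n : ℝ) ^ ε := by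
    intro n
    induction n using Nat.strong_induction_on with
    | _ n ih =>
      intro hn
      by_cases h1 : n = 1
      · subst h1; simp
      set p := n.minFac with hpdef
      have pp : p.Prime := Nat.minFac_prime h1
      obtain ⟨k, m, hm, hnm⟩ := Nat.exists_eq_pow_mul_and_not_dvd hn p pp.ne_one
      have hk : k ≠ 0 := by
        rintro rfl
        apply hm; rw [pow_zero, one_mul] at hnm; rw [← hnm]; exact Nat.minFac_dvd n
      have hm0 : m ≠ 0 := by rintro rfl; simp at hm
      have hlt : m < n := by
        rw [hnm]
        have : 1 < p ^ k := Nat.one_lt_pow hk pp.one_lt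
        nlinarith [Nat.pos_of_ne_zero hm0]
      have hpf : n.primeFactors = insert p m.primeFactors := by
        rw [hnm, Nat.primeFactors_mul (pow_ne_zero _ pp.ne_zero) hm0, Nat.primeFactors_prime_pow hk pp]
        rfl
      have hnot : p ∉ m.primeFactors := fun h => hm (Nat.dvd_of_mem_primeFactors h)
      have hck : ((k : ℝ) + 1) ^ 2 ≤ c p * ((p : ℝ) ^ ε) ^ k := by
        simp only [hc]
        split_ifs with h
        · refine (hC₁' k).trans ?_
          have : (2:ℝ) ≤ p := by exact_mod_cast pp.two_le
          gcongr
        · have h4 := hP p (not_lt.1 h)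
          rw [one_mul]
          calc ((k : ℝ) + 1) ^ 2 ≤ ((2:ℝ) ^ k) ^ 2 := by
                gcongr
                have := @Nat.lt_two_pow_self k
                exact_mod_cast this
            _ = 4 ^ k := by rw [← pow_mul, mul_comm, pow_mul]; norm_num
            _ ≤ _ := by gcongr
      have hprod : 0 ≤ ∏ p ∈ m.primeFactors, c p :=
        Finset.prod_nonneg fun p _ => zero_le_one.trans (hc1 p)
      have e1 : ((n : ℕ) : ℝ) ^ ε = ((p : ℝ) ^ ε) ^ k * (m : ℝ) ^ ε := by
        rw [hnm]; push_cast
        rw [Real.mul_rpow (by positivity) (by positivity), ← Real.rpow_natCast,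
          ← Real.rpow_natCast, ← Real.rpow_mul (by positivity), ← Real.rpow_mul (by positivity),
          mul_comm ε]
      calc F n = F (p ^ k * m) := by rw [← hnm]
        _ ≤ ((k : ℝ) + 1) ^ 2 * F m := hp p k m pp hm hm0
        _ ≤ (c p * ((p : ℝ) ^ ε) ^ k) * (F 1 * (∏ p ∈ m.primeFactors, c p) * (m : ℝ) ^ ε) := by
            have := ih m hlt hm0
            gcongr
            · exact h0 m
        _ = _ := by rw [hpf, Finset.prod_insert hnot, e1]; ring
  refine ⟨F 1 * C₁ ^ P + 1, by have := h0 1; positivity, fun n hn => (key n hn).trans ?_⟩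
  have hle : (∏ p ∈ n.primeFactors, c p) ≤ C₁ ^ P := by
    have : (∏ p ∈ n.primeFactors, c p) = C₁ ^ (n.primeFactors.filter (· < P)).card := by
      simp only [hc]
      rw [Finset.prod_ite]; simp
    rw [this]
    refine pow_le_pow_right₀ hC₁ ?_
    calc _ ≤ (Finset.range P).card := Finset.card_le_card fun x hx => by
            simp at hx ⊢; exact hx.2
      _ = P := Finset.card_range P
  have hF := h0 1
  gcongr
  nlinarith [mul_le_mul_of_nonneg_left hle hF]

theorem card_divisors_le_rpow (ε : ℝ) (hε : 0 < ε) :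
    ∃ C > (0:ℝ), ∀ n : ℕ, n ≠ 0 → (n.divisors.card : ℝ) ≤ C * (n : ℝ) ^ ε := by
  refine le_rpow_of_prime_pow_mul_le (fun n => n.divisors.card) (fun n => by positivity) ?_ ε hε
  intro p k n hp hn hn0
  have hcop : (p ^ k).Coprime n := Nat.Coprime.pow_left _ ((Nat.Prime.coprime_iff_not_dvd hp).2 hn)
  rw [Nat.Coprime.card_divisors_mul hcop, Nat.divisors_prime_pow hp]
  simp only [Finset.card_map, Finset.card_range]
  push_cast
  have : (0:ℝ) ≤ n.divisors.card := by positivity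
  have hk : (0:ℝ) ≤ k := by positivity
  nlinarith [mul_nonneg hk this, mul_nonneg hk (mul_nonneg hk this)]

theorem gaussianInt_finite_norm_eq (n : ℕ) : {z : GaussianInt | z.norm = n}.Finite := by
  have : Set.InjOn (fun z : GaussianInt => (z.re, z.im)) {z : GaussianInt | z.norm = n} := by
    intro a _ b _ h
    simp only [Prod.mk.injEq] at h
    exact Zsqrtd.ext h.1 h.2
  refine Set.Finite.of_finite_image (((Set.finite_Icc (-(n:ℤ)) n).prod
    (Set.finite_Icc (-(n:ℤ)) n)).subset ?_) this
  rintro _ ⟨z, hz, rfl⟩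
  simp only [Set.mem_ofPred_eq, Zsqrtd.norm_def] at hz
  simp only [Set.mem_prod, Set.mem_Icc]
  refine ⟨⟨?_, ?_⟩, ?_, ?_⟩ <;> nlinarith [sq_nonneg (z.re), sq_nonneg z.im]

theorem gaussianInt_exists_factor (p : ℕ) (hp : p.Prime) :
    ∃ ϖ : GaussianInt, Prime ϖ ∧ (ϖ ∣ (p : GaussianInt)) := by
  have hnu : ¬ IsUnit (p : GaussianInt) := by
    rw [Zsqrtd.isUnit_iff_norm_isUnit, Zsqrtd.norm_natCast, Int.isUnit_iff]
    have := hp.two_le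
    rintro (h | h) <;> nlinarith
  obtain ⟨q, hq, hq'⟩ := WfDvdMonoid.exists_irreducible_factor hnu (by exact_mod_cast hp.ne_zero)
  exact ⟨q, hq.prime, hq'⟩

theorem gaussianInt_prime_pow_factor (p : ℕ) (hp : p.Prime) (n : ℕ) (hn : ¬ p ∣ n) (ϖ : GaussianInt)
    (hϖ : Prime ϖ) (hϖp : ϖ ∣ (p : GaussianInt)) (k : ℕ) : ∀ z : GaussianInt,
    z.norm = (p ^ k * n : ℕ) → ∃ i ∈ Finset.range (k + 1), ∃ j ∈ Finset.range (k + 1),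
      ∃ z' : GaussianInt, z'.norm = n ∧ z = ϖ ^ i * (star ϖ) ^ j * z' := by
  have hnorm : ∃ e : ℕ, 1 ≤ e ∧ ϖ.norm = (p ^ e : ℕ) := by
    obtain ⟨c, hc⟩ := hϖp
    have h1 := congrArg Zsqrtd.norm hc
    rw [Zsqrtd.norm_mul, Zsqrtd.norm_natCast] at h1
    have h2 : ϖ.norm.natAbs ∣ p ^ 2 := by
      have := congrArg Int.natAbs h1
      rw [Int.natAbs_mul, Int.natAbs_mul, Int.natAbs_natCast] at this
      exact ⟨_, by rw [← this]; ring⟩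
    obtain ⟨e, _, he⟩ := (Nat.dvd_prime_pow hp).1 h2
    refine ⟨e, ?_, ?_⟩
    · rcases Nat.eq_zero_or_pos e with h | h
      · exfalso
        rw [h, pow_zero] at he
        exact hϖ.not_isUnit (Zsqrtd.norm_eq_one_iff.1 he)
      · exact h
    · rw [← he]; exact (Int.natAbs_of_nonneg (GaussianInt.norm_nonneg ϖ)).symm
  obtain ⟨e, he1, he⟩ := hnorm
  have hnstar : (star ϖ).norm = (p ^ e : ℕ) := by rw [Zsqrtd.norm_conj, he]
  have hp0 : (p : ℤ) ≠ 0 := by exact_mod_cast hp.ne_zero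
  have step : ∀ (ρ z w : GaussianInt) (k : ℕ), ρ.norm = (p ^ e : ℕ) → z = ρ * w →
      z.norm = (p ^ (k + 1) * n : ℕ) → ∃ k' ≤ k, w.norm = (p ^ k' * n : ℕ) := by
    intro ρ z w k h1 h2 h3
    rw [h2, Zsqrtd.norm_mul, h1] at h3
    have hek : e ≤ k + 1 := by
      by_contra hlt
      have : (p : ℤ) ^ (k + 2) ∣ (p : ℤ) ^ (k + 1) * n := by
        have h4 : ((p ^ (k + 1) * n : ℕ) : ℤ) = (p : ℤ) ^ (k + 1) * n := by push_cast; ring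
        rw [← h4, ← h3]
        push_cast
        exact Dvd.dvd.mul_right (pow_dvd_pow _ (by omega)) _
      rw [pow_succ (p : ℤ) (k + 1)] at this
      have := Int.dvd_of_mul_dvd_mul_left (pow_ne_zero _ hp0) this
      exact hn (by exact_mod_cast this)
    refine ⟨k + 1 - e, by omega, ?_⟩
    have h5 : (p : ℤ) ^ e * w.norm = (p : ℤ) ^ e * ((p : ℤ) ^ (k + 1 - e) * n) := by
      rw [← mul_assoc, ← pow_add, Nat.add_sub_cancel' hek]
      push_cast at h3; exact h3
    have := mul_left_cancel₀ (pow_ne_zero e hp0) h5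
    rw [this]; push_cast; ring
  induction k using Nat.strong_induction_on with
  | _ k ih =>
    intro z hz
    rcases Nat.eq_zero_or_pos k with rfl | hk
    · exact ⟨0, by simp, 0, by simp, z, by simpa using hz, by simp⟩
    obtain ⟨k, rfl⟩ : ∃ l, k = l + 1 := ⟨k - 1, by omega⟩
    have hdvd : ϖ ∣ z * star z := by
      rw [← Zsqrtd.norm_eq_mul_conj, hz]
      refine hϖp.trans ⟨((p ^ k * n : ℕ) : GaussianInt), ?_⟩
      push_cast; ring
    rcases hϖ.dvd_or_dvd hdvd with ⟨w, hw⟩ | ⟨w, hw⟩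
    · obtain ⟨k', hk', hwn⟩ := step ϖ z w k he hw hz
      obtain ⟨i, hi, j, hj, z', hz', hw'⟩ := ih k' (by omega) w hwn
      simp only [Finset.mem_range] at hi hj
      refine ⟨i + 1, by simp; omega, j, by simp; omega, z', hz', ?_⟩
      rw [hw, hw']; ring
    · have hw2 : z = star ϖ * star w := by
        rw [← star_star z, hw]; simp
      obtain ⟨k', hk', hwn⟩ := step (star ϖ) z (star w) k hnstar hw2 hz
      obtain ⟨i, hi, j, hj, z', hz', hw'⟩ := ih k' (by omega) (star w) hwn
      simp only [Finset.mem_range] at hi hj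
      refine ⟨i, by simp; omega, j + 1, by simp; omega, z', hz', ?_⟩
      rw [hw2, hw']; ring

theorem gaussianInt_card_norm_le (ε : ℝ) (hε : 0 < ε) :
    ∃ C > (0:ℝ), ∀ n : ℕ, n ≠ 0 →
      (({z : GaussianInt | z.norm = n}.ncard : ℕ) : ℝ) ≤ C * (n : ℝ) ^ ε := by
  refine le_rpow_of_prime_pow_mul_le (fun n => ({z : GaussianInt | z.norm = n}.ncard : ℝ))
    (fun n => by positivity) ?_ ε hε
  intro p k n hp hn hn0
  obtain ⟨ϖ, hϖ, hϖp⟩ := gaussianInt_exists_factor p hp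
  set T : Finset GaussianInt := (gaussianInt_finite_norm_eq n).toFinset with hT
  set U : Finset (ℕ × ℕ × GaussianInt) := Finset.range (k+1) ×ˢ Finset.range (k+1) ×ˢ T with hU
  have hsub : {z : GaussianInt | z.norm = (p ^ k * n : ℕ)} ⊆
      (fun x : ℕ × ℕ × GaussianInt => ϖ ^ x.1 * (star ϖ) ^ x.2.1 * x.2.2) '' (U : Set _) := by
    intro z hz
    obtain ⟨i, hi, j, hj, z', hz', h⟩ := gaussianInt_prime_pow_factor p hp n hn ϖ hϖ hϖp k z hz
    refine ⟨(i, j, z'), ?_, h.symm⟩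
    simp only [hU, Finset.coe_product, Set.mem_prod, Finset.mem_coe]
    exact ⟨hi, hj, by simpa [hT] using hz'⟩
  have h1 := (Set.ncard_le_ncard hsub (U.finite_toSet.image _)).trans
    (Set.ncard_image_le U.finite_toSet)
  rw [Set.ncard_coe_finset, hU, Finset.card_product, Finset.card_product, Finset.card_range] at h1
  have h2 : {z : GaussianInt | z.norm = n}.ncard = T.card := by
    rw [hT, Set.ncard_eq_toFinset_card _ (gaussianInt_finite_norm_eq n)]
  rw [h2]
  calc _ ≤ (((k + 1) * ((k + 1) * T.card) : ℕ) : ℝ) := by exact_mod_cast h1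
    _ = _ := by push_cast; ring

/-- The squared Euclidean norm of an integer vector. -/
def nsq (v : ℤ × ℤ × ℤ) : ℕ := v.1.natAbs ^ 2 + v.2.1.natAbs ^ 2 + v.2.2.natAbs ^ 2

theorem nsq_int (v : ℤ × ℤ × ℤ) : (nsq v : ℤ) = v.1 ^ 2 + v.2.1 ^ 2 + v.2.2 ^ 2 := by
  simp [nsq]

theorem nsq_real (v : ℤ × ℤ × ℤ) : (nsq v : ℝ) = (v.1 : ℝ) ^ 2 + (v.2.1 : ℝ) ^ 2 + (v.2.2 : ℝ) ^ 2 := by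
  exact_mod_cast congrArg (Int.cast : ℤ → ℝ) (nsq_int v)

theorem nsq_eq_zero {v : ℤ × ℤ × ℤ} : nsq v = 0 ↔ v = 0 := by
  obtain ⟨a, b, c⟩ := v
  simp [nsq, Prod.ext_iff, and_assoc]

/-- The integer vectors of squared norm at most `N`. -/
noncomputable def zball (N : ℕ) : Finset (ℤ × ℤ × ℤ) :=
  (Finset.Icc (-(N:ℤ)) N ×ˢ Finset.Icc (-(N:ℤ)) N ×ˢ Finset.Icc (-(N:ℤ)) N).filter (nsq · ≤ N)

theorem mem_zball {N : ℕ} {v : ℤ × ℤ × ℤ} : v ∈ zball N ↔ nsq v ≤ N := by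
  simp only [zball, Finset.mem_filter, Finset.mem_product, Finset.mem_Icc, and_iff_right_iff_imp]
  intro h
  have h' : v.1 ^ 2 + v.2.1 ^ 2 + v.2.2 ^ 2 ≤ N := by rw [← nsq_int]; exact_mod_cast h
  refine ⟨⟨?_, ?_⟩, ⟨?_, ?_⟩, ?_, ?_⟩ <;>
    nlinarith [sq_nonneg v.1, sq_nonneg v.2.1, sq_nonneg v.2.2]

/-- The number of representations of `n` as a sum of three squares. -/
noncomputable def r3 (n : ℕ) : ℕ := ((zball n).filter (nsq · = n)).card

theorem card_circle_le (ε : ℝ) (hε : 0 < ε) : ∃ C > (0:ℝ), ∀ (n : ℕ) (M : ℕ), n ≤ M → M ≠ 0 →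
    ∀ s : Finset (ℤ × ℤ), (∀ z ∈ s, z.1 ^ 2 + z.2 ^ 2 = (n : ℤ)) →
      (s.card : ℝ) ≤ C * (M : ℝ) ^ ε := by
  obtain ⟨C, hC, h⟩ := gaussianInt_card_norm_le ε hε
  refine ⟨C + 1, by positivity, fun n M hM hM0 s hs => ?_⟩
  have hM1 : (1:ℝ) ≤ M := by exact_mod_cast Nat.one_le_iff_ne_zero.2 hM0
  have h1 : (1:ℝ) ≤ (M:ℝ) ^ ε := Real.one_le_rpow hM1 hε.le
  rcases eq_or_ne n 0 with rfl | hn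
  · have : s.card ≤ 1 := by
      rw [Finset.card_le_one]
      intro a ha b hb
      have h2 := hs a ha
      have h3 := hs b hb
      have ha1 : a.1 = 0 := by push_cast at h2; nlinarith [sq_nonneg a.1, sq_nonneg a.2]
      have ha2 : a.2 = 0 := by push_cast at h2; nlinarith [sq_nonneg a.1, sq_nonneg a.2]
      have hb1 : b.1 = 0 := by push_cast at h3; nlinarith [sq_nonneg b.1, sq_nonneg b.2]
      have hb2 : b.2 = 0 := by push_cast at h3; nlinarith [sq_nonneg b.1, sq_nonneg b.2]
      exact Prod.ext (by rw [ha1, hb1]) (by rw [ha2, hb2])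
    have h4 : (s.card : ℝ) ≤ 1 := by exact_mod_cast this
    nlinarith
  · have hinj : s.card ≤ {z : GaussianInt | z.norm = n}.ncard := by
      rw [Set.ncard_eq_toFinset_card _ (gaussianInt_finite_norm_eq n)]
      refine Finset.card_le_card_of_injOn (fun z => (⟨z.1, z.2⟩ : GaussianInt)) ?_ ?_
      · intro z hz
        have := hs z hz
        simp only [Set.Finite.coe_toFinset, Set.mem_ofPred_eq, Zsqrtd.norm_def]
        linarith
      · intro a _ b _ hab
        simp only [Zsqrtd.mk.injEq] at hab
        exact Prod.ext hab.1 hab.2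
    have hnM : (n:ℝ) ^ ε ≤ (M:ℝ) ^ ε := by gcongr
    calc (s.card : ℝ) ≤ ({z : GaussianInt | z.norm = n}.ncard : ℝ) := by exact_mod_cast hinj
      _ ≤ C * (n:ℝ) ^ ε := h n hn
      _ ≤ (C + 1) * (M:ℝ) ^ ε := by nlinarith

theorem r3_le_rpow (ε : ℝ) (hε : 0 < ε) : ∃ C > (0:ℝ), ∀ n : ℕ, n ≠ 0 →
    (r3 n : ℝ) ≤ C * (n : ℝ) ^ (1 / 2 + ε) := by
  obtain ⟨C, hC, h⟩ := card_circle_le ε hε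
  refine ⟨3 * C, by positivity, fun n hn => ?_⟩
  have hn1 : (1:ℝ) ≤ n := by exact_mod_cast Nat.one_le_iff_ne_zero.2 hn
  set S := (zball n).filter (nsq · = n) with hS
  have hmaps : ∀ v ∈ S, v.1 ∈ Finset.Icc (-(n.sqrt : ℤ)) n.sqrt := by
    intro v hv
    have hv' : nsq v = n := (Finset.mem_filter.1 hv).2
    have : v.1.natAbs ≤ n.sqrt := by
      rw [Nat.le_sqrt, ← hv', nsq]
      nlinarith [sq_nonneg v.2.1.natAbs, sq_nonneg v.2.2.natAbs]
    rw [Finset.mem_Icc]; omega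
  have hfib : ∀ a ∈ Finset.Icc (-(n.sqrt : ℤ)) n.sqrt,
      (((S.filter (fun v => v.1 = a)).card : ℕ) : ℝ) ≤ C * (n:ℝ) ^ ε := by
    intro a ha
    set S' := S.filter (fun v => v.1 = a) with hS'
    have hcard : S'.card = (S'.image Prod.snd).card := by
      rw [Finset.card_image_of_injOn]
      intro x hx y hy hxy
      have hx1 : x.1 = a := (Finset.mem_filter.1 hx).2
      have hy1 : y.1 = a := (Finset.mem_filter.1 hy).2
      exact Prod.ext (hx1.trans hy1.symm) hxy
    rw [hcard]
    have ha2 : a.natAbs ^ 2 ≤ n := by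
      have : a.natAbs ≤ n.sqrt := by rw [Finset.mem_Icc] at ha; omega
      calc a.natAbs ^ 2 ≤ n.sqrt ^ 2 := Nat.pow_le_pow_left this 2
        _ ≤ n := Nat.sqrt_le' n
    refine h (n - a.natAbs ^ 2) n (Nat.sub_le _ _) hn _ ?_
    intro z hz
    obtain ⟨v, hv, rfl⟩ := Finset.mem_image.1 hz
    have hv1 : v.1 = a := (Finset.mem_filter.1 hv).2
    have hv2 : nsq v = n := (Finset.mem_filter.1 (Finset.mem_filter.1 hv).1).2
    have := nsq_int v
    rw [hv2, hv1] at this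
    rw [Nat.cast_sub ha2]; push_cast
    rw [sq_abs]; linarith
  have hsum := Finset.card_eq_sum_card_fiberwise hmaps
  have hsq : ((n.sqrt : ℕ) : ℝ) ≤ (n:ℝ) ^ ((1:ℝ) / 2) := by
    rw [← Real.sqrt_eq_rpow]; exact Real.nat_sqrt_le_real_sqrt
  have h1 : (1:ℝ) ≤ (n:ℝ) ^ ((1:ℝ)/2) := Real.one_le_rpow hn1 (by norm_num)
  calc (r3 n : ℝ) = ∑ a ∈ Finset.Icc (-(n.sqrt : ℤ)) n.sqrt,
        (((S.filter (fun v => v.1 = a)).card : ℕ) : ℝ) := by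
        rw [r3, ← hS, hsum]; push_cast; rfl
    _ ≤ ∑ a ∈ Finset.Icc (-(n.sqrt : ℤ)) n.sqrt, C * (n:ℝ) ^ ε := Finset.sum_le_sum hfib
    _ = (2 * n.sqrt + 1 : ℕ) * (C * (n:ℝ) ^ ε) := by
        rw [Finset.sum_const, Int.card_Icc, nsmul_eq_mul]
        congr 2; omega
    _ ≤ (3 * (n:ℝ) ^ ((1:ℝ)/2)) * (C * (n:ℝ) ^ ε) := by
        gcongr; push_cast; linarith
    _ = _ := by rw [Real.rpow_add (by positivity)]; ring

theorem card_eq_eq_sum {α β γ : Type*} [Fintype α] [Fintype β] [Fintype γ] [DecidableEq γ]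
    (f : α → γ) (g : β → γ) :
    (Finset.univ.filter (fun x : α × β => f x.1 = g x.2)).card =
      ∑ h : γ, (Finset.univ.filter (fun x => f x = h)).card *
        (Finset.univ.filter (fun x => g x = h)).card := by
  rw [Finset.card_eq_sum_card_fiberwise (f := fun x => f x.1) (t := Finset.univ) (by simp)]
  refine Finset.sum_congr rfl fun h _ => ?_
  rw [← Finset.card_product]
  congr 1
  ext x
  simp only [Finset.mem_filter, Finset.mem_univ, true_and, Finset.mem_product]
  constructor
  · rintro ⟨h1, h2⟩; exact ⟨h2, h1 ▸ h2⟩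
  · rintro ⟨h1, h2⟩; exact ⟨h1.trans h2.symm, h1⟩

theorem card_eq_sq_le_mul {α β γ : Type*} [Fintype α] [Fintype β] [Fintype γ] [DecidableEq γ]
    (f : α → γ) (g : β → γ) :
    ((Finset.univ.filter (fun x : α × β => f x.1 = g x.2)).card) ^ 2 ≤
      (Finset.univ.filter (fun x : α × α => f x.1 = f x.2)).card *
      (Finset.univ.filter (fun x : β × β => g x.1 = g x.2)).card := by
  rw [card_eq_eq_sum f g, card_eq_eq_sum f f, card_eq_eq_sum g g]
  simp only [← sq]
  exact Finset.sum_mul_sq_le_sq_mul_sq _ _ _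

theorem card_dvd_range_le (d m : ℕ) :
    ((Finset.range (d * m)).filter (d ∣ ·)).card ≤ m := by
  calc _ ≤ (Finset.range m).card := by
        refine Finset.card_le_card_of_injOn (· / d) ?_ ?_
        · intro x hx
          simp only [Finset.coe_filter, Finset.mem_range, Set.mem_ofPred_eq] at hx
          simp only [Finset.coe_range, Set.mem_Iio]
          exact Nat.div_lt_of_lt_mul hx.1
        · intro x hx y hy hxy
          simp only [Finset.coe_filter, Finset.mem_range, Set.mem_ofPred_eq] at hx hy
          exact Nat.div_left_inj hx.2 hy.2 |>.1 hxy
    _ = m := Finset.card_range m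

theorem sum_gcd_le (q : ℕ) (hq : q ≠ 0) :
    ∑ i ∈ Finset.range q, Nat.gcd i q ≤ q * q.divisors.card := by
  calc ∑ i ∈ Finset.range q, Nat.gcd i q
      ≤ ∑ i ∈ Finset.range q, ∑ d ∈ q.divisors, if d ∣ i then d else 0 := by
        refine Finset.sum_le_sum fun i _ => ?_
        refine le_trans (le_of_eq ?_) (Finset.single_le_sum (f := fun d => if d ∣ i then d else 0)
          (fun _ _ => Nat.zero_le _) (Nat.mem_divisors.2 ⟨Nat.gcd_dvd_right i q, hq⟩))
        simp [Nat.gcd_dvd_left]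
    _ = ∑ d ∈ q.divisors, ∑ i ∈ Finset.range q, if d ∣ i then d else 0 := Finset.sum_comm
    _ ≤ ∑ d ∈ q.divisors, q := by
        refine Finset.sum_le_sum fun d hd => ?_
        obtain ⟨m, rfl⟩ := (Nat.mem_divisors.1 hd).1
        rw [← Finset.sum_filter, Finset.sum_const, smul_eq_mul, mul_comm]
        exact Nat.mul_le_mul_left _ (card_dvd_range_le d m)
    _ = _ := by simp [mul_comm]

theorem zmod_card_mul_eq_le (q : ℕ) [NeZero q] (u h : ZMod q) :
    (Finset.univ.filter (fun v : ZMod q => u * v = h)).card ≤ Nat.gcd u.val q := by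
  rcases Finset.eq_empty_or_nonempty (Finset.univ.filter (fun v : ZMod q => u * v = h)) with h0 | ⟨v0, hv0⟩
  · rw [h0]; simp
  have hv0' : u * v0 = h := by simpa using hv0
  have hq : q ≠ 0 := NeZero.ne q
  set g := Nat.gcd u.val q with hg
  have hgpos : 0 < g := Nat.gcd_pos_of_pos_right _ (Nat.pos_of_ne_zero hq)
  obtain ⟨m, hm⟩ : g ∣ q := Nat.gcd_dvd_right _ _
  calc _ ≤ ((Finset.range (m * g)).filter (m ∣ ·)).card := by
        refine Finset.card_le_card_of_injOn (fun v => (v - v0).val) ?_ ?_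
        · intro v hv
          have hv' : u * v = h := by simpa using hv
          simp only [Finset.coe_filter, Finset.mem_range, Set.mem_ofPred_eq]
          refine ⟨by rw [mul_comm, ← hm]; exact ZMod.val_lt _, ?_⟩
          have h1 : u * (v - v0) = 0 := by rw [mul_sub, hv', hv0', sub_self]
          have h2 : q ∣ u.val * (v - v0).val := by
            rw [← ZMod.natCast_eq_zero_iff]; push_cast; simpa using h1
          have h3 : m = q / g := by rw [hm]; exact (Nat.mul_div_cancel_left m hgpos).symm
          rw [h3]
          have hc : Nat.Coprime (q / g) (u.val / g) :=
            (Nat.coprime_div_gcd_div_gcd hgpos).symm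
          refine hc.dvd_of_dvd_mul_left ?_
          obtain ⟨t, ht⟩ := h2
          refine ⟨t, ?_⟩
          have hgu : g * (u.val / g) = u.val := Nat.mul_div_cancel' (Nat.gcd_dvd_left _ _)
          have hgq : g * (q / g) = q := Nat.mul_div_cancel' (Nat.gcd_dvd_right _ _)
          apply Nat.eq_of_mul_eq_mul_left hgpos
          rw [← mul_assoc, ← mul_assoc, hgu, hgq, ht]
        · intro x _ y _ hxy
          have := ZMod.val_injective q hxy
          exact sub_left_injective this
    _ ≤ g := card_dvd_range_le m g

theorem zmod_sum_gcd_two_le (q : ℕ) [NeZero q] :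
    ∑ u : ZMod q, Nat.gcd (2 * u).val q ≤ 2 * (q * q.divisors.card) := by
  have hq : q ≠ 0 := NeZero.ne q
  calc ∑ u : ZMod q, Nat.gcd (2 * u).val q ≤ ∑ u : ZMod q, 2 * Nat.gcd u.val q := by
        refine Finset.sum_le_sum fun u _ => ?_
        have h1 : Nat.gcd (2 * u).val q = Nat.gcd (2 * u.val) q := by
          have : (2 * u).val = (2 * u.val) % q := by
            rw [← ZMod.val_natCast]; congr 1; push_cast; simp
          rw [this, ← Nat.gcd_rec, Nat.gcd_comm]
        rw [h1]
        calc Nat.gcd (2 * u.val) q ≤ Nat.gcd 2 q * Nat.gcd u.val q :=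
              Nat.le_of_dvd (Nat.mul_pos (Nat.gcd_pos_of_pos_left _ two_pos)
                (Nat.gcd_pos_of_pos_right _ (Nat.pos_of_ne_zero hq))) (Nat.gcd_mul_left_dvd_mul_gcd _ _ _)
          _ ≤ _ := Nat.mul_le_mul_right _ (Nat.gcd_le_left _ two_pos)
    _ = 2 * ∑ i ∈ Finset.range q, Nat.gcd i q := by
        rw [← Finset.mul_sum]; congr 1
        symm
        refine Finset.sum_bij (fun i _ => (i : ZMod q)) (by simp) ?_ ?_ ?_
        · intro a ha b hb hab
          have := congrArg ZMod.val hab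
          rwa [ZMod.val_cast_of_lt (Finset.mem_range.1 ha),
            ZMod.val_cast_of_lt (Finset.mem_range.1 hb)] at this
        · intro b _
          exact ⟨b.val, Finset.mem_range.2 (ZMod.val_lt b), by simp⟩
        · intro a ha
          rw [ZMod.val_cast_of_lt (Finset.mem_range.1 ha)]
    _ ≤ _ := Nat.mul_le_mul_left _ (sum_gcd_le q hq)

theorem zmod_card_sq_eq_sq_le (q : ℕ) [NeZero q] :
    (Finset.univ.filter (fun x : ZMod q × ZMod q => x.1 ^ 2 = x.2 ^ 2)).card ≤
      2 * (q * q.divisors.card) := by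
  refine le_trans ?_ (zmod_sum_gcd_two_le q)
  rw [Finset.card_eq_sum_card_fiberwise (f := fun x => x.2 - x.1) (t := Finset.univ) (by simp)]
  refine Finset.sum_le_sum fun u _ => ?_
  refine le_trans ?_ (zmod_card_mul_eq_le q (2 * u) (-u ^ 2))
  refine Finset.card_le_card_of_injOn Prod.fst ?_ ?_
  · intro x hx
    simp only [Finset.coe_filter, Finset.mem_filter, Finset.mem_univ, true_and, Set.mem_ofPred_eq] at hx ⊢
    obtain ⟨h1, rfl⟩ := hx
    linear_combination -h1
  · intro x hx y hy hxy
    simp only [Finset.coe_filter, Finset.mem_filter, Finset.mem_univ, true_and, Set.mem_ofPred_eq] at hx hy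
    refine Prod.ext hxy ?_
    have := hx.2.trans hy.2.symm
    rw [hxy] at this
    exact sub_left_injective this

theorem zmod_card_two_sq_eq_le (q : ℕ) [NeZero q] :
    (Finset.univ.filter (fun x : (ZMod q × ZMod q) × (ZMod q × ZMod q) =>
      x.1.1 ^ 2 + x.1.2 ^ 2 = x.2.1 ^ 2 + x.2.2 ^ 2)).card ≤
      q ^ 2 * (2 * (q * q.divisors.card)) := by
  calc _ ≤ ∑ y : (ZMod q × ZMod q) × ZMod q, Nat.gcd (2 * y.2).val q := by
        rw [Finset.card_eq_sum_card_fiberwise (f := fun x => ((x.1.1, x.2.1), x.2.2 - x.1.2))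
          (t := Finset.univ) (by simp)]
        refine Finset.sum_le_sum fun y _ => ?_
        refine le_trans ?_ (zmod_card_mul_eq_le q (2 * y.2) (y.1.1 ^ 2 - y.1.2 ^ 2 -y.2 ^ 2))
        refine Finset.card_le_card_of_injOn (fun x => x.1.2) ?_ ?_
        · intro x hx
          simp only [Finset.coe_filter, Finset.mem_filter, Finset.mem_univ, true_and,
            Set.mem_ofPred_eq] at hx ⊢
          obtain ⟨h1, rfl⟩ := hx
          linear_combination -h1
        · rintro ⟨⟨a, b⟩, ⟨c, d⟩⟩ hx ⟨⟨a', b'⟩, ⟨c', d'⟩⟩ hy hxy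
          simp only [Finset.coe_filter, Finset.mem_filter, Finset.mem_univ, true_and,
            Set.mem_ofPred_eq] at hx hy hxy
          have := hx.2.trans hy.2.symm
          simp only [Prod.mk.injEq] at this
          obtain ⟨⟨rfl, rfl⟩, h3⟩ := this
          subst hxy
          have := sub_left_injective h3
          subst this; rfl
    _ = q ^ 2 * ∑ u : ZMod q, Nat.gcd (2 * u).val q := by
        rw [Fintype.sum_prod_type]
        simp [ZMod.card, sq]
    _ ≤ _ := Nat.mul_le_mul_left _ (zmod_sum_gcd_two_le q)

/-- The number of zeros of `x² + y² + z²` modulo `q`. -/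
def coneCount (q : ℕ) [NeZero q] : ℕ :=
  (Finset.univ.filter (fun x : ZMod q × ZMod q × ZMod q => x.1 ^ 2 + x.2.1 ^ 2 + x.2.2 ^ 2 = 0)).card

theorem coneCount_le (q : ℕ) [NeZero q] : coneCount q ≤ 2 * q ^ 2 * q.divisors.card := by
  have h := card_eq_sq_le_mul (fun x : ZMod q × ZMod q => x.1 ^ 2 + x.2 ^ 2)
    (fun z : ZMod q => - z ^ 2)
  have h1 := zmod_card_two_sq_eq_le q
  have h2 : (Finset.univ.filter (fun x : ZMod q × ZMod q => -x.1 ^ 2 = -x.2 ^ 2)).card ≤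
      2 * (q * q.divisors.card) := by simpa using zmod_card_sq_eq_sq_le q
  have h3 : coneCount q = (Finset.univ.filter (fun x : (ZMod q × ZMod q) × ZMod q =>
      x.1.1 ^ 2 + x.1.2 ^ 2 = - x.2 ^ 2)).card := by
    rw [coneCount]
    refine Finset.card_bij (fun x _ => ((x.1, x.2.1), x.2.2)) ?_ ?_ ?_
    · intro x hx
      simp only [Finset.mem_filter, Finset.mem_univ, true_and] at hx ⊢
      linear_combination hx
    · intro x _ y _ hxy
      simp only [Prod.mk.injEq] at hxy
      exact Prod.ext hxy.1.1 (Prod.ext hxy.1.2 hxy.2)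
    · rintro ⟨⟨a, b⟩, c⟩ hx
      simp only [Finset.mem_filter, Finset.mem_univ, true_and] at hx
      exact ⟨(a, b, c), by simp only [Finset.mem_filter, Finset.mem_univ, true_and];
                           linear_combination hx, rfl⟩
  rw [← h3] at h
  have h4 := h.trans (Nat.mul_le_mul h1 h2)
  refine (Nat.pow_le_pow_iff_left two_ne_zero).1 ?_
  calc _ ≤ _ := h4
    _ = _ := by ring

theorem box_coord_injective {q : ℕ} [NeZero q] {M : ℤ} (hM : IsCoprime M q) {v a x y : ℤ}
    (hx : a ≤ x) (hy : a ≤ y) (h1 : ((x - a) / q).toNat = ((y - a) / q).toNat)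
    (h2 : ((v + M * x : ℤ) : ZMod q) = ((v + M * y : ℤ) : ZMod q)) : x = y := by
  have hq : (0:ℤ) < q := by exact_mod_cast Nat.pos_of_ne_zero (NeZero.ne q)
  have h3 : (x - a) / q = (y - a) / q := by
    have e1 := Int.ediv_nonneg (sub_nonneg.2 hx) hq.le
    have e2 := Int.ediv_nonneg (sub_nonneg.2 hy) hq.le
    omega
  have h4 : (q : ℤ) ∣ M * (y - x) := by
    have := (ZMod.intCast_eq_intCast_iff_dvd_sub _ _ _).1 h2
    convert this using 1
    ring
  have h5 : (q : ℤ) ∣ y - x := hM.symm.dvd_of_dvd_mul_left h4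
  have h6 : (x - a) % q = (y - a) % q := by
    refine Int.modEq_iff_dvd.2 ?_
    rwa [sub_sub_sub_cancel_right]
  have h7 := Int.mul_ediv_add_emod (x - a) q
  have h8 := Int.mul_ediv_add_emod (y - a) q
  rw [h3, h6] at h7
  linarith

theorem card_affine_le (q L : ℕ) [NeZero q] (M : ℤ) (hM : IsCoprime M q) (v0 a : ℤ × ℤ × ℤ)
    (s : Finset (ℤ × ℤ × ℤ))
    (h1 : ∀ u ∈ s, (a.1 ≤ u.1 ∧ u.1 < a.1 + L) ∧ (a.2.1 ≤ u.2.1 ∧ u.2.1 < a.2.1 + L) ∧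
      (a.2.2 ≤ u.2.2 ∧ u.2.2 < a.2.2 + L))
    (h2 : ∀ u ∈ s, (q : ℤ) ∣ (v0.1 + M * u.1) ^ 2 + (v0.2.1 + M * u.2.1) ^ 2 +
      (v0.2.2 + M * u.2.2) ^ 2) :
    s.card ≤ (L / q + 1) ^ 3 * coneCount q := by
  have hq : (0:ℤ) < q := by exact_mod_cast Nat.pos_of_ne_zero (NeZero.ne q)
  have hb : ∀ {x b : ℤ}, b ≤ x → x < b + L → ((x - b) / q).toNat < L / q + 1 := by
    intro x b h h'
    have e1 := Int.ediv_nonneg (sub_nonneg.2 h) hq.le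
    have e2 : (x - b) / q ≤ (L : ℤ) / q := Int.ediv_le_ediv hq (by linarith)
    have e3 : ((L / q : ℕ) : ℤ) = (L : ℤ) / q := by push_cast; rfl
    omega
  calc s.card ≤ ((Finset.range (L / q + 1) ×ˢ Finset.range (L / q + 1) ×ˢ
        Finset.range (L / q + 1)) ×ˢ (Finset.univ.filter
        (fun x : ZMod q × ZMod q × ZMod q => x.1 ^ 2 + x.2.1 ^ 2 + x.2.2 ^ 2 = 0))).card := by
        refine Finset.card_le_card_of_injOn (fun u =>
          ((((u.1 - a.1) / q).toNat, ((u.2.1 - a.2.1) / q).toNat, ((u.2.2 - a.2.2) / q).toNat),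
          (((v0.1 + M * u.1 : ℤ) : ZMod q), ((v0.2.1 + M * u.2.1 : ℤ) : ZMod q),
            ((v0.2.2 + M * u.2.2 : ℤ) : ZMod q)))) ?_ ?_
        · intro u hu
          obtain ⟨⟨a1, a2⟩, ⟨a3, a4⟩, a5, a6⟩ := h1 u hu
          have := (ZMod.intCast_zmod_eq_zero_iff_dvd _ q).2 (h2 u hu)
          push_cast at this
          simp only [Finset.coe_product, Finset.coe_range, Set.mem_prod, Set.mem_Iio,
            Finset.coe_filter, Finset.mem_univ, true_and, Set.mem_ofPred_eq]
          refine ⟨⟨hb a1 a2, hb a3 a4, hb a5 a6⟩, ?_⟩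
          push_cast
          exact this
        · intro u hu w hw huw
          obtain ⟨⟨a1, a2⟩, ⟨a3, a4⟩, a5, a6⟩ := h1 u hu
          obtain ⟨⟨b1, b2⟩, ⟨b3, b4⟩, b5, b6⟩ := h1 w hw
          simp only [Prod.mk.injEq] at huw
          obtain ⟨⟨c1, c2, c3⟩, d1, d2, d3⟩ := huw
          refine Prod.ext ?_ (Prod.ext ?_ ?_)
          · exact box_coord_injective hM a1 b1 c1 d1
          · exact box_coord_injective hM a3 b3 c2 d2
          · exact box_coord_injective hM a5 b5 c3 d3
    _ = _ := by
        simp only [Finset.card_product, Finset.card_range, coneCount]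
        ring

theorem coneCount_le_rpow (ε : ℝ) (hε : 0 < ε) : ∃ C > (0:ℝ), ∀ (q : ℕ) [NeZero q],
    (coneCount q : ℝ) ≤ C * (q : ℝ) ^ (2 + ε) := by
  obtain ⟨C, hC, h⟩ := card_divisors_le_rpow ε hε
  refine ⟨2 * C, by positivity, fun q _ => ?_⟩
  have hq : (0:ℝ) < q := by exact_mod_cast Nat.pos_of_ne_zero (NeZero.ne q)
  have h1 : (coneCount q : ℝ) ≤ 2 * (q:ℝ) ^ 2 * (q.divisors.card : ℝ) := by
    exact_mod_cast coneCount_le q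
  refine h1.trans ?_
  rw [Real.rpow_add hq, Real.rpow_two]
  have := h q (NeZero.ne q)
  calc _ ≤ 2 * (q:ℝ) ^ 2 * (C * (q:ℝ) ^ ε) := by gcongr
    _ = _ := by ring

theorem mem_zball_coord {T : ℕ} {v : ℤ × ℤ × ℤ} (h : v ∈ zball T) :
    (-(Nat.sqrt T : ℤ) ≤ v.1 ∧ v.1 ≤ Nat.sqrt T) ∧ (-(Nat.sqrt T : ℤ) ≤ v.2.1 ∧ v.2.1 ≤ Nat.sqrt T) ∧
    (-(Nat.sqrt T : ℤ) ≤ v.2.2 ∧ v.2.2 ≤ Nat.sqrt T) := by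
  rw [mem_zball] at h
  unfold nsq at h
  have h1 : v.1.natAbs ≤ Nat.sqrt T := Nat.le_sqrt'.2 (by omega)
  have h2 : v.2.1.natAbs ≤ Nat.sqrt T := Nat.le_sqrt'.2 (by omega)
  have h3 : v.2.2.natAbs ≤ Nat.sqrt T := Nat.le_sqrt'.2 (by omega)
  omega

theorem card_sq_dvd_le : ∃ C > (0:ℝ), ∀ n T : ℕ, 1 ≤ n →
    (((zball T).filter (fun v => v ≠ 0 ∧ n ^ 2 ∣ nsq v)).card : ℝ) ≤
      C * (T : ℝ) ^ (3 / 2 : ℝ) * (n : ℝ) ^ (-(3 / 2) : ℝ) := by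
  obtain ⟨C1, hC1, h1⟩ := coneCount_le_rpow (1 / 4) (by norm_num)
  obtain ⟨C2, hC2, h2⟩ := r3_le_rpow (1 / 8) (by norm_num)
  refine ⟨64 * C1 + C2, by positivity, fun n T hn => ?_⟩
  have hn0 : (0:ℝ) < n := by exact_mod_cast hn
  have hn1 : (1:ℝ) ≤ n := by exact_mod_cast hn
  have hT0 : (0:ℝ) ≤ T := by positivity
  rcases lt_or_ge T (n ^ 2) with hA | hA
  · have : (zball T).filter (fun v => v ≠ 0 ∧ n ^ 2 ∣ nsq v) = ∅ := by
      rw [Finset.filter_eq_empty_iff]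
      rintro v hv ⟨h0, hd⟩
      have := Nat.le_of_dvd (Nat.pos_of_ne_zero (fun h => h0 (nsq_eq_zero.1 h))) hd
      have := mem_zball.1 hv
      omega
    rw [this]
    simp only [Finset.card_empty, Nat.cast_zero]
    positivity
  have hT1 : (0:ℝ) < T := by
    have : 0 < n ^ 2 := by positivity
    exact_mod_cast this.trans_le hA
  rcases le_or_gt (n ^ 4) T with hB | hB
  · set s := Nat.sqrt T with hs
    have hsn : n ^ 2 ≤ s := Nat.le_sqrt'.2 (by rw [← pow_mul]; exact hB)
    have : NeZero (n ^ 2) := ⟨by positivity⟩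
    have h3 := card_affine_le (n ^ 2) (2 * s + 1) 1 isCoprime_one_left (0, 0, 0) (-s, -s, -s)
      ((zball T).filter (fun v => v ≠ 0 ∧ n ^ 2 ∣ nsq v)) (by
        intro u hu
        have := mem_zball_coord (Finset.mem_filter.1 hu).1
        push_cast
        omega) (by
        intro u hu
        have := Int.natCast_dvd_natCast.2 (Finset.mem_filter.1 hu).2.2
        rw [nsq_int] at this
        simpa using this)
    have hs0 : (1:ℝ) ≤ s := by
      have : 1 ≤ n ^ 2 := Nat.one_le_pow _ _ hn
      exact_mod_cast this.trans hsn
    have hsn' : (n:ℝ) ^ 2 ≤ s := by exact_mod_cast hsn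
    have h4 : (((2 * s + 1) / n ^ 2 + 1 : ℕ) : ℝ) ≤ 4 * s / (n:ℝ) ^ 2 := by
      push_cast
      have : (((2 * s + 1) / n ^ 2 : ℕ) : ℝ) ≤ (2 * s + 1) / (n:ℝ) ^ 2 := by
        refine Nat.cast_div_le.trans ?_
        push_cast; rfl
      refine (add_le_add_left this 1).trans ?_
      rw [div_add_one (by positivity)]
      gcongr
      linarith
    have h5 : (s:ℝ) ≤ (T:ℝ) ^ (1 / 2 : ℝ) := by
      rw [← Real.sqrt_eq_rpow]
      exact Real.nat_sqrt_le_real_sqrt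
    have h6 : (((zball T).filter (fun v => v ≠ 0 ∧ n ^ 2 ∣ nsq v)).card : ℝ) ≤
        (4 * (T:ℝ) ^ (1 / 2 : ℝ) / (n:ℝ) ^ 2) ^ 3 * (C1 * ((n:ℝ) ^ 2) ^ (2 + 1 / 4 : ℝ)) := by
      have h7 := h1 (n ^ 2)
      push_cast at h7
      calc _ ≤ ((((2 * s + 1) / n ^ 2 + 1 : ℕ) ^ 3 * coneCount (n ^ 2) : ℕ) : ℝ) := by
            exact_mod_cast h3
        _ ≤ _ := by
            rw [Nat.cast_mul, Nat.cast_pow]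
            gcongr
            refine h4.trans ?_
            gcongr
    refine h6.trans ?_
    have e1 : ((T:ℝ) ^ (1 / 2 : ℝ)) ^ 3 = (T:ℝ) ^ (3 / 2 : ℝ) := by
      rw [← Real.rpow_natCast, ← Real.rpow_mul hT0]; norm_num
    have e2 : ((n:ℝ) ^ 2) ^ (2 + 1 / 4 : ℝ) = (n:ℝ) ^ (-(3/2) : ℝ) * (n:ℝ) ^ 6 := by
      rw [← Real.rpow_natCast, ← Real.rpow_natCast, ← Real.rpow_mul hn0.le, ← Real.rpow_add hn0]
      norm_num
    rw [e2, div_pow, mul_pow, e1]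
    have e3 : (4:ℝ) ^ 3 * (T:ℝ) ^ (3 / 2 : ℝ) / ((n:ℝ) ^ 2) ^ 3 * (C1 * ((n:ℝ) ^ (-(3/2) : ℝ) * (n:ℝ) ^ 6))
        = 64 * C1 * (T:ℝ) ^ (3 / 2 : ℝ) * (n:ℝ) ^ (-(3/2) : ℝ) := by
      field_simp
      norm_num
    rw [e3]
    gcongr
    linarith
  · have h3 : ((zball T).filter (fun v => v ≠ 0 ∧ n ^ 2 ∣ nsq v)).card ≤
        ∑ j ∈ Finset.Icc 1 (T / n ^ 2), r3 (n ^ 2 * j) := by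
      rw [Finset.card_eq_sum_card_fiberwise (f := fun v => nsq v / n ^ 2)
        (t := Finset.Icc 1 (T / n ^ 2))]
      · refine Finset.sum_le_sum fun j _ => ?_
        refine Finset.card_le_card ?_
        intro v hv
        simp only [Finset.mem_filter, mem_zball] at hv ⊢
        obtain ⟨⟨_, _, hd⟩, rfl⟩ := hv
        rw [Nat.mul_div_cancel' hd]
        simp
      · intro v hv
        simp only [Finset.coe_filter, mem_zball, Set.mem_ofPred_eq] at hv
        simp only [Finset.coe_Icc, Set.mem_Icc]
        refine ⟨?_, Nat.div_le_div_right hv.1⟩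
        rw [Nat.one_le_div_iff (by positivity)]
        exact Nat.le_of_dvd (Nat.pos_of_ne_zero (fun h => hv.2.1 (nsq_eq_zero.1 h))) hv.2.2
    have h4 : ∀ j ∈ Finset.Icc 1 (T / n ^ 2), (r3 (n ^ 2 * j) : ℝ) ≤ C2 * (T:ℝ) ^ (1 / 2 + 1 / 8 : ℝ) := by
      intro j hj
      rw [Finset.mem_Icc] at hj
      refine (h2 _ (by have : 0 < n ^ 2 := by positivity
                       have := Nat.mul_pos this hj.1
                       omega)).trans ?_
      gcongr
      have := Nat.mul_le_mul_left (n ^ 2) hj.2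
      exact this.trans (Nat.mul_div_le _ _)
    have h5 : (((zball T).filter (fun v => v ≠ 0 ∧ n ^ 2 ∣ nsq v)).card : ℝ) ≤
        (T / (n:ℝ) ^ 2) * (C2 * (T:ℝ) ^ (1 / 2 + 1 / 8 : ℝ)) := by
      calc _ ≤ ((∑ j ∈ Finset.Icc 1 (T / n ^ 2), r3 (n ^ 2 * j) : ℕ) : ℝ) := by exact_mod_cast h3
        _ ≤ ∑ j ∈ Finset.Icc 1 (T / n ^ 2), C2 * (T:ℝ) ^ (1 / 2 + 1 / 8 : ℝ) := by
            push_cast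
            exact Finset.sum_le_sum fun j hj => by simpa using h4 j hj
        _ = ((T / n ^ 2 : ℕ) : ℝ) * (C2 * (T:ℝ) ^ (1 / 2 + 1 / 8 : ℝ)) := by simp
        _ ≤ _ := by
            gcongr
            refine Nat.cast_div_le.trans ?_
            push_cast; rfl
    refine h5.trans ?_
    have e1 : (T:ℝ) * (T:ℝ) ^ (1 / 2 + 1 / 8 : ℝ) = (T:ℝ) ^ (3 / 2 : ℝ) * (T:ℝ) ^ (1 / 8 : ℝ) := by
      rw [← Real.rpow_add hT1, ← Real.rpow_one_add' hT0 (by norm_num)]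
      norm_num
    have e2 : (T:ℝ) ^ (1 / 8 : ℝ) ≤ (n:ℝ) ^ (1 / 2 : ℝ) := by
      have : (T:ℝ) ≤ (n:ℝ) ^ (4:ℝ) := by
        have : T ≤ n ^ 4 := hB.le
        exact_mod_cast this
      calc _ ≤ ((n:ℝ) ^ (4:ℝ)) ^ (1 / 8 : ℝ) := by gcongr
        _ = _ := by rw [← Real.rpow_mul hn0.le]; norm_num
    have e3 : (n:ℝ) ^ (-(3/2) : ℝ) * (n:ℝ) ^ 2 = (n:ℝ) ^ (1 / 2 : ℝ) := by
      rw [← Real.rpow_natCast, ← Real.rpow_add hn0]; norm_num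
    calc _ = C2 * ((T:ℝ) * (T:ℝ) ^ (1 / 2 + 1 / 8 : ℝ)) / (n:ℝ) ^ 2 := by ring
      _ = C2 * ((T:ℝ) ^ (3 / 2 : ℝ) * (T:ℝ) ^ (1 / 8 : ℝ)) / (n:ℝ) ^ 2 := by rw [e1]
      _ ≤ C2 * ((T:ℝ) ^ (3 / 2 : ℝ) * (n:ℝ) ^ (1 / 2 : ℝ)) / (n:ℝ) ^ 2 := by gcongr
      _ = C2 * (T:ℝ) ^ (3 / 2 : ℝ) * (n:ℝ) ^ (-(3/2) : ℝ) := by rw [← e3]; field_simp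
      _ ≤ _ := by
        gcongr
        have : 0 < 64 * C1 := by positivity
        linarith

theorem exists_sum_rpow_lt (ε : ℝ) (hε : 0 < ε) : ∃ J : ℕ, ∀ s : Finset ℕ, (∀ n ∈ s, J < n) →
    ∑ n ∈ s, (n : ℝ) ^ (-(3 / 2) : ℝ) < ε := by
  have h : Summable (fun n : ℕ => (n : ℝ) ^ (-(3 / 2) : ℝ)) :=
    Real.summable_nat_rpow.2 (by norm_num)
  obtain ⟨s, hs⟩ := summable_iff_vanishing_norm.1 h ε hε
  refine ⟨s.sup id, fun t ht => ?_⟩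
  refine (le_abs_self _).trans_lt (hs t ?_)
  rw [Finset.disjoint_left]
  intro a ha hs'
  have := Finset.le_sup (f := id) hs'
  exact absurd (ht a ha) (not_lt.2 this)

theorem card_squarefree_aux : ∃ M Y0 : ℕ, 0 < M ∧ ∀ Y ≥ Y0,
    (Y : ℝ) ^ 3 / 2 ≤ (((zball (M * Y ^ 2)).filter (fun v => Squarefree (nsq v))).card : ℝ) := by
  obtain ⟨C1, hC1, h1⟩ := coneCount_le_rpow (1 / 4) (by norm_num)
  obtain ⟨C2, hC2, h2⟩ := card_sq_dvd_le
  obtain ⟨J, hJ⟩ := exists_sum_rpow_lt (1 / (32 * C1)) (by positivity)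
  set M := J.factorial ^ 2 with hM
  have hM0 : 0 < M := by positivity
  set M' := 12 * M ^ 2 with hM'
  obtain ⟨Q, hQ⟩ := exists_sum_rpow_lt (1 / (4 * C2 * (M':ℝ) ^ (3 / 2 : ℝ))) (by positivity)
  refine ⟨M', (Q + 1) ^ 2, by positivity, fun Y hY => ?_⟩
  have hY1 : 1 ≤ Y := le_trans (Nat.one_le_pow _ _ (by omega)) hY
  set T := M' * Y ^ 2 with hT
  set B : Finset (ℤ × ℤ × ℤ) := Finset.Ico (0:ℤ) Y ×ˢ Finset.Ico (0:ℤ) Y ×ˢ Finset.Ico (0:ℤ) Y with hB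
  set φ : ℤ × ℤ × ℤ → ℤ × ℤ × ℤ := fun u => (1 + M * u.1, M * u.2.1, M * u.2.2) with hφ
  have hφinj : Function.Injective φ := by
    intro u w huw
    have hMz : (M:ℤ) ≠ 0 := by positivity
    simp only [hφ, Prod.mk.injEq] at huw
    obtain ⟨e1, e2, e3⟩ := huw
    exact Prod.ext (mul_left_cancel₀ hMz (add_left_cancel e1))
      (Prod.ext (mul_left_cancel₀ hMz e2) (mul_left_cancel₀ hMz e3))
  have hBmem : ∀ u ∈ B, (0 ≤ u.1 ∧ u.1 < Y) ∧ (0 ≤ u.2.1 ∧ u.2.1 < Y) ∧ (0 ≤ u.2.2 ∧ u.2.2 < Y) := by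
    intro u hu
    simpa [hB] using hu
  have hφball : ∀ u ∈ B, φ u ∈ zball T := by
    intro u hu
    obtain ⟨⟨a1, a2⟩, ⟨a3, a4⟩, a5, a6⟩ := hBmem u hu
    rw [mem_zball]
    zify
    rw [nsq_int, hT, hM', hφ]
    push_cast
    have hMz : (1:ℤ) ≤ M := by exact_mod_cast hM0
    have hYz : (1:ℤ) ≤ Y := by exact_mod_cast hY1
    have b1 : (M:ℤ) * u.1 ≤ M * Y := by gcongr
    have b2 : (M:ℤ) * u.2.1 ≤ M * Y := by gcongr
    have b3 : (M:ℤ) * u.2.2 ≤ M * Y := by gcongr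
    have c1 : (0:ℤ) ≤ M * u.1 := by positivity
    have c2 : (0:ℤ) ≤ M * u.2.1 := by positivity
    have c3 : (0:ℤ) ≤ M * u.2.2 := by positivity
    have d : (1:ℤ) ≤ M * Y := by nlinarith
    have e1 : (1 + (M:ℤ) * u.1) ^ 2 ≤ (2 * (M * Y)) ^ 2 := by gcongr; linarith
    have e2 : ((M:ℤ) * u.2.1) ^ 2 ≤ (2 * (M * Y)) ^ 2 :=
      pow_le_pow_left₀ c2 (by linarith) 2
    have e3 : ((M:ℤ) * u.2.2) ^ 2 ≤ (2 * (M * Y)) ^ 2 :=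
      pow_le_pow_left₀ c3 (by linarith) 2
    nlinarith
  have hφ0 : ∀ u ∈ B, φ u ≠ 0 := by
    intro u hu h
    have : 1 + (M:ℤ) * u.1 = 0 := congrArg Prod.fst h
    have c1 : (0:ℤ) ≤ M * u.1 := mul_nonneg (by positivity) (hBmem u hu).1.1
    omega
  have hcop : ∀ p : ℕ, p.Prime → J < p → Nat.Coprime M p := by
    intro p hp hpJ
    rw [hM]
    refine Nat.Coprime.pow_left _ (Nat.Coprime.symm ?_)
    rw [Nat.Prime.coprime_iff_not_dvd hp, hp.dvd_factorial]
    omega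
  have hdivJ : ∀ u ∈ B, ∀ p : ℕ, p.Prime → p ^ 2 ∣ nsq (φ u) → J < p := by
    intro u hu p hp hd
    by_contra hpJ
    have h3 : p ^ 2 ∣ M := pow_dvd_pow_of_dvd ((hp.dvd_factorial).2 (not_lt.1 hpJ)) 2
    have h4 : ((p:ℤ) ^ 2) ∣ (nsq (φ u) : ℤ) := by exact_mod_cast hd
    have h5 : ((p:ℤ) ^ 2) ∣ (M : ℤ) := by exact_mod_cast h3
    rw [nsq_int] at h4
    have h6 : (p:ℤ) ^ 2 ∣ 1 := by
      have h7 : (M:ℤ) ∣ (φ u).1 ^ 2 + (φ u).2.1 ^ 2 + (φ u).2.2 ^ 2 - 1 :=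
        ⟨2 * u.1 + M * u.1 ^ 2 + M * u.2.1 ^ 2 + M * u.2.2 ^ 2, by simp only [hφ]; ring⟩
      have := dvd_sub h4 (h5.trans h7)
      simpa using this
    have h7 : p ^ 2 ∣ 1 := by exact_mod_cast h6
    have := hp.two_le
    have := Nat.le_of_dvd one_pos h7
    nlinarith
  set bad : ℕ → Finset (ℤ × ℤ × ℤ) := fun p => B.filter (fun u => p ^ 2 ∣ nsq (φ u)) with hbad
  set Ps := (Finset.Icc 1 T).filter (fun p => p.Prime ∧ J < p) with hPs
  have hsub : B ⊆ (B.filter (fun u => Squarefree (nsq (φ u)))) ∪ Ps.biUnion bad := by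
    intro u hu
    by_cases hs : Squarefree (nsq (φ u))
    · exact Finset.mem_union_left _ (Finset.mem_filter.2 ⟨hu, hs⟩)
    · refine Finset.mem_union_right _ ?_
      rw [Nat.squarefree_iff_prime_squarefree] at hs
      push Not at hs
      obtain ⟨p, hp, hd⟩ := hs
      rw [← sq] at hd
      refine Finset.mem_biUnion.2 ⟨p, Finset.mem_filter.2 ⟨Finset.mem_Icc.2 ⟨hp.one_le, ?_⟩, hp,
        hdivJ u hu p hp hd⟩, Finset.mem_filter.2 ⟨hu, hd⟩⟩
      have h3 := Nat.le_of_dvd (Nat.pos_of_ne_zero fun h => hφ0 u hu (nsq_eq_zero.1 h)) hd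
      have h4 := mem_zball.1 (hφball u hu)
      exact (Nat.le_self_pow two_ne_zero p).trans (h3.trans h4)
  have hcard : B.card = Y ^ 3 := by
    simp only [hB, Finset.card_product, Int.card_Ico, sub_zero, Int.toNat_natCast]; ring
  have hYpos : (0:ℝ) < Y := by exact_mod_cast hY1
  have hsmall : ∀ p ∈ Ps, p ^ 2 ≤ Y → ((bad p).card : ℝ) ≤ 8 * C1 * (Y:ℝ) ^ 3 * (p:ℝ) ^ (-(3/2) : ℝ) := by
    intro p hp hpY
    obtain ⟨_, hpp, hpJ⟩ := Finset.mem_filter.1 hp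
    have hp0 : (0:ℝ) < p := by exact_mod_cast hpp.pos
    have : NeZero (p ^ 2) := ⟨by have := hpp.pos; positivity⟩
    have h3 := card_affine_le (p ^ 2) Y M (by
      rw [Nat.isCoprime_iff_coprime]
      exact (hcop p hpp hpJ).pow_right 2) (1, 0, 0) (0, 0, 0) (bad p) (by
        intro u hu
        have := hBmem u (Finset.mem_filter.1 hu).1
        simpa using this) (by
        intro u hu
        have := Int.natCast_dvd_natCast.2 (Finset.mem_filter.1 hu).2
        rw [nsq_int] at this
        simpa [hφ] using this)
    have hpY' : (p:ℝ) ^ 2 ≤ Y := by exact_mod_cast hpY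
    have h4 : ((Y / p ^ 2 + 1 : ℕ) : ℝ) ≤ 2 * Y / (p:ℝ) ^ 2 := by
      push_cast
      have : ((Y / p ^ 2 : ℕ) : ℝ) ≤ Y / (p:ℝ) ^ 2 := by
        refine Nat.cast_div_le.trans ?_
        push_cast; rfl
      refine (add_le_add_left this 1).trans ?_
      rw [div_add_one (by positivity)]
      gcongr
      linarith
    have h7 := h1 (p ^ 2)
    push_cast at h7
    have e2 : ((p:ℝ) ^ 2) ^ (2 + 1 / 4 : ℝ) = (p:ℝ) ^ (-(3/2) : ℝ) * (p:ℝ) ^ 6 := by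
      rw [← Real.rpow_natCast, ← Real.rpow_natCast, ← Real.rpow_mul hp0.le, ← Real.rpow_add hp0]
      norm_num
    calc _ ≤ (((Y / p ^ 2 + 1 : ℕ) ^ 3 * coneCount (p ^ 2) : ℕ) : ℝ) := by
          exact_mod_cast h3
      _ ≤ (2 * Y / (p:ℝ) ^ 2) ^ 3 * (C1 * ((p:ℝ) ^ 2) ^ (2 + 1 / 4 : ℝ)) := by
          rw [Nat.cast_mul, Nat.cast_pow]
          gcongr
      _ = _ := by
          rw [e2]
          field_simp
          norm_num
  have hT0 : (0:ℝ) ≤ T := by positivity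
  have hbig : ∀ p ∈ Ps, ((bad p).card : ℝ) ≤ C2 * (T:ℝ) ^ (3/2:ℝ) * (p:ℝ) ^ (-(3/2) : ℝ) := by
    intro p hp
    obtain ⟨_, hpp, hpJ⟩ := Finset.mem_filter.1 hp
    refine le_trans ?_ (h2 p T hpp.one_le)
    have : (bad p).card ≤ ((zball T).filter (fun v => v ≠ 0 ∧ p ^ 2 ∣ nsq v)).card := by
      refine Finset.card_le_card_of_injOn φ ?_ hφinj.injOn
      intro u hu
      obtain ⟨hu1, hu2⟩ := Finset.mem_filter.1 hu
      exact Finset.mem_filter.2 ⟨hφball u hu1, hφ0 u hu1, hu2⟩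
    exact_mod_cast this
  have hT32 : (T:ℝ) ^ (3/2:ℝ) = (M':ℝ) ^ (3/2:ℝ) * (Y:ℝ) ^ 3 := by
    rw [hT]
    push_cast
    rw [Real.mul_rpow (by positivity) (by positivity)]
    congr 1
    rw [← Real.rpow_natCast, ← Real.rpow_mul hYpos.le, ← Real.rpow_natCast]
    norm_num
  have hsum : ∑ p ∈ Ps, ((bad p).card : ℝ) ≤ (Y:ℝ) ^ 3 / 2 := by
    rw [← Finset.sum_filter_add_sum_filter_not Ps (fun p => p ^ 2 ≤ Y)]
    have g1 : ∑ p ∈ Ps.filter (fun p => p ^ 2 ≤ Y), ((bad p).card : ℝ) ≤ (Y:ℝ) ^ 3 / 4 := by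
      calc _ ≤ ∑ p ∈ Ps.filter (fun p => p ^ 2 ≤ Y), 8 * C1 * (Y:ℝ) ^ 3 * (p:ℝ) ^ (-(3/2) : ℝ) :=
            Finset.sum_le_sum fun p hp => hsmall p (Finset.mem_filter.1 hp).1 (Finset.mem_filter.1 hp).2
        _ = 8 * C1 * (Y:ℝ) ^ 3 * ∑ p ∈ Ps.filter (fun p => p ^ 2 ≤ Y), (p:ℝ) ^ (-(3/2) : ℝ) := by
            rw [Finset.mul_sum]
        _ ≤ 8 * C1 * (Y:ℝ) ^ 3 * (1 / (32 * C1)) := by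
            gcongr
            refine (hJ _ fun n hn => ?_).le
            exact (Finset.mem_filter.1 (Finset.mem_filter.1 hn).1).2.2
        _ = _ := by field_simp; norm_num
    have g2 : ∑ p ∈ Ps.filter (fun p => ¬ p ^ 2 ≤ Y), ((bad p).card : ℝ) ≤ (Y:ℝ) ^ 3 / 4 := by
      calc _ ≤ ∑ p ∈ Ps.filter (fun p => ¬ p ^ 2 ≤ Y), C2 * (T:ℝ) ^ (3/2:ℝ) * (p:ℝ) ^ (-(3/2) : ℝ) :=
            Finset.sum_le_sum fun p hp => hbig p (Finset.mem_filter.1 hp).1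
        _ = C2 * (T:ℝ) ^ (3/2:ℝ) * ∑ p ∈ Ps.filter (fun p => ¬ p ^ 2 ≤ Y), (p:ℝ) ^ (-(3/2) : ℝ) := by
            rw [Finset.mul_sum]
        _ ≤ C2 * (T:ℝ) ^ (3/2:ℝ) * (1 / (4 * C2 * (M':ℝ) ^ (3 / 2 : ℝ))) := by
            gcongr
            refine (hQ _ fun n hn => ?_).le
            have := (Finset.mem_filter.1 hn).2
            have h9 : Q ^ 2 < n ^ 2 := by
              have : Q ^ 2 ≤ (Q + 1) ^ 2 := Nat.pow_le_pow_left (Nat.le_succ Q) 2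
              omega
            exact lt_of_pow_lt_pow_left₀ 2 (Nat.zero_le _) h9
        _ = _ := by
            have : (0:ℝ) < (M':ℝ) ^ (3/2:ℝ) := by positivity
            rw [hT32]; field_simp
    linarith
  have hfin : B.card ≤ (B.filter (fun u => Squarefree (nsq (φ u)))).card + ∑ p ∈ Ps, (bad p).card :=
    (Finset.card_le_card hsub).trans ((Finset.card_union_le _ _).trans
      (Nat.add_le_add_left Finset.card_biUnion_le _))
  have hle : (B.filter (fun u => Squarefree (nsq (φ u)))).card ≤
      ((zball T).filter (fun v => Squarefree (nsq v))).card := by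
    refine Finset.card_le_card_of_injOn φ ?_ hφinj.injOn
    intro u hu
    obtain ⟨hu1, hu2⟩ := Finset.mem_filter.1 hu
    exact Finset.mem_filter.2 ⟨hφball u hu1, hu2⟩
  have hfin' : ((Y:ℝ)) ^ 3 ≤ (((zball T).filter (fun v => Squarefree (nsq v))).card : ℝ) +
      ∑ p ∈ Ps, ((bad p).card : ℝ) := by
    rw [hcard] at hfin
    exact_mod_cast hfin.trans (Nat.add_le_add_right hle _)
  linarith

theorem sum_mul_eq_abel (a w : ℕ → ℝ) (N : ℕ) :
    ∑ j ∈ Finset.Icc 1 N, a j * w j = (∑ j ∈ Finset.Icc 1 N, a j) * w (N + 1) +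
      ∑ j ∈ Finset.Icc 1 N, (∑ i ∈ Finset.Icc 1 j, a i) * (w j - w (j + 1)) := by
  induction N with
  | zero => simp
  | succ N ih =>
    rw [Finset.sum_Icc_succ_top (by omega), ih, Finset.sum_Icc_succ_top (by omega) a,
      Finset.sum_Icc_succ_top (by omega), Finset.sum_Icc_succ_top (by omega) a]
    ring

theorem sum_Icc_inv_le (N : ℕ) : ∑ j ∈ Finset.Icc 1 N, (1 : ℝ) / j ≤ 1 + Real.log N := by
  have h := harmonic_le_one_add_log N
  rw [harmonic_eq_sum_Icc] at h
  push_cast at h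
  simpa [one_div] using h

theorem log_le_sum_Icc_inv (N : ℕ) : Real.log (N + 1) ≤ ∑ j ∈ Finset.Icc 1 N, (1 : ℝ) / j := by
  have h := log_add_one_le_harmonic N
  rw [harmonic_eq_sum_Icc] at h
  push_cast at h
  simpa [one_div] using h

theorem rpow_three_halves_sq (j : ℕ) : ((j : ℝ) ^ (3 / 2 : ℝ)) ^ 2 = (j : ℝ) ^ 3 := by
  rw [← Real.rpow_natCast, ← Real.rpow_mul (by positivity), ← Real.rpow_natCast]
  norm_num

theorem weight_sub_bounds (j : ℕ) (hj : 1 ≤ j) :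
    (j : ℝ) ^ (3 / 2 : ℝ) * ((j : ℝ) ^ (-(3 / 2) : ℝ) - ((j + 1 : ℕ) : ℝ) ^ (-(3 / 2) : ℝ)) ≤ 4 * (1 / j) ∧
    1 / 8 * (1 / j) ≤
      (j : ℝ) ^ (3 / 2 : ℝ) * ((j : ℝ) ^ (-(3 / 2) : ℝ) - ((j + 1 : ℕ) : ℝ) ^ (-(3 / 2) : ℝ)) ∧
    0 ≤ (j : ℝ) ^ (-(3 / 2) : ℝ) - ((j + 1 : ℕ) : ℝ) ^ (-(3 / 2) : ℝ) := by
  rw [Real.rpow_neg (by positivity), Real.rpow_neg (by positivity)]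
  have hj0 : (1:ℝ) ≤ j := by exact_mod_cast hj
  have hb := rpow_three_halves_sq j
  have hb' := rpow_three_halves_sq (j + 1)
  have hle : (j : ℝ) ^ (3 / 2 : ℝ) ≤ ((j + 1 : ℕ) : ℝ) ^ (3 / 2 : ℝ) := by gcongr; omega
  have hpos : 0 < (j : ℝ) ^ (3 / 2 : ℝ) := by positivity
  have hpos' : 0 < ((j + 1 : ℕ) : ℝ) ^ (3 / 2 : ℝ) := by positivity
  set b := (j : ℝ) ^ (3 / 2 : ℝ)
  set b' := ((j + 1 : ℕ) : ℝ) ^ (3 / 2 : ℝ)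
  push_cast at hb'
  have e : b * (b⁻¹ - b'⁻¹) = (b' - b) / b' := by field_simp
  have hx : (0:ℝ) < j := by linarith
  generalize (j:ℝ) = x at *
  have hd : (b' - b) * (b' + b) = 3 * x ^ 2 + 3 * x + 1 := by
    have : (b' - b) * (b' + b) = b' ^ 2 - b ^ 2 := by ring
    rw [this, hb, hb']; ring
  have hbb : b ^ 2 ≤ b' ^ 2 := by gcongr
  rw [e]
  refine ⟨?_, ?_, ?_⟩
  · rw [mul_one_div, div_le_div_iff₀ hpos' hx]
    have h1 : (b' - b) * x * b' ≤ 4 * b' * b' := by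
      calc (b' - b) * x * b' ≤ (b' - b) * x * (b' + b) := by
            have : 0 ≤ (b' - b) * x := mul_nonneg (by linarith) hx.le
            exact mul_le_mul_of_nonneg_left (by linarith) this
        _ = (3 * x ^ 2 + 3 * x + 1) * x := by rw [← hd]; ring
        _ ≤ 4 * (x + 1) ^ 3 := by nlinarith [pow_pos hx 3, pow_pos hx 2]
        _ = _ := by rw [← hb']; ring
    exact le_of_mul_le_mul_right h1 hpos'
  · rw [← mul_div_assoc, mul_one, div_le_div_iff₀ hx hpos']
    have h1 : 1 / 8 * b' * (2 * b') ≤ (b' - b) * x * (2 * b') := by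
      calc 1 / 8 * b' * (2 * b') = 1 / 4 * (x + 1) ^ 3 := by rw [← hb']; ring
        _ ≤ (3 * x ^ 2 + 3 * x + 1) * x := by
            nlinarith [mul_nonneg (sub_nonneg.2 hj0) (sub_nonneg.2 hj0), pow_pos hx 3, pow_pos hx 2,
              mul_nonneg (mul_nonneg (sub_nonneg.2 hj0) (sub_nonneg.2 hj0)) hx.le]
        _ = (b' - b) * x * (b' + b) := by rw [← hd]; ring
        _ ≤ _ := by
            have : 0 ≤ (b' - b) * x := mul_nonneg (by linarith) hx.le
            exact mul_le_mul_of_nonneg_left (by linarith) this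
    exact le_of_mul_le_mul_right h1 (by positivity)
  · rw [sub_nonneg]
    gcongr

theorem sum_mul_rpow_le (a : ℕ → ℝ) (B : ℝ) (hB : 0 ≤ B) (N : ℕ)
    (h : ∀ T : ℕ, 1 ≤ T → ∑ j ∈ Finset.Icc 1 T, a j ≤ B * (T : ℝ) ^ (3 / 2 : ℝ)) :
    ∑ j ∈ Finset.Icc 1 N, a j * (j : ℝ) ^ (-(3 / 2) : ℝ) ≤ 5 * B * (1 + Real.log N) := by
  rcases Nat.eq_zero_or_pos N with rfl | hN
  · simp; positivity
  rw [sum_mul_eq_abel a (fun j : ℕ => (j : ℝ) ^ (-(3 / 2) : ℝ))]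
  have h1 : (∑ j ∈ Finset.Icc 1 N, a j) * ((N + 1 : ℕ) : ℝ) ^ (-(3 / 2) : ℝ) ≤ B := by
    calc _ ≤ B * (N : ℝ) ^ (3 / 2 : ℝ) * ((N + 1 : ℕ) : ℝ) ^ (-(3 / 2) : ℝ) := by
          gcongr; exact h N hN
      _ ≤ B * ((N + 1 : ℕ) : ℝ) ^ (3 / 2 : ℝ) * ((N + 1 : ℕ) : ℝ) ^ (-(3 / 2) : ℝ) := by
          gcongr; omega
      _ = B := by
          rw [mul_assoc, ← Real.rpow_add (by positivity)]; simp
  have h2 : ∑ j ∈ Finset.Icc 1 N, (∑ i ∈ Finset.Icc 1 j, a i) *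
      ((j : ℝ) ^ (-(3 / 2) : ℝ) - ((j + 1 : ℕ) : ℝ) ^ (-(3 / 2) : ℝ)) ≤
      ∑ j ∈ Finset.Icc 1 N, 4 * B * (1 / j) := by
    refine Finset.sum_le_sum fun j hj => ?_
    have hj1 := (Finset.mem_Icc.1 hj).1
    obtain ⟨w1, _, w3⟩ := weight_sub_bounds j hj1
    calc _ ≤ (B * (j : ℝ) ^ (3 / 2 : ℝ)) *
          ((j : ℝ) ^ (-(3 / 2) : ℝ) - ((j + 1 : ℕ) : ℝ) ^ (-(3 / 2) : ℝ)) :=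
          mul_le_mul_of_nonneg_right (h j hj1) w3
      _ ≤ B * (4 * (1 / j)) := by rw [mul_assoc]; exact mul_le_mul_of_nonneg_left w1 hB
      _ = _ := by ring
  have h3 := sum_Icc_inv_le N
  rw [← Finset.mul_sum] at h2
  have h4 : 0 ≤ Real.log N := Real.log_natCast_nonneg N
  have h5 : 4 * B * ∑ j ∈ Finset.Icc 1 N, (1:ℝ) / j ≤ 4 * B * (1 + Real.log N) := by gcongr
  have h6 : 0 ≤ B * Real.log N := by positivity
  linarith

theorem log_le_sum_mul_rpow (a : ℕ → ℝ) (ha : ∀ j, 0 ≤ a j) (b : ℝ) (hb : 0 < b) (T0 : ℕ)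
    (h : ∀ T : ℕ, T0 ≤ T → b * (T : ℝ) ^ (3 / 2 : ℝ) ≤ ∑ j ∈ Finset.Icc 1 T, a j) :
    ∃ c > (0:ℝ), ∃ N0 : ℕ, ∀ N ≥ N0,
      c * Real.log N ≤ ∑ j ∈ Finset.Icc 1 N, a j * (j : ℝ) ^ (-(3 / 2) : ℝ) := by
  have hlim : Filter.Tendsto (fun N : ℕ => Real.log N) Filter.atTop Filter.atTop :=
    Real.tendsto_log_atTop.comp tendsto_natCast_atTop_atTop
  obtain ⟨N0, hN0⟩ := Filter.eventually_atTop.1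
    (hlim.eventually_ge_atTop (2 * (1 + Real.log T0)))
  refine ⟨b / 16, by positivity, max N0 T0, fun N hN => ?_⟩
  have hNN0 : N0 ≤ N := (le_max_left _ _).trans hN
  have hNT0 : T0 ≤ N := (le_max_right _ _).trans hN
  rw [sum_mul_eq_abel a (fun j : ℕ => (j : ℝ) ^ (-(3 / 2) : ℝ))]
  have hA : ∀ j, 0 ≤ ∑ i ∈ Finset.Icc 1 j, a i := fun j => Finset.sum_nonneg fun i _ => ha i
  have h1 : 0 ≤ (∑ j ∈ Finset.Icc 1 N, a j) * ((N + 1 : ℕ) : ℝ) ^ (-(3 / 2) : ℝ) :=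
    mul_nonneg (hA N) (by positivity)
  have h2 : ∑ j ∈ Finset.Icc 1 N, b / 8 * (1 / j) - ∑ j ∈ Finset.Icc 1 T0, b / 8 * (1 / j) ≤
      ∑ j ∈ Finset.Icc 1 N, (∑ i ∈ Finset.Icc 1 j, a i) *
      ((j : ℝ) ^ (-(3 / 2) : ℝ) - ((j + 1 : ℕ) : ℝ) ^ (-(3 / 2) : ℝ)) := by
    have hsub : Finset.Icc 1 T0 ⊆ Finset.Icc 1 N := Finset.Icc_subset_Icc_right hNT0
    rw [← Finset.sum_sdiff_eq_sub hsub]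
    calc _ ≤ ∑ j ∈ Finset.Icc 1 N \ Finset.Icc 1 T0, (∑ i ∈ Finset.Icc 1 j, a i) *
          ((j : ℝ) ^ (-(3 / 2) : ℝ) - ((j + 1 : ℕ) : ℝ) ^ (-(3 / 2) : ℝ)) := by
          refine Finset.sum_le_sum fun j hj => ?_
          simp only [Finset.mem_sdiff, Finset.mem_Icc, not_and, not_le] at hj
          obtain ⟨_, w2, w3⟩ := weight_sub_bounds j hj.1.1
          calc b / 8 * (1 / j) = b * (1 / 8 * (1 / j)) := by ring
            _ ≤ b * ((j : ℝ) ^ (3 / 2 : ℝ) *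
              ((j : ℝ) ^ (-(3 / 2) : ℝ) - ((j + 1 : ℕ) : ℝ) ^ (-(3 / 2) : ℝ))) :=
                mul_le_mul_of_nonneg_left w2 hb.le
            _ ≤ _ := by
                rw [← mul_assoc]
                exact mul_le_mul_of_nonneg_right (h j (hj.2 hj.1.1).le) w3
      _ ≤ _ := by
          refine Finset.sum_le_sum_of_subset_of_nonneg Finset.sdiff_subset fun j hj _ => ?_
          exact mul_nonneg (hA j) (weight_sub_bounds j (Finset.mem_Icc.1 hj).1).2.2
  rw [← Finset.mul_sum, ← Finset.mul_sum] at h2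
  have h3 := sum_Icc_inv_le T0
  have h4 := log_le_sum_Icc_inv N
  have h5 := hN0 N hNN0
  have h6 : Real.log N ≤ Real.log (N + 1) := by
    rcases Nat.eq_zero_or_pos N with rfl | hN
    · simp
    · exact Real.log_le_log (by exact_mod_cast hN) (by linarith)
  have h7 : b / 8 * (Real.log N / 2) ≤ b / 8 * ((∑ j ∈ Finset.Icc 1 N, (1:ℝ) / j) -
      ∑ j ∈ Finset.Icc 1 T0, (1:ℝ) / j) := by
    gcongr
    linarith
  rw [mul_sub] at h7
  linarith

theorem sum_r3_filter_eq (P : ℕ → Prop) [DecidablePred P] (T : ℕ) (f : ℕ → ℕ)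
    (hf : Function.Injective f) (s : Finset ℕ) (hs : ∀ j ∈ s, f j ≤ T ∧ P (f j)) :
    ∑ j ∈ s, r3 (f j) ≤ ((zball T).filter (fun v => P (nsq v))).card := by
  unfold r3
  rw [← Finset.card_biUnion]
  · refine Finset.card_le_card fun v hv => ?_
    simp only [Finset.mem_biUnion, Finset.mem_filter, mem_zball] at hv ⊢
    obtain ⟨j, hj, _, h⟩ := hv
    rw [h]
    exact hs j hj
  · intro i _ j _ hij
    rw [Function.onFun, Finset.disjoint_left]
    intro v hv hv'
    exact hij (hf ((Finset.mem_filter.1 hv).2.symm.trans (Finset.mem_filter.1 hv').2))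

theorem sum_r3_sq_mul_le : ∃ C > (0:ℝ), ∀ k N : ℕ, 1 ≤ k →
    ∑ j ∈ Finset.Icc 1 N, (r3 (j * k ^ 2) : ℝ) * ((j * k ^ 2 : ℕ) : ℝ) ^ (-(3 / 2) : ℝ) ≤
      C * (k : ℝ) ^ (-(3 / 2) : ℝ) * (1 + Real.log N) := by
  obtain ⟨C, hC, h⟩ := card_sq_dvd_le
  refine ⟨5 * C, by positivity, fun k N hk => ?_⟩
  have hk0 : (0:ℝ) < k := by exact_mod_cast hk
  have e1 : ((k:ℝ) ^ 2) ^ (3 / 2 : ℝ) = (k:ℝ) ^ 3 := by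
    rw [← Real.rpow_natCast, ← Real.rpow_mul hk0.le, ← Real.rpow_natCast]; norm_num
  have e2 : ((k:ℝ) ^ 2) ^ (-(3 / 2) : ℝ) * (k:ℝ) ^ 3 = 1 := by
    rw [Real.rpow_neg (by positivity), e1]; field_simp
  have key := sum_mul_rpow_le (fun j => (r3 (j * k ^ 2) : ℝ)) (C * (k:ℝ) ^ 3 * (k:ℝ) ^ (-(3/2) : ℝ))
    (by positivity) N (by
      intro T hT
      have h1 := sum_r3_filter_eq (fun n => n ≠ 0 ∧ k ^ 2 ∣ n) (T * k ^ 2) (fun j => j * k ^ 2)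
        (fun x y hxy => Nat.eq_of_mul_eq_mul_right (by positivity) hxy) (Finset.Icc 1 T) (by
          intro j hj
          obtain ⟨hj1, hj2⟩ := Finset.mem_Icc.1 hj
          exact ⟨Nat.mul_le_mul_right _ hj2, by positivity, Dvd.intro_left _ rfl⟩)
      have h2 := h k (T * k ^ 2) hk
      simp only [ne_eq, nsq_eq_zero] at h1
      have h3 : (∑ j ∈ Finset.Icc 1 T, (r3 (j * k ^ 2) : ℝ)) ≤ _ :=
        le_trans (by exact_mod_cast h1) h2
      refine h3.trans (le_of_eq ?_)
      push_cast
      rw [Real.mul_rpow (by positivity) (by positivity), e1]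
      ring)
  calc _ = ((k:ℝ) ^ 2) ^ (-(3 / 2) : ℝ) *
        ∑ j ∈ Finset.Icc 1 N, (r3 (j * k ^ 2) : ℝ) * (j:ℝ) ^ (-(3 / 2) : ℝ) := by
        rw [Finset.mul_sum]
        refine Finset.sum_congr rfl fun j _ => ?_
        push_cast
        rw [Real.mul_rpow (by positivity) (by positivity)]
        ring
    _ ≤ ((k:ℝ) ^ 2) ^ (-(3 / 2) : ℝ) *
        (5 * (C * (k:ℝ) ^ 3 * (k:ℝ) ^ (-(3/2) : ℝ)) * (1 + Real.log N)) := by gcongr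
    _ = (((k:ℝ) ^ 2) ^ (-(3 / 2) : ℝ) * (k:ℝ) ^ 3) *
        (5 * C * (k:ℝ) ^ (-(3/2) : ℝ) * (1 + Real.log N)) := by ring
    _ = _ := by rw [e2, one_mul]

theorem log_le_sum_r3_squarefree : ∃ c > (0:ℝ), ∃ N0 : ℕ, ∀ N ≥ N0,
    c * Real.log N ≤ ∑ m ∈ (Finset.Icc 1 N).filter Squarefree,
      (r3 m : ℝ) * (m : ℝ) ^ (-(3 / 2) : ℝ) := by
  obtain ⟨M, Y0, hM, h⟩ := card_squarefree_aux
  have hM0 : (0:ℝ) < M := by exact_mod_cast hM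
  obtain ⟨c, hc, N0, hN⟩ := log_le_sum_mul_rpow (fun j => if Squarefree j then (r3 j : ℝ) else 0)
    (by intro j; split_ifs <;> positivity) (1 / (16 * (M:ℝ) ^ (3/2:ℝ))) (by positivity)
    (M * (Y0 + 1) ^ 2) (by
      intro T hT
      set Y := Nat.sqrt (T / M) with hY
      have hY1 : Y0 + 1 ≤ Y := by
        rw [hY, Nat.le_sqrt', Nat.le_div_iff_mul_le hM, mul_comm]; exact hT
      have hle : M * Y ^ 2 ≤ T := by
        have := Nat.sqrt_le' (T / M)
        rw [Nat.le_div_iff_mul_le hM] at this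
        rw [mul_comm]; exact this
      have hge : T ≤ M * (2 * Y) ^ 2 := by
        have h1 := Nat.succ_le_succ_sqrt' (T / M)
        have h2 : T < (T / M + 1) * M := Nat.lt_mul_of_div_lt (Nat.lt_succ_self _) hM
        have h3 : T / M + 1 ≤ (2 * Y) ^ 2 := h1.trans (Nat.pow_le_pow_left (by omega) 2)
        exact h2.le.trans (by rw [mul_comm M]; exact Nat.mul_le_mul_right _ h3)
      have h1 := h Y (by omega)
      have h2 : ((zball (M * Y ^ 2)).filter (fun v => Squarefree (nsq v))).card ≤
          ∑ j ∈ (Finset.Icc 1 T).filter Squarefree, r3 j := by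
        rw [Finset.card_eq_sum_card_fiberwise (f := nsq) (t := (Finset.Icc 1 T).filter Squarefree)]
        · refine Finset.sum_le_sum fun j _ => Finset.card_le_card fun v hv => ?_
          simp only [Finset.mem_filter, mem_zball] at hv ⊢
          exact ⟨hv.2.le, hv.2⟩
        · intro v hv
          simp only [Finset.coe_filter, mem_zball, Set.mem_ofPred_eq, Finset.mem_Icc] at hv ⊢
          exact ⟨⟨Nat.pos_of_ne_zero hv.2.ne_zero, hv.1.trans hle⟩, hv.2⟩
      rw [← Finset.sum_filter]
      have h3 : (((zball (M * Y ^ 2)).filter (fun v => Squarefree (nsq v))).card : ℝ) ≤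
          ∑ j ∈ (Finset.Icc 1 T).filter Squarefree, (r3 j : ℝ) := by exact_mod_cast h2
      refine le_trans ?_ (h1.trans h3)
      have h4 : (T:ℝ) ^ (3/2:ℝ) ≤ (M:ℝ) ^ (3/2:ℝ) * (8 * (Y:ℝ) ^ 3) := by
        calc (T:ℝ) ^ (3/2:ℝ) ≤ ((M * (2 * Y) ^ 2 : ℕ) : ℝ) ^ (3/2:ℝ) := by gcongr
          _ = (M:ℝ) ^ (3/2:ℝ) * (2 * (Y:ℝ)) ^ 3 := by
            push_cast
            rw [Real.mul_rpow (by positivity) (by positivity)]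
            congr 1
            rw [← Real.rpow_natCast, ← Real.rpow_mul (by positivity), ← Real.rpow_natCast]
            norm_num
          _ = _ := by ring
      rw [one_div, inv_mul_le_iff₀ (by positivity)]
      linarith)
  refine ⟨c, hc, N0, fun N hN' => (hN N hN').trans (le_of_eq ?_)⟩
  rw [Finset.sum_filter]
  refine Finset.sum_congr rfl fun j _ => ?_
  split_ifs <;> simp

/-- `HtLe l H u`: `u` lies in the ring generated over `ℤ` by the square roots of the entries of `l`,
with integer coordinates of size at most `H`. -/
def HtLe : List ℕ → ℕ → ℝ → Prop
  | [], H, u => ∃ n : ℤ, u = n ∧ n.natAbs ≤ H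
  | m :: l, H, u => ∃ x y, HtLe l H x ∧ HtLe l H y ∧ u = x + y * √m

theorem HtLe.mono {l : List ℕ} {H H' : ℕ} (h : H ≤ H') : ∀ {u : ℝ}, HtLe l H u → HtLe l H' u := by
  induction l with
  | nil => rintro u ⟨n, rfl, hn⟩; exact ⟨n, rfl, hn.trans h⟩
  | cons m l ih => rintro u ⟨x, y, hx, hy, rfl⟩; exact ⟨x, y, ih hx, ih hy, rfl⟩

theorem HtLe.intCast (l : List ℕ) (n : ℤ) : HtLe l n.natAbs n := by
  induction l with
  | nil => exact ⟨n, rfl, le_rfl⟩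
  | cons m l ih =>
    refine ⟨n, 0, ih, ?_, by simp⟩
    clear ih
    induction l with
    | nil => exact ⟨0, by simp, by simp⟩
    | cons m l ih => exact ⟨0, 0, ih, ih, by simp⟩

theorem HtLe.add {l : List ℕ} {H H' : ℕ} : ∀ {u v : ℝ}, HtLe l H u → HtLe l H' v →
    HtLe l (H + H') (u + v) := by
  induction l with
  | nil =>
    rintro u v ⟨n, rfl, hn⟩ ⟨k, rfl, hk⟩
    exact ⟨n + k, by push_cast; ring, by omega⟩
  | cons m l ih =>
    rintro u v ⟨x, y, hx, hy, rfl⟩ ⟨x', y', hx', hy', rfl⟩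
    exact ⟨x + x', y + y', ih hx hx', ih hy hy', by ring⟩

theorem HtLe.intMul {l : List ℕ} {H : ℕ} (n : ℤ) : ∀ {u : ℝ}, HtLe l H u →
    HtLe l (n.natAbs * H) (n * u) := by
  induction l with
  | nil =>
    rintro u ⟨k, rfl, hk⟩
    exact ⟨n * k, by push_cast; ring, by rw [Int.natAbs_mul]; exact Nat.mul_le_mul_left _ hk⟩
  | cons m l ih =>
    rintro u ⟨x, y, hx, hy, rfl⟩
    exact ⟨n * x, n * y, ih hx, ih hy, by ring⟩

theorem HtLe.mul {l : List ℕ} {N : ℕ} (hN : 1 ≤ N) (hl : ∀ m ∈ l, m ≤ N) {H H' : ℕ} :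
    ∀ {u v : ℝ}, HtLe l H u → HtLe l H' v → HtLe l ((1 + N) ^ l.length * (H * H')) (u * v) := by
  induction l with
  | nil =>
    rintro u v ⟨n, rfl, hn⟩ ⟨k, rfl, hk⟩
    refine ⟨n * k, by push_cast; ring, ?_⟩
    rw [Int.natAbs_mul]
    simpa using Nat.mul_le_mul hn hk
  | cons m l ih =>
    rintro u v ⟨x, y, hx, hy, rfl⟩ ⟨x', y', hx', hy', rfl⟩
    have hm : m ≤ N := hl m List.mem_cons_self
    have ih' := @ih (fun m hm => hl m (List.mem_cons_of_mem _ hm))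
    set Q := (1 + N) ^ l.length * (H * H') with hQ
    have e : (1 + N) ^ (m :: l).length * (H * H') = Q + N * Q := by
      rw [hQ, List.length_cons]; ring
    refine ⟨x * x' + (m : ℤ) * (y * y'), x * y' + y * x', ?_, ?_, ?_⟩
    · rw [e]
      refine ((ih' hx hx').add ((ih' hy hy').intMul m)).mono ?_
      gcongr
      simpa using hm
    · rw [e]
      refine ((ih' hx hy').add (ih' hy hx')).mono ?_
      nlinarith [Nat.zero_le Q]
    · have : (√(m:ℝ)) ^ 2 = m := Real.sq_sqrt (by positivity)
      push_cast
      linear_combination y * y' * this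

theorem HtLe.abs_le {l : List ℕ} {N : ℕ} (hN : 1 ≤ N) (hl : ∀ m ∈ l, m ≤ N) {H : ℕ} :
    ∀ {u : ℝ}, HtLe l H u → |u| ≤ ((1 + N) ^ l.length * H : ℕ) := by
  induction l with
  | nil =>
    rintro u ⟨n, rfl, hn⟩
    simp only [List.length_nil, pow_zero, one_mul]
    rw [← Int.cast_abs, Int.abs_eq_natAbs]
    exact_mod_cast hn
  | cons m l ih =>
    rintro u ⟨x, y, hx, hy, rfl⟩
    have hm : m ≤ N := hl m List.mem_cons_self
    have ih' := @ih (fun m hm => hl m (List.mem_cons_of_mem _ hm))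
    have h1 := ih' hx
    have h2 := ih' hy
    have h3 : √(m:ℝ) ≤ N := by
      have hmN : (m:ℝ) ≤ N := by exact_mod_cast hm
      have hN1 : (1:ℝ) ≤ N := by exact_mod_cast hN
      rw [Real.sqrt_le_left (by positivity)]
      nlinarith
    calc |x + y * √m| ≤ |x| + |y| * √m := by
          refine (abs_add_le _ _).trans ?_
          rw [abs_mul, abs_of_nonneg (Real.sqrt_nonneg (m:ℝ))]
      _ ≤ ((1 + N) ^ l.length * H : ℕ) + ((1 + N) ^ l.length * H : ℕ) * (N:ℝ) := by gcongr
      _ = _ := by push_cast [List.length_cons]; ring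

theorem HtLe.gap (r : ℕ) : ∃ e : ℕ, ∀ (l : List ℕ) (N H : ℕ), l.length = r → 1 ≤ N → 1 ≤ H →
    (∀ m ∈ l, m ≤ N) → ∀ u : ℝ, HtLe l H u → u ≠ 0 → 1 ≤ |u| * ((((1 + N) * H : ℕ) : ℝ)) ^ e := by
  induction r with
  | zero =>
    refine ⟨0, ?_⟩
    rintro l N H hl - - - u hu hu0
    rw [List.length_eq_zero_iff] at hl
    subst hl
    obtain ⟨n, rfl, -⟩ := hu
    have hn : n ≠ 0 := by rintro rfl; simp at hu0
    have : 1 ≤ |n| := Int.one_le_abs hn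
    rw [pow_zero, mul_one]
    exact_mod_cast this
  | succ r ih =>
    obtain ⟨e, he⟩ := ih
    refine ⟨(r + 2) * e + (r + 1), ?_⟩
    rintro (_ | ⟨m, l⟩) N H hlen hN hH hl u hu hu0
    · simp at hlen
    have hlr : l.length = r := by simpa using hlen
    have hlN : ∀ m ∈ l, m ≤ N := fun m hm => hl m (List.mem_cons_of_mem _ hm)
    have hm : m ≤ N := hl m List.mem_cons_self
    have hbarle : ∀ z, HtLe (m :: l) H z → |z| ≤ (((1 + N) * H : ℕ) : ℝ) ^ (r + 1) := by
      intro z hz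
      refine (hz.abs_le hN hl).trans ?_
      rw [hlen]
      have : (1 + N) ^ (r + 1) * H ≤ ((1 + N) * H) ^ (r + 1) := by
        rw [mul_pow]
        exact Nat.mul_le_mul_left _ (Nat.le_self_pow (by omega) H)
      exact_mod_cast this
    obtain ⟨x, y, hx, hy, rfl⟩ := hu
    set A : ℝ := (((1 + N) * H : ℕ) : ℝ) with hA
    have hA1 : 1 ≤ A := by
      have : 1 ≤ (1 + N) * H := Nat.mul_pos (by omega) hH
      rw [hA]; exact_mod_cast this
    have hsq : (√(m:ℝ)) ^ 2 = m := Real.sq_sqrt (by positivity)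
    by_cases hbar : x - y * √m = 0
    · have hx0 : x ≠ 0 := by
        rintro rfl
        apply hu0
        linarith
      have h1 := he l N H hlr hN hH hlN x hx hx0
      have h2 : x + y * √m = 2 * x := by linarith
      rw [h2, abs_mul, abs_two]
      calc 1 ≤ |x| * A ^ e := h1
        _ ≤ (2 * |x|) * A ^ ((r + 2) * e + (r + 1)) := by
            gcongr
            · linarith [abs_nonneg x]
            · nlinarith [Nat.zero_le (r * e)]
    · have hy' : HtLe l H (-y) := by simpa using hy.intMul (-1)
      have hbar' : HtLe (m :: l) H (x - y * √m) := ⟨x, -y, hx, hy', by ring⟩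
      have hprod : HtLe l ((1 + N) ^ (r + 1) * H ^ 2) ((x + y * √m) * (x - y * √m)) := by
        have e1 : (x + y * √m) * (x - y * √m) = x * x + ((-(m:ℤ) : ℤ) : ℝ) * (y * y) := by
          push_cast
          linear_combination - y ^ 2 * hsq
        rw [e1]
        refine ((hx.mul hN hlN hx).add ((hy.mul hN hlN hy).intMul (-(m:ℤ)))).mono ?_
        rw [hlr]
        simp only [Int.natAbs_neg, Int.natAbs_natCast]
        calc _ ≤ (1 + N) ^ r * (H * H) + N * ((1 + N) ^ r * (H * H)) := by gcongr
          _ = _ := by ring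
      have h0 : (x + y * √m) * (x - y * √m) ≠ 0 := mul_ne_zero hu0 hbar
      have h1 := he l N _ hlr hN (Nat.mul_pos (by positivity) (by positivity)) hlN _ hprod h0
      rw [abs_mul] at h1
      have h2 := hbarle _ hbar'
      have h3 : ((((1 + N) * ((1 + N) ^ (r + 1) * H ^ 2) : ℕ)) : ℝ) ≤ A ^ (r + 2) := by
        have : (1 + N) * ((1 + N) ^ (r + 1) * H ^ 2) ≤ ((1 + N) * H) ^ (r + 2) := by
          calc _ = (1 + N) ^ (r + 2) * H ^ 2 := by ring
            _ ≤ (1 + N) ^ (r + 2) * H ^ (r + 2) :=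
              Nat.mul_le_mul_left _ (Nat.pow_le_pow_right hH (by omega))
            _ = _ := by rw [mul_pow]
        rw [hA]; exact_mod_cast this
      calc 1 ≤ |x + y * √m| * |x - y * √m| *
            ((((1 + N) * ((1 + N) ^ (r + 1) * H ^ 2) : ℕ)) : ℝ) ^ e := h1
        _ ≤ |x + y * √m| * A ^ (r + 1) * (A ^ (r + 2)) ^ e := by gcongr
        _ = _ := by rw [← pow_mul, pow_add]; ring

theorem htLe_sum_sqrt (l : List (ℤ × ℕ)) (hl : ∀ a ∈ l, a.1.natAbs ≤ 1) :
    HtLe (l.map Prod.snd) 1 ((l.map (fun a => (a.1 : ℝ) * √a.2)).sum) := by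
  induction l with
  | nil => exact ⟨0, by simp, by simp⟩
  | cons a l ih =>
    refine ⟨_, a.1, ih fun a ha => hl a (List.mem_cons_of_mem _ ha),
      (HtLe.intCast _ _).mono (hl a List.mem_cons_self), ?_⟩
    simp only [List.map_cons, List.sum_cons]
    ring

theorem sum_sqrt_sub_gap (k : ℕ) : ∃ e : ℕ, ∀ N : ℕ, 1 ≤ N → ∀ x y : Fin k → ℕ,
    (∀ i, x i ≤ N) → (∀ i, y i ≤ N) → ∑ i, √(x i : ℝ) ≠ ∑ i, √(y i : ℝ) →
    1 ≤ |∑ i, √(x i : ℝ) - ∑ i, √(y i : ℝ)| * ((1 + N : ℕ) : ℝ) ^ e := by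
  obtain ⟨e, he⟩ := HtLe.gap (k + k)
  refine ⟨e, fun N hN x y hx hy hne => ?_⟩
  set l : List (ℤ × ℕ) := List.ofFn (fun i => ((1:ℤ), x i)) ++ List.ofFn (fun i => ((-1:ℤ), y i)) with hl
  have h1 := htLe_sum_sqrt l (by
    intro a ha
    rw [hl, List.mem_append, List.mem_ofFn, List.mem_ofFn] at ha
    rcases ha with ⟨i, rfl⟩ | ⟨i, rfl⟩ <;> simp)
  have h2 : (l.map (fun a => (a.1 : ℝ) * √a.2)).sum = ∑ i, √(x i : ℝ) - ∑ i, √(y i : ℝ) := by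
    rw [hl, List.map_append, List.sum_append, List.map_ofFn, List.map_ofFn, List.sum_ofFn, List.sum_ofFn]
    simp [Function.comp_def, sub_eq_add_neg]
  rw [h2] at h1
  have h3 := he _ N 1 (by simp [hl]) hN le_rfl (by
    intro m hm
    rw [List.mem_map] at hm
    obtain ⟨a, ha, rfl⟩ := hm
    rw [hl, List.mem_append, List.mem_ofFn, List.mem_ofFn] at ha
    rcases ha with ⟨i, rfl⟩ | ⟨i, rfl⟩
    · exact hx i
    · exact hy i) _ h1 (sub_ne_zero.2 hne)
  simpa using h3

theorem trace_eq_zero_of_sq_eq {K : Type*} [Field K] [Algebra ℚ K] [FiniteDimensional ℚ K] (α : K) (d : ℕ)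
    (hd : ¬ IsSquare d) (h : α ^ 2 = (d : K)) : Algebra.trace ℚ K α = 0 := by
  have hirr : Irreducible (Polynomial.X ^ 2 - Polynomial.C (d:ℚ)) := by
    rw [X_pow_sub_C_irreducible_iff_of_prime Nat.prime_two]
    intro b hb
    apply hd
    rw [← Rat.isSquare_natCast_iff]
    exact ⟨b, by rw [← hb, sq]⟩
  have hmin := minpoly.eq_of_irreducible_of_monic (x := α) hirr (by simp [h])
    (Polynomial.monic_X_pow_sub_C _ two_ne_zero)
  rw [trace_eq_finrank_mul_minpoly_nextCoeff, ← hmin, Polynomial.nextCoeff_of_natDegree_pos]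
  · rw [Polynomial.natDegree_X_pow_sub_C]
    simp [Polynomial.coeff_C]
  · rw [Polynomial.natDegree_X_pow_sub_C]; norm_num

theorem not_isSquare_mul_of_squarefree {m n : ℕ} (hm : Squarefree m) (hn : Squarefree n) (h : m ≠ n) :
    ¬ IsSquare (m * n) := by
  rintro ⟨r, hr⟩
  apply h
  have key : ∀ {m n : ℕ}, Squarefree m → m * n = r * r → ∀ p : ℕ, p.Prime → p ∣ m → p ∣ n := by
    intro m n hm hr p hp hpm
    by_contra hpn
    have h1 : p ∣ r := by
      have : p ∣ r * r := hr ▸ hpm.mul_right n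
      exact (hp.dvd_mul.1 this).elim id id
    have h2 : p * p ∣ m * n := hr ▸ mul_dvd_mul h1 h1
    have h3 : Nat.Coprime (p * p) n := by
      have := (hp.coprime_iff_not_dvd).2 hpn
      exact Nat.Coprime.mul_left this this
    have := hm p (h3.dvd_of_dvd_mul_right h2)
    exact hp.one_lt.ne' (Nat.isUnit_iff.1 this)
  rw [Nat.Squarefree.ext_iff hm hn]
  exact fun p hp => ⟨key hm hr p hp, key hn ((mul_comm _ _).trans hr) p hp⟩

theorem sqrt_squarefree_independent (S : Finset ℕ) (hS : ∀ m ∈ S, Squarefree m) (c : ℕ → ℤ)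
    (h : ∑ m ∈ S, (c m : ℝ) * √(m:ℝ) = 0) : ∀ m ∈ S, c m = 0 := by
  intro m0 hm0
  let K := IntermediateField.adjoin ℚ ((fun m : ℕ => √(m:ℝ)) '' (S : Set ℕ))
  have hfin : FiniteDimensional ℚ K := by
    apply IntermediateField.finiteDimensional_adjoin
    rintro _ ⟨m, -, rfl⟩
    refine ⟨Polynomial.X ^ 2 - Polynomial.C (m:ℚ), Polynomial.monic_X_pow_sub_C _ two_ne_zero, ?_⟩
    simp [Real.sq_sqrt]
  have hmem : ∀ m ∈ S, √(m:ℝ) ∈ K := fun m hm =>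
    IntermediateField.subset_adjoin _ _ ⟨m, hm, rfl⟩
  let g : ℕ → K := fun m => if hm : m ∈ S then ⟨√(m:ℝ), hmem m hm⟩ else 0
  have hg : ∀ m ∈ S, ((g m : K) : ℝ) = √(m:ℝ) := fun m hm => by simp [g, hm]
  have hgsq : ∀ m ∈ S, g m ^ 2 = (m : K) := by
    intro m hm
    apply Subtype.ext
    push_cast
    rw [hg m hm, Real.sq_sqrt (by positivity)]
  have h1 : ∑ m ∈ S, (c m : ℚ) • (g m * g m0) = 0 := by
    have h2 : ∑ m ∈ S, (c m : K) * g m = 0 := by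
      apply Subtype.ext
      push_cast
      rw [← h]
      exact Finset.sum_congr rfl fun m hm => by rw [hg m hm]
    calc _ = (∑ m ∈ S, (c m : K) * g m) * g m0 := by
          rw [Finset.sum_mul]
          refine Finset.sum_congr rfl fun m _ => ?_
          rw [Algebra.smul_def, mul_assoc]; simp
      _ = 0 := by rw [h2, zero_mul]
  have h3 := congrArg (Algebra.trace ℚ K) h1
  rw [map_sum, map_zero, Finset.sum_eq_single_of_mem m0 hm0] at h3
  · have h4 : g m0 * g m0 = algebraMap ℚ K (m0:ℚ) := by rw [← sq, hgsq m0 hm0]; simp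
    rw [map_smul, h4, Algebra.trace_algebraMap] at h3
    have hm0' : (m0:ℚ) ≠ 0 := by exact_mod_cast (hS m0 hm0).ne_zero
    have hfr : (Module.finrank ℚ K : ℚ) ≠ 0 := by exact_mod_cast Module.finrank_pos.ne'
    simpa [hm0', hfr] using h3
  · intro m hm hne
    rw [map_smul, trace_eq_zero_of_sq_eq (g m * g m0) (m * m0)
      (not_isSquare_mul_of_squarefree (hS m hm) (hS m0 hm0) hne), smul_zero]
    rw [mul_pow, hgsq m hm, hgsq m0 hm0]; push_cast; ring

theorem exists_perm_of_sum_sqrt_eq {k : ℕ} (x y : Fin k → ℕ) (hx : ∀ i, Squarefree (x i))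
    (hy : ∀ i, Squarefree (y i)) (h : ∑ i, √(x i : ℝ) = ∑ i, √(y i : ℝ)) :
    ∃ σ : Equiv.Perm (Fin k), x = y ∘ σ := by
  classical
  set S : Finset ℕ := Finset.univ.image x ∪ Finset.univ.image y with hS
  have hxS : ∀ i, x i ∈ S := fun i => Finset.mem_union_left _ (Finset.mem_image_of_mem _ (Finset.mem_univ i))
  have hyS : ∀ i, y i ∈ S := fun i => Finset.mem_union_right _ (Finset.mem_image_of_mem _ (Finset.mem_univ i))
  have hsum : ∀ z : Fin k → ℕ, (∀ i, z i ∈ S) → ∑ i, √(z i : ℝ) =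
      ∑ m ∈ S, ((Finset.univ.filter (fun i => z i = m)).card : ℝ) * √(m:ℝ) := by
    intro z hz
    rw [← Finset.sum_fiberwise_of_maps_to (s := Finset.univ) (t := S) (g := z) (fun i _ => hz i)]
    refine Finset.sum_congr rfl fun m _ => ?_
    rw [Finset.sum_congr rfl (g := fun _ => √(m:ℝ))]
    · simp
    · intro i hi
      rw [(Finset.mem_filter.1 hi).2]
  have h1 := sqrt_squarefree_independent S (by
    intro m hm
    rw [hS, Finset.mem_union, Finset.mem_image, Finset.mem_image] at hm
    rcases hm with ⟨i, -, rfl⟩ | ⟨i, -, rfl⟩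
    · exact hx i
    · exact hy i) (fun m => ((Finset.univ.filter (fun i => x i = m)).card : ℤ) -
      ((Finset.univ.filter (fun i => y i = m)).card : ℤ)) (by
      push_cast
      simp only [sub_mul, Finset.sum_sub_distrib]
      rw [← hsum x hxS, ← hsum y hyS, h, sub_self])
  have h2 : ∀ m, Nonempty ({i // x i = m} ≃ {i // y i = m}) := by
    intro m
    rw [← Fintype.card_eq, Fintype.card_subtype, Fintype.card_subtype]
    by_cases hm : m ∈ S
    · have := h1 m hm
      omega
    · rw [Finset.card_eq_zero.2, Finset.card_eq_zero.2]
      · rw [Finset.filter_eq_empty_iff]; rintro i - rfl; exact hm (hyS i)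
      · rw [Finset.filter_eq_empty_iff]; rintro i - rfl; exact hm (hxS i)
  let e := fun m => (h2 m).some
  refine ⟨(Equiv.sigmaFiberEquiv x).symm.trans ((Equiv.sigmaCongrRight e).trans
    (Equiv.sigmaFiberEquiv y)), ?_⟩
  funext i
  exact ((e (x i) ⟨i, rfl⟩).2).symm

theorem norm_integral_exp_le (s a b : ℝ) (hs : s ≠ 0) :
    ‖∫ t in a..b, Complex.exp (Complex.I * s * t)‖ ≤ 2 / |s| := by
  have hs' : Complex.I * (s:ℂ) ≠ 0 := mul_ne_zero Complex.I_ne_zero (by exact_mod_cast hs)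
  rw [integral_exp_mul_complex hs', norm_div]
  have h1 : ‖Complex.I * (s:ℂ)‖ = |s| := by simp
  rw [h1]
  gcongr
  refine (norm_sub_le _ _).trans ?_
  have : ∀ t : ℝ, ‖Complex.exp (Complex.I * s * t)‖ = 1 := by
    intro t
    rw [Complex.norm_exp]; simp
  rw [this, this]; norm_num

theorem sum_sqrt_coincidence_le (k : ℕ) (S : Finset ℕ) (hS : ∀ m ∈ S, Squarefree m) (β : ℕ → ℝ) :
    ∑ x ∈ Fintype.piFinset (fun _ : Fin k => S), ∑ y ∈ Fintype.piFinset (fun _ : Fin k => S),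
      (if ∑ i, √(x i : ℝ) = ∑ i, √(y i : ℝ) then |(∏ i, β (x i)) * ∏ i, β (y i)| else 0) ≤
      k.factorial * (∑ m ∈ S, β m ^ 2) ^ k := by
  calc _ ≤ ∑ x ∈ Fintype.piFinset (fun _ : Fin k => S), ∑ y ∈ Fintype.piFinset (fun _ : Fin k => S),
        ∑ σ : Equiv.Perm (Fin k), (if x ∘ σ = y then (∏ i, β (x i)) ^ 2 else 0) := by
        refine Finset.sum_le_sum fun x hx => Finset.sum_le_sum fun y hy => ?_
        rw [Fintype.mem_piFinset] at hx hy
        split_ifs with h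
        · obtain ⟨σ, hσ⟩ := exists_perm_of_sum_sqrt_eq y x (fun i => hS _ (hy i))
            (fun i => hS _ (hx i)) h.symm
          refine le_trans ?_ (Finset.single_le_sum (f := fun σ : Equiv.Perm (Fin k) =>
            (if x ∘ σ = y then (∏ i, β (x i)) ^ 2 else 0)) (fun τ _ => by positivity)
            (Finset.mem_univ σ))
          have : ∏ i, β (y i) = ∏ i, β (x i) := by
            rw [hσ]; exact Equiv.prod_comp σ (fun i => β (x i))
          simp only [hσ, if_true]
          rw [← hσ, this, ← sq, abs_of_nonneg (sq_nonneg _)]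
        · exact Finset.sum_nonneg fun σ _ => by positivity
    _ = ∑ x ∈ Fintype.piFinset (fun _ : Fin k => S), ∑ σ : Equiv.Perm (Fin k),
        ∑ y ∈ Fintype.piFinset (fun _ : Fin k => S), (if x ∘ σ = y then (∏ i, β (x i)) ^ 2 else 0) :=
        Finset.sum_congr rfl fun x _ => Finset.sum_comm
    _ ≤ ∑ x ∈ Fintype.piFinset (fun _ : Fin k => S), ∑ σ : Equiv.Perm (Fin k), (∏ i, β (x i)) ^ 2 := by
        refine Finset.sum_le_sum fun x _ => Finset.sum_le_sum fun σ _ => ?_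
        rw [Finset.sum_ite_eq]
        split_ifs
        · exact le_rfl
        · positivity
    _ = _ := by
        simp only [Finset.sum_const, Finset.card_univ, Fintype.card_perm, Fintype.card_fin,
          nsmul_eq_mul, ← Finset.mul_sum]
        congr 1
        simp only [← Finset.prod_pow]
        exact (Finset.prod_univ_sum (fun _ : Fin k => S) (fun _ m => β m ^ 2)).symm.trans (by simp)

theorem norm_sum_exp_pow (k : ℕ) (S : Finset ℕ) (β : ℕ → ℝ) (θ t : ℝ) :
    ((‖∑ m ∈ S, (β m : ℂ) * Complex.exp (Complex.I * (θ * √(m:ℝ) * t : ℝ))‖ ^ (2 * k) : ℝ) : ℂ) =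
    ∑ x ∈ Fintype.piFinset (fun _ : Fin k => S), ∑ y ∈ Fintype.piFinset (fun _ : Fin k => S),
      (((∏ i, β (x i)) * ∏ i, β (y i) : ℝ) : ℂ) *
        Complex.exp (Complex.I * (θ * (∑ i, √(x i : ℝ) - ∑ i, √(y i : ℝ)) : ℝ) * t) := by
  set F := ∑ m ∈ S, (β m : ℂ) * Complex.exp (Complex.I * (θ * √(m:ℝ) * t : ℝ)) with hF
  have hpow : ∀ f : ℕ → ℂ, (∑ m ∈ S, f m) ^ k =
      ∑ x ∈ Fintype.piFinset (fun _ : Fin k => S), ∏ i, f (x i) := fun f => by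
    rw [← Finset.prod_univ_sum (fun _ : Fin k => S) (fun _ m => f m)]; simp
  have h1 : ((‖F‖ ^ (2 * k) : ℝ) : ℂ) = F ^ k * ((starRingEnd ℂ) F) ^ k := by
    rw [← mul_pow, Complex.mul_conj, Complex.normSq_eq_norm_sq, pow_mul]; push_cast; rfl
  have h2 : (starRingEnd ℂ) F = ∑ m ∈ S, (β m : ℂ) * Complex.exp (-(Complex.I * (θ * √(m:ℝ) * t : ℝ))) := by
    rw [hF, map_sum]
    refine Finset.sum_congr rfl fun m _ => ?_
    rw [map_mul, Complex.conj_ofReal, ← Complex.exp_conj, map_mul, Complex.conj_I, Complex.conj_ofReal,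
      neg_mul]
  rw [h1, h2, hF, hpow, hpow, Finset.sum_mul_sum]
  refine Finset.sum_congr rfl fun x _ => Finset.sum_congr rfl fun y _ => ?_
  simp only [Finset.prod_mul_distrib, ← Complex.exp_sum]
  rw [mul_mul_mul_comm, ← Complex.exp_add]
  push_cast
  congr 2
  simp only [mul_sub, sub_mul, Finset.mul_sum, Finset.sum_mul, Finset.sum_neg_distrib, ← sub_eq_add_neg]
  congr 1 <;> exact Finset.sum_congr rfl fun i _ => by ring

theorem moment_le (k : ℕ) : ∃ e : ℕ, ∀ (N : ℕ) (S : Finset ℕ) (β : ℕ → ℝ) (θ a b : ℝ), 1 ≤ N →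
    (∀ m ∈ S, Squarefree m ∧ m ≤ N) → (∀ m ∈ S, |β m| ≤ 1) → 0 < θ → a ≤ b →
    ∫ t in a..b, |∑ m ∈ S, β m * Real.cos (θ * √(m:ℝ) * t)| ^ (2 * k) ≤
      k.factorial * (b - a) * (∑ m ∈ S, β m ^ 2) ^ k + 2 / θ * ((1 + N : ℕ) : ℝ) ^ e := by
  obtain ⟨e, he⟩ := sum_sqrt_sub_gap k
  refine ⟨e + 2 * k, fun N S β θ a b hN hS hβ hθ hab => ?_⟩
  set F : ℝ → ℂ := fun t => ∑ m ∈ S, (β m : ℂ) * Complex.exp (Complex.I * (θ * √(m:ℝ) * t : ℝ)) with hF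
  have hFc : Continuous F := by
    rw [hF]; fun_prop
  set X := Fintype.piFinset (fun _ : Fin k => S) with hX
  set s : (Fin k → ℕ) → ℝ := fun x => ∑ i, √(x i : ℝ) with hs
  set p : (Fin k → ℕ) → ℝ := fun x => ∏ i, β (x i) with hp
  have h1 : ∫ t in a..b, |∑ m ∈ S, β m * Real.cos (θ * √(m:ℝ) * t)| ^ (2 * k) ≤
      ∫ t in a..b, ‖F t‖ ^ (2 * k) := by
    refine intervalIntegral.integral_mono_on hab ?_ ?_ fun t _ => ?_
    · apply Continuous.intervalIntegrable; fun_prop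
    · apply Continuous.intervalIntegrable; fun_prop
    · gcongr
      have : (∑ m ∈ S, β m * Real.cos (θ * √(m:ℝ) * t)) = (F t).re := by
        rw [hF, Complex.re_sum]
        refine Finset.sum_congr rfl fun m _ => ?_
        rw [Complex.re_ofReal_mul, mul_comm Complex.I, Complex.exp_ofReal_mul_I_re]
      rw [this]
      exact Complex.abs_re_le_norm _
  refine h1.trans ?_
  have h2 : ((∫ t in a..b, ‖F t‖ ^ (2 * k) : ℝ) : ℂ) = ∑ x ∈ X, ∑ y ∈ X,
      ((p x * p y : ℝ) : ℂ) * ∫ t in a..b, Complex.exp (Complex.I * (θ * (s x - s y) : ℝ) * t) := by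
    rw [← intervalIntegral.integral_ofReal]
    simp_rw [hF, norm_sum_exp_pow]
    rw [intervalIntegral.integral_finsetSum]
    · refine Finset.sum_congr rfl fun x _ => ?_
      rw [intervalIntegral.integral_finsetSum]
      · refine Finset.sum_congr rfl fun y _ => ?_
        rw [intervalIntegral.integral_const_mul]
      · intro y _
        apply Continuous.intervalIntegrable; fun_prop
    · intro x _
      apply Continuous.intervalIntegrable; fun_prop
  have hpx : ∀ x ∈ X, |p x| ≤ 1 := by
    intro x hx
    rw [hp, Finset.abs_prod]
    exact Finset.prod_le_one (fun _ _ => abs_nonneg _) fun i _ => hβ _ (Fintype.mem_piFinset.1 hx i)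
  have h3 : ∫ t in a..b, ‖F t‖ ^ (2 * k) ≤ ∑ x ∈ X, ∑ y ∈ X,
      ((b - a) * (if s x = s y then |p x * p y| else 0) + 2 / θ * ((1 + N : ℕ) : ℝ) ^ e) := by
    calc _ ≤ ‖((∫ t in a..b, ‖F t‖ ^ (2 * k) : ℝ) : ℂ)‖ := by
          rw [Complex.norm_real]; exact le_abs_self _
      _ ≤ ∑ x ∈ X, ∑ y ∈ X, ‖((p x * p y : ℝ) : ℂ) *
          ∫ t in a..b, Complex.exp (Complex.I * (θ * (s x - s y) : ℝ) * t)‖ := by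
          rw [h2]
          exact (norm_sum_le _ _).trans (Finset.sum_le_sum fun x _ => norm_sum_le _ _)
      _ ≤ _ := by
          refine Finset.sum_le_sum fun x hx => Finset.sum_le_sum fun y hy => ?_
          rw [norm_mul, Complex.norm_real, Real.norm_eq_abs]
          split_ifs with h
          · rw [h, sub_self, mul_zero]
            simp only [Complex.ofReal_zero, mul_zero, zero_mul, Complex.exp_zero]
            rw [intervalIntegral.integral_const]
            have : ‖(b - a) • (1:ℂ)‖ = b - a := by
              rw [norm_smul, norm_one, mul_one, Real.norm_eq_abs, abs_of_nonneg (by linarith)]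
            rw [this, mul_comm]
            exact le_add_of_nonneg_right (by positivity)
          · have hx' := fun i => hS _ (Fintype.mem_piFinset.1 hx i)
            have hy' := fun i => hS _ (Fintype.mem_piFinset.1 hy i)
            have h4 := he N hN x y (fun i => (hx' i).2) (fun i => (hy' i).2) h
            have h5 : s x - s y ≠ 0 := sub_ne_zero.2 h
            have h6 := norm_integral_exp_le (θ * (s x - s y)) a b (mul_ne_zero hθ.ne' h5)
            have h7 : |p x * p y| ≤ 1 := by
              rw [abs_mul]; exact mul_le_one₀ (hpx x hx) (abs_nonneg _) (hpx y hy)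
            rw [mul_zero, zero_add]
            calc _ ≤ 1 * (2 / |θ * (s x - s y)|) := by gcongr
              _ = 2 / θ * (1 / |s x - s y|) := by
                  rw [abs_mul, abs_of_pos hθ]; field_simp
              _ ≤ _ := by
                  gcongr
                  rw [div_le_iff₀' (abs_pos.2 h5)]
                  exact h4
  refine h3.trans ?_
  simp only [Finset.sum_add_distrib, ← Finset.mul_sum, Finset.sum_const, nsmul_eq_mul]
  refine add_le_add ?_ ?_
  · have := sum_sqrt_coincidence_le k S (fun m hm => (hS m hm).1) β
    calc _ ≤ (b - a) * (k.factorial * (∑ m ∈ S, β m ^ 2) ^ k) :=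
          mul_le_mul_of_nonneg_left this (by linarith)
      _ = _ := by ring
  · have hc : (X.card : ℝ) ≤ ((1 + N : ℕ) : ℝ) ^ k := by
      have h8 : S.card ≤ 1 + N := by
        calc S.card ≤ (Finset.range (1 + N)).card :=
              Finset.card_le_card fun m hm => Finset.mem_range.2 (by have := (hS m hm).2; omega)
          _ = _ := Finset.card_range _
      have : X.card ≤ (1 + N) ^ k := by
        rw [hX, Fintype.card_piFinset]; simp only [Finset.prod_const, Finset.card_univ, Fintype.card_fin]
        exact Nat.pow_le_pow_left h8 k
      exact_mod_cast this
    calc _ = (X.card : ℝ) * ((X.card : ℝ) * (2 / θ * ((1 + N : ℕ) : ℝ) ^ e)) := by ring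
      _ ≤ ((1 + N : ℕ) : ℝ) ^ k * (((1 + N : ℕ) : ℝ) ^ k * (2 / θ * ((1 + N : ℕ) : ℝ) ^ e)) := by
          gcongr
      _ = _ := by ring

/-- The kernel `sin (2πρr) / ρ`, extended by continuity to `ρ = 0`. -/
noncomputable def radK (ρ r : ℝ) : ℝ := if ρ = 0 then 2 * π * r else Real.sin (2 * π * ρ * r) / ρ

theorem hasDerivAt_radK (ρ r : ℝ) : HasDerivAt (radK ρ) (2 * π * Real.cos (2 * π * ρ * r)) r := by
  unfold radK
  by_cases h : ρ = 0
  · simp only [h, if_true, mul_zero, zero_mul, Real.cos_zero]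
    exact (hasDerivAt_id r).const_mul (2 * π)
  · simp only [h, if_false]
    have h1 := ((Real.hasDerivAt_sin (2 * π * ρ * r)).comp r
      ((hasDerivAt_id r).const_mul (2 * π * ρ))).div_const ρ
    refine h1.congr_deriv ?_
    field_simp

theorem abs_radK_le (ρ r : ℝ) : |radK ρ r| ≤ 2 * π * |r| := by
  unfold radK
  split_ifs with h
  · rw [abs_mul, abs_of_pos (by positivity : 0 < 2 * π)]
  · rw [abs_div, div_le_iff₀ (abs_pos.2 h)]
    calc |Real.sin (2 * π * ρ * r)| ≤ |2 * π * ρ * r| := Real.abs_sin_le_abs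
      _ = _ := by rw [abs_mul, abs_mul, abs_of_pos (by positivity : 0 < 2 * π)]; ring

theorem continuous_radK (ρ : ℝ) : Continuous (radK ρ) :=
  continuous_iff_continuousAt.2 fun r => (hasDerivAt_radK ρ r).continuousAt

theorem norm_cexp_neg_pi_mul (s : ℂ) (r : ℝ) :
    ‖Complex.exp (-π * s * r ^ 2)‖ = Real.exp (-π * s.re * r ^ 2) := by
  rw [Complex.norm_exp]
  congr 1
  have : (-π * s * r ^ 2 : ℂ) = ((-π * r ^ 2 : ℝ) : ℂ) * s := by push_cast; ring
  rw [this, Complex.re_ofReal_mul]; ring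

theorem integrable_sq_mul_gaussian {x : ℝ} (hx : 0 < x) :
    Integrable fun r : ℝ => r ^ 2 * Real.exp (-π * x * r ^ 2) := by
  have := integrable_rpow_mul_exp_neg_mul_sq (b := π * x) (by positivity) (s := 2) (by norm_num)
  refine this.congr (Filter.Eventually.of_forall fun r => ?_)
  simp only [Real.rpow_two, neg_mul]

theorem norm_radK_mul_gaussian_le (ρ : ℝ) (s : ℂ) (r : ℝ) :
    ‖((r * radK ρ r : ℝ) : ℂ) * Complex.exp (-π * s * r ^ 2)‖ ≤
      2 * π * (r ^ 2 * Real.exp (-π * s.re * r ^ 2)) := by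
  rw [norm_mul, norm_cexp_neg_pi_mul, Complex.norm_real, Real.norm_eq_abs, abs_mul]
  calc |r| * |radK ρ r| * Real.exp (-π * s.re * r ^ 2)
      ≤ |r| * (2 * π * |r|) * Real.exp (-π * s.re * r ^ 2) := by gcongr; exact abs_radK_le _ _
    _ = 2 * π * ((|r| * |r|) * Real.exp (-π * s.re * r ^ 2)) := by ring
    _ = _ := by rw [abs_mul_abs_self]; ring

theorem continuous_radK_mul_gaussian (ρ : ℝ) (s : ℂ) :
    Continuous fun r : ℝ => ((r * radK ρ r : ℝ) : ℂ) * Complex.exp (-π * s * r ^ 2) := by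
  have := continuous_radK ρ
  fun_prop

theorem integrable_radK_mul_gaussian (ρ : ℝ) {s : ℂ} (hs : 0 < s.re) :
    Integrable fun r : ℝ => ((r * radK ρ r : ℝ) : ℂ) * Complex.exp (-π * s * r ^ 2) :=
  ((integrable_sq_mul_gaussian hs).const_mul (2 * π)).mono'
    (continuous_radK_mul_gaussian ρ s).aestronglyMeasurable
    (Filter.Eventually.of_forall fun r => norm_radK_mul_gaussian_le ρ s r)

theorem integrable_radK_mul_gaussian' (ρ : ℝ) {s : ℂ} (hs : 0 < s.re) :
    Integrable fun r : ℝ => ((radK ρ r : ℝ) : ℂ) * Complex.exp (-π * s * r ^ 2) := by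
  have h1 := integrable_rpow_mul_exp_neg_mul_sq (b := π * s.re) (by positivity) (s := 1)
    (by norm_num)
  refine (h1.norm.const_mul (2 * π)).mono' ?_ (Filter.Eventually.of_forall fun r => ?_)
  · have := continuous_radK ρ
    exact Continuous.aestronglyMeasurable (by fun_prop)
  · rw [norm_mul, norm_cexp_neg_pi_mul, Complex.norm_real, Real.norm_eq_abs, Real.rpow_one, norm_mul,
      Real.norm_eq_abs, Real.norm_eq_abs, Real.abs_exp, ← mul_assoc, neg_mul]
    gcongr
    exact abs_radK_le _ _

theorem integral_cos_gaussian (ρ : ℝ) {s : ℂ} (hs : 0 < s.re) :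
    Integrable (fun r : ℝ => ((Real.cos (2 * π * ρ * r) : ℝ) : ℂ) * Complex.exp (-π * s * r ^ 2)) ∧
    ∫ r : ℝ, ((Real.cos (2 * π * ρ * r) : ℝ) : ℂ) * Complex.exp (-π * s * r ^ 2) =
      1 / s ^ (1 / 2 : ℂ) * Complex.exp (-π / s * ρ ^ 2) := by
  have hs0 : s ≠ 0 := by rintro rfl; simp at hs
  have hb : 0 < ((π : ℂ) * s).re := by
    rw [Complex.re_ofReal_mul]; positivity
  have hπ : (π : ℂ) ≠ 0 := Complex.ofReal_ne_zero.2 Real.pi_ne_zero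
  have h_integ : ∀ t : ℂ, Integrable fun x : ℝ =>
      Complex.exp (Complex.I * t * x) * Complex.exp (-(π * s) * x ^ 2) := by
    intro t
    have := integrable_cexp_quadratic hb (Complex.I * t) 0
    refine this.congr (Filter.Eventually.of_forall fun x => ?_)
    simp only [← Complex.exp_add]; ring_nf
  have key : ∀ r : ℝ, ((Real.cos (2 * π * ρ * r) : ℝ) : ℂ) * Complex.exp (-π * s * r ^ 2) =
      (1 / 2 : ℂ) * (Complex.exp (Complex.I * (2 * π * ρ) * r) * Complex.exp (-(π * s) * r ^ 2)) +
      (1 / 2 : ℂ) * (Complex.exp (Complex.I * (-(2 * π * ρ)) * r) *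
        Complex.exp (-(π * s) * r ^ 2)) := by
    intro r
    rw [Complex.ofReal_cos, Complex.cos]
    push_cast
    rw [show (2 * π * ρ * r : ℂ) * Complex.I = Complex.I * (2 * π * ρ) * r by ring,
      show -(2 * π * ρ * r : ℂ) * Complex.I = Complex.I * (-(2 * π * ρ)) * r by ring,
      show (-π * s * r ^ 2 : ℂ) = -(π * s) * r ^ 2 by ring]
    ring
  have hroot : ((π : ℂ) / (π * s)) ^ (1 / 2 : ℂ) = 1 / s ^ (1 / 2 : ℂ) := by
    have harg : s.arg ≠ π := fun h => by linarith [(Complex.arg_eq_pi_iff.1 h).1]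
    rw [div_mul_eq_div_div, div_self hπ, one_div s, Complex.inv_cpow _ _ harg,
      one_div (s ^ (1 / 2 : ℂ))]
  have hexp : ∀ e : ℂ, e ^ 2 = (2 * π * ρ) ^ 2 → -e ^ 2 / (4 * (π * s)) = -π / s * ρ ^ 2 := by
    intro e he
    rw [he]; field_simp; ring
  constructor
  · simp_rw [key]
    exact ((h_integ _).const_mul _).add ((h_integ _).const_mul _)
  · simp_rw [key]
    rw [integral_add ((h_integ _).const_mul _) ((h_integ _).const_mul _), integral_const_mul,
      integral_const_mul, fourierIntegral_gaussian hb, fourierIntegral_gaussian hb, hroot,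
      hexp _ rfl, hexp _ (by ring)]
    ring

theorem integral_radK_gaussian (ρ : ℝ) {s : ℂ} (hs : 0 < s.re) :
    ∫ r : ℝ, ((r * radK ρ r : ℝ) : ℂ) * Complex.exp (-π * s * r ^ 2) =
      1 / s * (1 / s ^ (1 / 2 : ℂ)) * Complex.exp (-π / s * ρ ^ 2) := by
  have hs0 : s ≠ 0 := by rintro rfl; simp at hs
  have hπ : (π : ℂ) ≠ 0 := Complex.ofReal_ne_zero.2 Real.pi_ne_zero
  obtain ⟨hc, hc'⟩ := integral_cos_gaussian ρ hs
  have h0 := integral_eq_zero_of_hasDerivAt_of_integrable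
    (f := fun r : ℝ => ((radK ρ r : ℝ) : ℂ) * Complex.exp (-π * s * r ^ 2))
    (f' := fun r : ℝ => (2 * π : ℂ) * (((Real.cos (2 * π * ρ * r) : ℝ) : ℂ) *
      Complex.exp (-π * s * r ^ 2)) - (2 * π * s) * (((r * radK ρ r : ℝ) : ℂ) *
        Complex.exp (-π * s * r ^ 2))) ?_
    ((hc.const_mul _).sub ((integrable_radK_mul_gaussian ρ hs).const_mul _))
    (integrable_radK_mul_gaussian' ρ hs)
  · rw [integral_sub (hc.const_mul _) ((integrable_radK_mul_gaussian ρ hs).const_mul _),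
      integral_const_mul, integral_const_mul, hc', sub_eq_zero] at h0
    have h2 : (2 * π * s : ℂ) ≠ 0 := by simp [hπ, hs0]
    apply mul_left_cancel₀ h2
    rw [← h0]; field_simp
  · intro r
    have h1 := (hasDerivAt_radK ρ r).ofReal_comp
    have h2 : HasDerivAt (fun r : ℝ => (-π * s * r ^ 2 : ℂ)) (-π * s * (2 * r)) r := by
      have := ((hasDerivAt_id r).ofReal_comp.pow 2).const_mul (-π * s : ℂ)
      refine this.congr_deriv ?_
      simp
    refine (h1.mul h2.cexp).congr_deriv ?_
    push_cast; ring

theorem summable_one_div_one_add_sq : Summable fun n : ℤ => 1 / (1 + (n : ℝ) ^ 2) := by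
  have h : Summable fun n : ℤ => 1 / (n : ℝ) ^ 2 := by
    simpa using (Real.summable_one_div_int_pow (p := 2)).2 (by norm_num)
  refine Summable.of_norm_bounded_eventually h ?_
  have : ∀ᶠ n : ℤ in Filter.cofinite, n ≠ 0 := Filter.eventually_cofinite_ne 0
  filter_upwards [this] with n hn
  have : 0 < (n : ℝ) ^ 2 := by positivity
  rw [Real.norm_of_nonneg (by positivity)]
  gcongr; linarith

/-- A summable weight on the integer lattice. -/
noncomputable def latticeWeight (v : ℤ × ℤ × ℤ) : ℝ :=
  1 / (1 + (v.1 : ℝ) ^ 2) * (1 / (1 + (v.2.1 : ℝ) ^ 2) * (1 / (1 + (v.2.2 : ℝ) ^ 2)))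

theorem summable_latticeWeight : Summable latticeWeight :=
  summable_one_div_one_add_sq.mul_of_nonneg
    (summable_one_div_one_add_sq.mul_of_nonneg summable_one_div_one_add_sq
      (fun n => by positivity) (fun n => by positivity))
    (fun n => by positivity) (fun v => by simp only [Pi.zero_apply]; positivity)

theorem norm_cexp_neg_pi_mul_int_le {a : ℂ} (h0 : 0 < a.re) (h1 : a.re ≤ 1) (n : ℤ) :
    ‖Complex.exp (-π * a * (n : ℂ) ^ 2)‖ ≤ 1 / a.re * (1 / (1 + (n : ℝ) ^ 2)) := by
  have := norm_cexp_neg_pi_mul a (n : ℝ)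
  rw [Complex.ofReal_intCast] at this
  rw [this, show -π * a.re * (n : ℝ) ^ 2 = -(π * a.re * (n : ℝ) ^ 2) by ring, Real.exp_neg,
    ← one_div, one_div_mul_one_div]
  apply one_div_le_one_div_of_le (by positivity)
  refine le_trans ?_ (Real.add_one_le_exp _)
  have h2 : 0 ≤ a.re * (n : ℝ) ^ 2 := by positivity
  nlinarith [Real.pi_gt_three]

theorem cexp_nsq (a : ℂ) (v : ℤ × ℤ × ℤ) :
    Complex.exp (-π * a * (nsq v : ℂ)) = Complex.exp (-π * a * (v.1 : ℂ) ^ 2) *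
      (Complex.exp (-π * a * (v.2.1 : ℂ) ^ 2) * Complex.exp (-π * a * (v.2.2 : ℂ) ^ 2)) := by
  rw [← Complex.exp_add, ← Complex.exp_add]
  congr 1
  have : (nsq v : ℂ) = (v.1 : ℂ) ^ 2 + (v.2.1 : ℂ) ^ 2 + (v.2.2 : ℂ) ^ 2 := by
    exact_mod_cast congrArg (fun x : ℤ => (x : ℂ)) (nsq_int v)
  rw [this]; ring

theorem norm_cexp_nsq_le {a : ℂ} (h0 : 0 < a.re) (h1 : a.re ≤ 1) (v : ℤ × ℤ × ℤ) :
    ‖Complex.exp (-π * a * (nsq v : ℂ))‖ ≤ (1 / a.re) ^ 3 * latticeWeight v := by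
  rw [cexp_nsq, norm_mul, norm_mul]
  have := norm_cexp_neg_pi_mul_int_le h0 h1
  calc _ ≤ (1 / a.re * (1 / (1 + (v.1 : ℝ) ^ 2))) * ((1 / a.re * (1 / (1 + (v.2.1 : ℝ) ^ 2))) *
        (1 / a.re * (1 / (1 + (v.2.2 : ℝ) ^ 2)))) := by
        gcongr <;> apply this
    _ = _ := by unfold latticeWeight; ring

theorem summable_cexp_nsq {a : ℂ} (h0 : 0 < a.re) (h1 : a.re ≤ 1) :
    Summable fun v : ℤ × ℤ × ℤ => Complex.exp (-π * a * (nsq v : ℂ)) :=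
  Summable.of_norm_bounded (summable_latticeWeight.mul_left _) (norm_cexp_nsq_le h0 h1)

theorem tsum_cexp_nsq {a : ℂ} (h0 : 0 < a.re) (h1 : a.re ≤ 1) :
    ∑' v : ℤ × ℤ × ℤ, Complex.exp (-π * a * (nsq v : ℂ)) =
      (∑' n : ℤ, Complex.exp (-π * a * (n : ℂ) ^ 2)) ^ 3 := by
  have hs : Summable fun n : ℤ => ‖Complex.exp (-π * a * (n : ℂ) ^ 2)‖ :=
    Summable.of_nonneg_of_le (fun _ => norm_nonneg _) (norm_cexp_neg_pi_mul_int_le h0 h1)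
      (summable_one_div_one_add_sq.mul_left _)
  have hs2 : Summable fun v : ℤ × ℤ => ‖Complex.exp (-π * a * (v.1 : ℂ) ^ 2) *
      Complex.exp (-π * a * (v.2 : ℂ) ^ 2)‖ := by
    simp only [norm_mul]
    exact hs.mul_of_nonneg hs (fun _ => norm_nonneg _) (fun _ => norm_nonneg _)
  have e2 := tsum_mul_tsum_of_summable_norm hs hs
  have e3 := tsum_mul_tsum_of_summable_norm hs hs2
  rw [pow_succ', sq, e2, e3]
  exact tsum_congr fun v => cexp_nsq a v

theorem tsum_cexp_nsq_inversion {a : ℂ} (h0 : 0 < a.re) (h1 : a.re ≤ 1) (h0' : 0 < (1 / a).re)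
    (h1' : (1 / a).re ≤ 1) :
    ∑' v : ℤ × ℤ × ℤ, Complex.exp (-π * a * (nsq v : ℂ)) =
      (1 / a ^ (1 / 2 : ℂ)) ^ 3 * ∑' v : ℤ × ℤ × ℤ, Complex.exp (-π * (1 / a) * (nsq v : ℂ)) := by
  rw [tsum_cexp_nsq h0 h1, tsum_cexp_nsq h0' h1', Complex.tsum_exp_neg_mul_int_sq h0, mul_pow]
  simp only [mul_one_div]

/-- The point `1 - 2iη` of the line `Re s = 1`. -/
noncomputable def lineS (η : ℝ) : ℂ := 1 - 2 * η * Complex.I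

theorem lineS_re (η : ℝ) : (lineS η).re = 1 := by simp [lineS]

theorem lineS_ne_zero (η : ℝ) : lineS η ≠ 0 := fun h => by
  have := lineS_re η; rw [h] at this; simp at this

theorem inv_lineS_re (η : ℝ) : (1 / lineS η).re = 1 / (1 + 4 * η ^ 2) := by
  rw [one_div, Complex.inv_re, lineS_re, Complex.normSq_apply, lineS_re]
  have : (lineS η).im = -2 * η := by simp [lineS]
  rw [this]; congr 1; ring

theorem continuous_lineS : Continuous lineS := by unfold lineS; fun_prop

theorem lineS_mem_slitPlane (η : ℝ) : lineS η ∈ Complex.slitPlane :=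
  Or.inl (by rw [lineS_re]; norm_num)

theorem inv_sqrt_lineS_sq (η : ℝ) :
    (1 / lineS η ^ (1 / 2 : ℂ)) ^ 2 = 1 / lineS η := by
  rw [div_pow, one_pow]
  congr 1
  rw [← Complex.cpow_nat_mul]
  norm_num

theorem norm_inv_sqrt_lineS_le (η : ℝ) : ‖1 / lineS η ^ (1 / 2 : ℂ)‖ ≤ 1 := by
  have h := congrArg norm (inv_sqrt_lineS_sq η)
  rw [norm_pow, norm_div 1 (lineS η), norm_one] at h
  have h1 : 1 ≤ ‖lineS η‖ := by
    have := Complex.abs_re_le_norm (lineS η)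
    rwa [lineS_re, abs_one] at this
  have h2 : ‖1 / lineS η ^ (1 / 2 : ℂ)‖ ^ 2 ≤ 1 := by
    rw [h]; exact (div_le_one (by linarith)).2 h1
  exact (sq_le_one_iff₀ (norm_nonneg _)).1 h2

theorem hasSum_radial_of_gaussian {G : ℝ → ℂ} (hG : Continuous G)
    (hG1 : Integrable fun η => ‖G η‖ * (1 + 4 * η ^ 2) ^ 3) (hG0 : Integrable G) {w : ℝ → ℂ}
    (hw : ∀ r : ℝ, w r = ∫ η, G η * Complex.exp (-π * lineS η * r ^ 2)) :
    ∃ T : ℂ, HasSum (fun v : ℤ × ℤ × ℤ => w (√(nsq v : ℝ))) T ∧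
      HasSum (fun v : ℤ × ℤ × ℤ => ∫ r : ℝ, ((r * radK (√(nsq v : ℝ)) r : ℝ) : ℂ) * w r) T := by
  have hsq : ∀ v : ℤ × ℤ × ℤ, ((√(nsq v : ℝ) : ℝ) : ℂ) ^ 2 = (nsq v : ℂ) := by
    intro v
    rw [← Complex.ofReal_pow, Real.sq_sqrt (Nat.cast_nonneg _)]; simp
  have hcS := continuous_lineS
  have hcI : Continuous fun η => 1 / lineS η := continuous_const.div hcS lineS_ne_zero
  have hcR : Continuous fun η => 1 / lineS η ^ (1 / 2 : ℂ) := by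
    refine continuous_const.div (continuous_iff_continuousAt.2 fun η => ?_) ?_
    · exact (hcS.continuousAt).cpow continuousAt_const (lineS_mem_slitPlane η)
    · intro η; rw [Complex.cpow_ne_zero_iff]; exact Or.inl (lineS_ne_zero η)
  have hA : ∀ η : ℝ, 1 ≤ 1 + 4 * η ^ 2 := fun η => by nlinarith [sq_nonneg η]
  have hre0 : ∀ η, 0 < (1 / lineS η).re := fun η => by
    rw [inv_lineS_re]; have := hA η; positivity
  have hre1 : ∀ η, (1 / lineS η).re ≤ 1 := fun η => by
    rw [inv_lineS_re]; exact (div_le_one (by linarith [hA η])).2 (hA η)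
  have hs0 : ∀ η, 0 < (lineS η).re := fun η => by rw [lineS_re]; norm_num
  have hs1 : ∀ η, (lineS η).re ≤ 1 := fun η => by rw [lineS_re]
  set bd : (ℤ × ℤ × ℤ) → ℝ → ℝ := fun v η => (‖G η‖ * (1 + 4 * η ^ 2) ^ 3) * latticeWeight v
  have hLW : ∀ v, 0 ≤ latticeWeight v := fun v => by unfold latticeWeight; positivity
  have hbs : ∀ η, Summable fun v => bd v η := fun η => summable_latticeWeight.mul_left _
  have hbi : Integrable fun η => ∑' v, bd v η := by
    simp only [bd, tsum_mul_left]
    exact hG1.mul_const _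
  have H1 := hasSum_integral_of_dominated_convergence (μ := volume)
    (F := fun (v : ℤ × ℤ × ℤ) η => G η * Complex.exp (-π * lineS η * (nsq v : ℂ)))
    (f := fun η => G η * ∑' v : ℤ × ℤ × ℤ, Complex.exp (-π * lineS η * (nsq v : ℂ))) bd
    (fun v => Continuous.aestronglyMeasurable (by fun_prop))
    (fun v => Filter.Eventually.of_forall fun η => by
      have h := norm_cexp_nsq_le (hs0 η) (hs1 η) v
      rw [lineS_re, one_div_one, one_pow, one_mul] at h
      rw [norm_mul]
      have h2 : 1 ≤ (1 + 4 * η ^ 2) ^ 3 := one_le_pow₀ (hA η)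
      have h3 := hLW v
      calc _ ≤ ‖G η‖ * 1 * latticeWeight v := by rw [mul_one]; gcongr
        _ ≤ _ := by simp only [bd]; gcongr)
    (Filter.Eventually.of_forall hbs) hbi
    (Filter.Eventually.of_forall fun η => (summable_cexp_nsq (hs0 η) (hs1 η)).hasSum.mul_left _)
  have H2 := hasSum_integral_of_dominated_convergence (μ := volume)
    (F := fun (v : ℤ × ℤ × ℤ) η => G η * ((1 / lineS η ^ (1 / 2 : ℂ)) ^ 3 *
      Complex.exp (-π * (1 / lineS η) * (nsq v : ℂ))))
    (f := fun η => G η * ∑' v : ℤ × ℤ × ℤ, Complex.exp (-π * lineS η * (nsq v : ℂ))) bd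
    (fun v => Continuous.aestronglyMeasurable (by fun_prop))
    (fun v => Filter.Eventually.of_forall fun η => by
      have h := norm_cexp_nsq_le (hre0 η) (hre1 η) v
      rw [inv_lineS_re, one_div_one_div] at h
      rw [norm_mul, norm_mul, norm_pow]
      have h3 := hLW v
      have h4 : ‖1 / lineS η ^ (1 / 2 : ℂ)‖ ^ 3 ≤ 1 :=
        pow_le_one₀ (norm_nonneg _) (norm_inv_sqrt_lineS_le η)
      calc _ ≤ ‖G η‖ * (1 * ((1 + 4 * η ^ 2) ^ 3 * latticeWeight v)) := by gcongr
        _ = _ := by simp only [bd]; ring)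
    (Filter.Eventually.of_forall hbs) hbi
    (Filter.Eventually.of_forall fun η => by
      rw [tsum_cexp_nsq_inversion (hs0 η) (hs1 η) (hre0 η) (hre1 η)]
      exact ((summable_cexp_nsq (hre0 η) (hre1 η)).hasSum.mul_left _).mul_left _)
  refine ⟨∫ η, G η * ∑' v : ℤ × ℤ × ℤ, Complex.exp (-π * lineS η * (nsq v : ℂ)), ?_, ?_⟩
  · have e : (fun v : ℤ × ℤ × ℤ => w (√(nsq v : ℝ))) = fun v =>
        ∫ η, G η * Complex.exp (-π * lineS η * (nsq v : ℂ)) := by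
      funext v
      rw [hw]
      simp only [hsq]
    rw [e]; exact H1
  · suffices h : (fun v : ℤ × ℤ × ℤ => ∫ r : ℝ, ((r * radK (√(nsq v : ℝ)) r : ℝ) : ℂ) * w r) =
        fun v => ∫ η, G η * ((1 / lineS η ^ (1 / 2 : ℂ)) ^ 3 *
          Complex.exp (-π * (1 / lineS η) * (nsq v : ℂ))) by rw [h]; exact H2
    funext v
    symm
    set ρ := √(nsq v : ℝ) with hρ
    have e1 : ∀ η, G η * ((1 / lineS η ^ (1 / 2 : ℂ)) ^ 3 *
        Complex.exp (-π * (1 / lineS η) * (nsq v : ℂ))) =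
        ∫ r : ℝ, G η * (((r * radK ρ r : ℝ) : ℂ) * Complex.exp (-π * lineS η * r ^ 2)) := by
      intro η
      rw [integral_const_mul, integral_radK_gaussian ρ (hs0 η), hsq, pow_succ, inv_sqrt_lineS_sq,
        mul_one_div (-π : ℂ)]
    have e2 : ∀ r : ℝ, ((r * radK ρ r : ℝ) : ℂ) * w r =
        ∫ η, G η * (((r * radK ρ r : ℝ) : ℂ) * Complex.exp (-π * lineS η * r ^ 2)) := by
      intro r
      rw [hw, ← integral_const_mul]
      exact integral_congr_ae (Filter.Eventually.of_forall fun η => by dsimp only; ring)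
    simp_rw [e1, e2]
    apply integral_integral_swap
    have hb := hG0.norm.mul_prod ((integrable_sq_mul_gaussian one_pos).const_mul (2 * π))
    refine hb.mono' ?_ (Filter.Eventually.of_forall fun z => ?_)
    · have := continuous_radK ρ
      refine Continuous.aestronglyMeasurable ?_
      unfold Function.uncurry
      fun_prop
    · have := norm_radK_mul_gaussian_le ρ (lineS z.1) z.2
      rw [lineS_re] at this
      simp only [Function.uncurry]
      rw [norm_mul]
      gcongr

theorem radK_neg (ρ r : ℝ) : radK ρ (-r) = -radK ρ r := by
  unfold radK; split_ifs
  · ring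
  · rw [mul_neg, Real.sin_neg, neg_div]

theorem integral_radK_abs (ρ : ℝ) (w : ℝ → ℝ) (hw : ∀ t ≤ 0, w t = 0) :
    ∫ r : ℝ, r * radK ρ r * w |r| = 2 * ∫ r : ℝ, r * radK ρ r * w r := by
  have h1 : ∀ r : ℝ, r * radK ρ r * w |r| = (fun x => x * radK ρ x * w x) |r| := by
    intro r
    rcases abs_cases r with ⟨h, _⟩ | ⟨h, _⟩ <;> simp only [h]
    rw [radK_neg]; ring
  rw [integral_congr_ae (Filter.Eventually.of_forall h1),
    integral_comp_abs (f := fun x => x * radK ρ x * w x), setIntegral_eq_integral_of_forall_compl_eq_zero]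
  intro x hx
  rw [hw x (not_lt.1 hx), mul_zero]

open scoped ContDiff FourierTransform SchwartzMap in
/-- Poisson summation for radial functions on `ℤ³`. -/
theorem hasSum_radial {w : ℝ → ℝ} (hw : ContDiff ℝ ∞ w) {a b : ℝ} (ha : 0 < a)
    (hsupp : ∀ t, w t ≠ 0 → t ∈ Set.Icc a b) :
    ∃ T : ℝ, HasSum (fun v : ℤ × ℤ × ℤ => w (√(nsq v : ℝ))) T ∧
      HasSum (fun v : ℤ × ℤ × ℤ => 2 * ∫ r : ℝ, r * radK (√(nsq v : ℝ)) r * w r) T := by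
  have hz : ∀ t ≤ 0, w t = 0 := fun t ht => by
    by_contra h; exact absurd (hsupp t h).1 (by linarith)
  set V : ℝ → ℂ := fun u => ((w (√u) * Real.exp (π * u) : ℝ) : ℂ) with hV
  have hVs : ∀ u, V u ≠ 0 → u ∈ Set.Icc (a ^ 2) (b ^ 2) := by
    intro u hu
    have h1 : w (√u) ≠ 0 := fun h => hu (by simp [hV, h])
    obtain ⟨h2, h3⟩ := hsupp _ h1
    have h4 : 0 < u := Real.sqrt_pos.1 (by linarith)
    constructor
    · exact (Real.le_sqrt' ha).1 h2
    · exact (Real.sqrt_le_left (by linarith [Real.sqrt_nonneg u])).1 h3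
  have hVc : HasCompactSupport V :=
    HasCompactSupport.intro isCompact_Icc fun u hu => by
      by_contra h; exact hu (hVs u h)
  have hVd : ContDiff ℝ ∞ V := by
    refine contDiff_iff_contDiffAt.2 fun u => ?_
    by_cases hu : u = 0
    · have : V =ᶠ[nhds u] fun _ => 0 := by
        rw [hu]
        filter_upwards [Iio_mem_nhds (show (0 : ℝ) < a ^ 2 by positivity)] with y hy
        by_contra h
        exact absurd (hVs y h).1 (not_le.2 hy)
      exact contDiffAt_const.congr_of_eventuallyEq this
    · have h1 : ContDiffAt ℝ ∞ (fun u => w (√u)) u :=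
        hw.contDiffAt.comp u (Real.contDiffAt_sqrt hu)
      have h2 : ContDiffAt ℝ ∞ (fun u => Real.exp (π * u)) u := by fun_prop
      exact Complex.ofRealCLM.contDiff.contDiffAt.comp u (h1.mul h2)
  set S : 𝓢(ℝ, ℂ) := hVc.toSchwartzMap hVd
  set G : 𝓢(ℝ, ℂ) := 𝓕 S with hGdef
  have hinv : ∀ u : ℝ, V u = ∫ η : ℝ, G η * Complex.exp (2 * π * η * u * Complex.I) := by
    intro u
    have h1 : 𝓕⁻ G = S := FourierTransform.fourierInv_fourier_eq S
    have h2 : V u = (𝓕⁻ G) u := by rw [h1]; rfl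
    rw [h2, SchwartzMap.fourierInv_coe, Real.fourierInv_eq']
    refine integral_congr_ae (Filter.Eventually.of_forall fun η => ?_)
    simp only [smul_eq_mul, RCLike.inner_apply, conj_trivial]
    rw [mul_comm]
    congr 2
    push_cast; ring
  have hG1 : Integrable fun η => ‖G η‖ * (1 + 4 * η ^ 2) ^ 3 := by
    have h0 := G.integrable_pow_mul volume 0
    have h2 := (G.integrable_pow_mul volume 2).const_mul 12
    have h4 := (G.integrable_pow_mul volume 4).const_mul 48
    have h6 := (G.integrable_pow_mul volume 6).const_mul 64
    refine (((h0.add h2).add h4).add h6).congr (Filter.Eventually.of_forall fun η => ?_)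
    have e2 : ‖η‖ ^ 2 = η ^ 2 := by rw [Real.norm_eq_abs, sq_abs]
    have e4 : ‖η‖ ^ 4 = η ^ 4 := by rw [show 4 = 2 * 2 by rfl, pow_mul, e2, ← pow_mul]
    have e6 : ‖η‖ ^ 6 = η ^ 6 := by rw [show 6 = 2 * 3 by rfl, pow_mul, e2, ← pow_mul]
    simp only [Pi.add_apply, e2, e4, e6]
    ring
  have hwr : ∀ r : ℝ, ((w |r| : ℝ) : ℂ) =
      ∫ η, G η * Complex.exp (-π * lineS η * r ^ 2) := by
    intro r
    have h1 : ((w |r| : ℝ) : ℂ) = V (r ^ 2) * Complex.exp (-π * r ^ 2) := by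
      simp only [hV, Real.sqrt_sq_eq_abs]
      push_cast
      rw [mul_assoc, ← Complex.exp_add]
      simp
    rw [h1, hinv, ← integral_mul_const]
    refine integral_congr_ae (Filter.Eventually.of_forall fun η => ?_)
    dsimp only
    rw [mul_assoc, ← Complex.exp_add]
    congr 2
    unfold lineS
    push_cast; ring
  obtain ⟨T, h1, h2⟩ := hasSum_radial_of_gaussian G.continuous hG1 G.integrable
    (w := fun r => ((w |r| : ℝ) : ℂ)) hwr
  have h3 : HasSum (fun v : ℤ × ℤ × ℤ => w (√(nsq v : ℝ))) T.re := by
    have := Complex.hasSum_re h1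
    simpa only [Complex.ofReal_re, abs_of_nonneg (Real.sqrt_nonneg _)] using this
  refine ⟨T.re, h3, ?_⟩
  have := Complex.hasSum_re h2
  simp_rw [← integral_radK_abs _ w hz]
  convert this using 2 with v
  simp only [← Complex.ofReal_mul]
  rw [integral_complex_ofReal, Complex.ofReal_re]

/-- A smooth bump supported in `[5/4, 7/4]`. -/
noncomputable def stdBump : ContDiffBump (3 / 2 : ℝ) := ⟨1 / 8, 1 / 4, by norm_num, by norm_num⟩

/-- The smooth cutoff function used to localise to `[R, 2R]`. -/
noncomputable def w0 (t : ℝ) : ℝ := stdBump t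

open scoped ContDiff in
theorem contDiff_w0 : ContDiff ℝ ∞ w0 := stdBump.contDiff

theorem w0_nonneg (t : ℝ) : 0 ≤ w0 t := stdBump.nonneg

theorem w0_le_one (t : ℝ) : w0 t ≤ 1 := stdBump.le_one

theorem mem_Icc_of_w0_ne_zero {t : ℝ} (h : w0 t ≠ 0) : t ∈ Set.Icc (5 / 4 : ℝ) (7 / 4) := by
  have h1 : t ∈ Function.support stdBump := h
  rw [stdBump.support_eq, Metric.mem_ball, Real.dist_eq, abs_lt] at h1
  simp only [stdBump] at h1
  constructor <;> linarith [h1.1, h1.2]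

theorem w0_eq_zero_of_le {t : ℝ} (h : t ≤ 1) : w0 t = 0 := by
  by_contra h1; linarith [(mem_Icc_of_w0_ne_zero h1).1]

theorem w0_eq_zero_of_ge {t : ℝ} (h : 2 ≤ t) : w0 t = 0 := by
  by_contra h1; linarith [(mem_Icc_of_w0_ne_zero h1).2]

theorem hasCompactSupport_mul_w0 (f : ℝ → ℝ) : HasCompactSupport fun u => f u * w0 u :=
  HasCompactSupport.intro (isCompact_Icc (a := (5 / 4 : ℝ)) (b := 7 / 4)) fun u hu => by
    by_contra h
    exact hu (mem_Icc_of_w0_ne_zero fun h0 => h (by rw [h0, mul_zero]))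

theorem hasCompactSupport_w0 : HasCompactSupport w0 := by
  simpa using hasCompactSupport_mul_w0 fun _ => 1

theorem exists_abs_deriv_w0_le : ∃ M, 0 < M ∧ ∀ t, |deriv w0 t| ≤ M := by
  have h1 : Continuous (deriv w0) := contDiff_w0.continuous_deriv (by simp)
  obtain ⟨M, hM⟩ := h1.bounded_above_of_compact_support hasCompactSupport_w0.deriv
  exact ⟨max M 1, by positivity, fun t => (hM t).trans (le_max_left _ _)⟩

open scoped ContDiff FourierTransform SchwartzMap in
theorem exists_fourier_decay {φ : ℝ → ℝ} (h1 : HasCompactSupport φ) (h2 : ContDiff ℝ ∞ φ) (A : ℕ) :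
    ∃ C, 0 < C ∧ ∀ x : ℝ, (1 + |x|) ^ A * |∫ u, φ u * Real.cos (2 * π * x * u)| ≤ C ∧
      (1 + |x|) ^ A * |∫ u, φ u * Real.sin (2 * π * x * u)| ≤ C := by
  have h1' : HasCompactSupport fun u => (φ u : ℂ) := h1.comp_left (g := Complex.ofReal) (by simp)
  have h2' : ContDiff ℝ ∞ fun u => (φ u : ℂ) := Complex.ofRealCLM.contDiff.comp h2
  set S : 𝓢(ℝ, ℂ) := h1'.toSchwartzMap h2'
  set G : 𝓢(ℝ, ℂ) := 𝓕 S
  have hb := fun x => SchwartzMap.one_add_le_sup_seminorm_apply (𝕜 := ℝ) (m := (A, 0)) (k := A)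
    (n := 0) le_rfl le_rfl G x
  set C := (2 : ℝ) ^ A * ((Finset.Iic (A, 0)).sup fun m => SchwartzMap.seminorm ℝ m.1 m.2) G
  have hG : ∀ x : ℝ, G x = ∫ u, (φ u : ℂ) * Complex.exp (-(2 * π * x * u) * Complex.I) := by
    intro x
    have : G x = 𝓕 (fun u => (φ u : ℂ)) x := rfl
    rw [this, Real.fourier_eq']
    refine integral_congr_ae (Filter.Eventually.of_forall fun u => ?_)
    simp only [smul_eq_mul, RCLike.inner_apply, conj_trivial]
    rw [mul_comm]; congr 2
    push_cast; ring
  have h_integ : ∀ x : ℝ, Integrable fun u => (φ u : ℂ) * Complex.exp (-(2 * π * x * u) * Complex.I) := by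
    intro x
    have hc : Continuous φ := h2.continuous
    exact Continuous.integrable_of_hasCompactSupport (by fun_prop) h1'.mul_right
  have hre : ∀ x : ℝ, (G x).re = ∫ u, φ u * Real.cos (2 * π * x * u) := by
    intro x
    rw [hG]
    have := integral_re (𝕜 := ℂ) (h_integ x)
    simp only [RCLike.re_to_complex] at this
    rw [← this]
    refine integral_congr_ae (Filter.Eventually.of_forall fun u => ?_)
    dsimp only
    rw [Complex.re_ofReal_mul, show (-(2 * π * x * u) * Complex.I : ℂ) =
      ((-(2 * π * x * u) : ℝ) : ℂ) * Complex.I by push_cast; ring, Complex.exp_ofReal_mul_I_re,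
      Real.cos_neg]
  have him : ∀ x : ℝ, -(G x).im = ∫ u, φ u * Real.sin (2 * π * x * u) := by
    intro x
    rw [hG]
    have := integral_im (𝕜 := ℂ) (h_integ x)
    simp only [RCLike.im_to_complex] at this
    rw [← this, ← integral_neg]
    refine integral_congr_ae (Filter.Eventually.of_forall fun u => ?_)
    dsimp only
    rw [Complex.im_ofReal_mul, show (-(2 * π * x * u) * Complex.I : ℂ) =
      ((-(2 * π * x * u) : ℝ) : ℂ) * Complex.I by push_cast; ring, Complex.exp_ofReal_mul_I_im,
      Real.sin_neg]
    ring
  refine ⟨max C 1, by positivity, fun x => ?_⟩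
  have h3 := hb x
  rw [norm_iteratedFDeriv_zero, Real.norm_eq_abs] at h3
  have h4 : 0 ≤ (1 + |x|) ^ A := by positivity
  constructor
  · rw [← hre]
    refine le_trans (mul_le_mul_of_nonneg_left (Complex.abs_re_le_norm _) h4) ?_
    exact h3.trans (le_max_left _ _)
  · rw [← him, abs_neg]
    refine le_trans (mul_le_mul_of_nonneg_left (Complex.abs_im_le_norm _) h4) ?_
    exact h3.trans (le_max_left _ _)

/-- Cosine transform of `u w₀(u)`. -/
noncomputable def cosT (x : ℝ) : ℝ := ∫ u, u * w0 u * Real.cos (2 * π * x * u)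

/-- Sine transform of `u² w₀(u)`. -/
noncomputable def sinT (x : ℝ) : ℝ := ∫ u, u ^ 2 * w0 u * Real.sin (2 * π * x * u)

theorem exists_cosT_sinT_decay (A : ℕ) : ∃ C, 0 < C ∧ ∀ x : ℝ,
    (1 + |x|) ^ A * |cosT x| ≤ C ∧ (1 + |x|) ^ A * |sinT x| ≤ C := by
  have hw := contDiff_w0
  obtain ⟨C1, h1, h1'⟩ := exists_fourier_decay (hasCompactSupport_mul_w0 fun u => u)
    (by fun_prop) A
  obtain ⟨C2, h2, h2'⟩ := exists_fourier_decay (hasCompactSupport_mul_w0 fun u => u ^ 2)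
    (by fun_prop) A
  exact ⟨max C1 C2, by positivity, fun x =>
    ⟨(h1' x).1.trans (le_max_left _ _), (h2' x).2.trans (le_max_right _ _)⟩⟩

theorem cosT_zero_pos : 0 < cosT 0 := by
  have h : cosT 0 = ∫ u, u * w0 u := by
    unfold cosT; simp
  have hc : Continuous fun u => u * w0 u := by
    have := contDiff_w0.continuous; fun_prop
  have hnn : ∀ u, 0 ≤ u * w0 u := by
    intro u
    by_cases hu : w0 u = 0
    · simp [hu]
    · have := (mem_Icc_of_w0_ne_zero hu).1
      exact mul_nonneg (by linarith) (w0_nonneg u)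
  rw [h]
  refine Continuous.integral_pos_of_hasCompactSupport_nonneg_nonzero (x := 3 / 2) hc
    (hasCompactSupport_mul_w0 fun u => u) hnn ?_
  have : w0 (3 / 2) = 1 := stdBump.one_of_mem_closedBall (by
    simp [stdBump])
  rw [this]; norm_num

/-- The localised oscillating test function. -/
noncomputable def testW (L μ t : ℝ) : ℝ := w0 (t / L) * Real.sin (2 * π * μ * t)

/-- The radial transform of `testW L μ`. -/
noncomputable def radTerm (L μ ρ : ℝ) : ℝ :=
  if ρ = 0 then 4 * π * L ^ 3 * sinT (L * μ) else
    L ^ 2 / ρ * (cosT (L * (μ - ρ)) - cosT (L * (μ + ρ)))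

open scoped ContDiff in
theorem contDiff_testW (L μ : ℝ) : ContDiff ℝ ∞ (testW L μ) := by
  have := contDiff_w0
  unfold testW; fun_prop

theorem testW_eq_zero_of_le {L μ t : ℝ} (hL : 0 < L) (h : t ≤ L) : testW L μ t = 0 := by
  rw [testW, w0_eq_zero_of_le ((div_le_one hL).2 h), zero_mul]

theorem testW_eq_zero_of_ge {L μ t : ℝ} (hL : 0 < L) (h : 2 * L ≤ t) : testW L μ t = 0 := by
  rw [testW, w0_eq_zero_of_ge ((le_div_iff₀ hL).2 h), zero_mul]

theorem abs_testW_le_one (L μ t : ℝ) : |testW L μ t| ≤ 1 := by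
  rw [testW, abs_mul, abs_of_nonneg (w0_nonneg _)]
  exact mul_le_one₀ (w0_le_one _) (abs_nonneg _) (Real.abs_sin_le_one _)

theorem integral_scale (g : ℝ → ℝ) {L : ℝ} (hL : 0 < L) :
    ∫ r, g r = L * ∫ u, g (L * u) := by
  rw [MeasureTheory.Measure.integral_comp_mul_left g L, abs_of_pos (inv_pos.2 hL), smul_eq_mul,
    mul_inv_cancel_left₀ hL.ne']

theorem two_mul_integral_radK_testW {L μ : ℝ} (hL : 0 < L) (ρ : ℝ) :
    2 * ∫ r : ℝ, r * radK ρ r * testW L μ r = radTerm L μ ρ := by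
  rw [integral_scale _ hL]
  unfold radK radTerm testW
  simp only [mul_div_cancel_left₀ _ hL.ne']
  split_ifs with h
  · unfold sinT
    have : ∀ u : ℝ, L * u * (2 * π * (L * u)) * (w0 u * Real.sin (2 * π * μ * (L * u))) =
        (2 * π * L ^ 2) * (u ^ 2 * w0 u * Real.sin (2 * π * (L * μ) * u)) := by
      intro u
      rw [show 2 * π * μ * (L * u) = 2 * π * (L * μ) * u by ring]; ring
    simp_rw [this]
    rw [integral_const_mul]; ring
  · have hi : ∀ x : ℝ, Integrable fun u => u * w0 u * Real.cos (2 * π * x * u) := by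
      intro x
      have := contDiff_w0.continuous
      exact Continuous.integrable_of_hasCompactSupport (by fun_prop)
        (hasCompactSupport_mul_w0 fun u => u).mul_right
    have : ∀ u : ℝ, L * u * (Real.sin (2 * π * ρ * (L * u)) / ρ) *
        (w0 u * Real.sin (2 * π * μ * (L * u))) = L / (2 * ρ) *
        (u * w0 u * Real.cos (2 * π * (L * (μ - ρ)) * u) -
          u * w0 u * Real.cos (2 * π * (L * (μ + ρ)) * u)) := by
      intro u
      rw [show 2 * π * (L * (μ - ρ)) * u = 2 * π * μ * (L * u) - 2 * π * ρ * (L * u) by ring,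
        show 2 * π * (L * (μ + ρ)) * u = 2 * π * μ * (L * u) + 2 * π * ρ * (L * u) by ring,
        Real.cos_sub, Real.cos_add]
      field_simp; ring
    simp_rw [this]
    rw [integral_const_mul, integral_sub (hi _) (hi _)]
    change 2 * (L * (L / (2 * ρ) * (cosT (L * (μ - ρ)) - cosT (L * (μ + ρ))))) = _
    field_simp

theorem exists_hasSum_testW {L : ℝ} (hL : 0 < L) (μ : ℝ) :
    ∃ T : ℝ, HasSum (fun v : ℤ × ℤ × ℤ => testW L μ (√(nsq v : ℝ))) T ∧
      HasSum (fun v : ℤ × ℤ × ℤ => radTerm L μ (√(nsq v : ℝ))) T := by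
  have h := hasSum_radial (contDiff_testW L μ) (a := L) (b := 2 * L) hL (fun t ht => by
    constructor
    · by_contra h; exact ht (testW_eq_zero_of_le hL (not_le.1 h).le)
    · by_contra h; exact ht (testW_eq_zero_of_ge hL (not_le.1 h).le))
  simpa only [two_mul_integral_radK_testW hL] using h

theorem one_div_latticeWeight_le (v : ℤ × ℤ × ℤ) :
    1 ≤ (1 + √(nsq v : ℝ)) ^ 6 * latticeWeight v := by
  have h1 := nsq_real v
  have hs : √(nsq v : ℝ) ^ 2 = (v.1 : ℝ) ^ 2 + (v.2.1 : ℝ) ^ 2 + (v.2.2 : ℝ) ^ 2 := by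
    rw [Real.sq_sqrt (Nat.cast_nonneg _), h1]
  have h0 := Real.sqrt_nonneg (nsq v : ℝ)
  set ρ := √(nsq v : ℝ)
  have h2 : ∀ x : ℝ, x ^ 2 ≤ ρ ^ 2 → 1 + x ^ 2 ≤ (1 + ρ) ^ 2 := fun x hx => by nlinarith
  unfold latticeWeight
  rw [one_div_mul_one_div, one_div_mul_one_div, mul_one_div, le_div_iff₀ (by positivity), one_mul]
  have a1 := h2 v.1 (by rw [hs]; nlinarith [sq_nonneg (v.2.1 : ℝ), sq_nonneg (v.2.2 : ℝ)])
  have a2 := h2 v.2.1 (by rw [hs]; nlinarith [sq_nonneg (v.1 : ℝ), sq_nonneg (v.2.2 : ℝ)])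
  have a3 := h2 v.2.2 (by rw [hs]; nlinarith [sq_nonneg (v.1 : ℝ), sq_nonneg (v.2.1 : ℝ)])
  calc _ ≤ (1 + ρ) ^ 2 * ((1 + ρ) ^ 2 * (1 + ρ) ^ 2) := by gcongr
    _ = _ := by ring

theorem rapid_decay_aux {R y ρ q C : ℝ} (hR : 1 ≤ R) (hy : R ^ (1 / 8 : ℝ) ≤ y) (hρ : 0 ≤ ρ)
    (h : 1 + ρ ≤ (1 + y) * R ^ 2) (hq : (1 + y) ^ 134 * |q| ≤ C) :
    R ^ 4 * |q| * (1 + ρ) ^ 6 ≤ C := by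
  have hR8 : (0 : ℝ) ≤ R ^ (1 / 8 : ℝ) := by positivity
  have h1 : R ^ 16 ≤ (1 + y) ^ 128 := by
    calc R ^ 16 = (R ^ (1 / 8 : ℝ)) ^ 128 := by
          rw [← Real.rpow_natCast (R ^ (1 / 8 : ℝ)), ← Real.rpow_mul (by linarith)]
          rw [← Real.rpow_natCast]
          congr 1
          norm_num
      _ ≤ (1 + y) ^ 128 := by gcongr; linarith
  have hy0 : 0 ≤ 1 + y := by linarith
  calc R ^ 4 * |q| * (1 + ρ) ^ 6 ≤ R ^ 4 * |q| * ((1 + y) * R ^ 2) ^ 6 := by gcongr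
    _ = (1 + y) ^ 6 * R ^ 16 * |q| := by ring
    _ ≤ (1 + y) ^ 6 * (1 + y) ^ 128 * |q| := by gcongr
    _ = (1 + y) ^ 134 * |q| := by ring
    _ ≤ C := hq

theorem rapid_decay_lattice {R y q C : ℝ} (v : ℤ × ℤ × ℤ) (hR : 1 ≤ R) (hy : R ^ (1 / 8 : ℝ) ≤ y)
    (h : 1 + √(nsq v : ℝ) ≤ (1 + y) * R ^ 2) (hq : (1 + y) ^ 134 * |q| ≤ C) :
    R ^ 3 * |q| ≤ C * latticeWeight v := by
  have h1 := rapid_decay_aux hR hy (Real.sqrt_nonneg _) h hq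
  have h2 := one_div_latticeWeight_le v
  have h3 : 0 ≤ latticeWeight v := by unfold latticeWeight; positivity
  have h4 : R ^ 3 ≤ R ^ 4 := pow_le_pow_right₀ hR (by norm_num)
  calc R ^ 3 * |q| ≤ R ^ 4 * |q| * 1 := by rw [mul_one]; gcongr
    _ ≤ R ^ 4 * |q| * ((1 + √(nsq v : ℝ)) ^ 6 * latticeWeight v) := by gcongr
    _ = R ^ 4 * |q| * (1 + √(nsq v : ℝ)) ^ 6 * latticeWeight v := by ring
    _ ≤ C * latticeWeight v := by gcongr

/-- The lattice points that are close to resonance. -/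
noncomputable def nearSet (R L μ : ℝ) (M : ℕ) : Finset (ℤ × ℤ × ℤ) :=
  open Classical in
  (zball M).filter fun v => nsq v ≠ 0 ∧ L * |μ - √(nsq v : ℝ)| < R ^ (1 / 8 : ℝ)

theorem mem_nearSet {R L μ : ℝ} {M : ℕ} {v : ℤ × ℤ × ℤ} : v ∈ nearSet R L μ M ↔
    nsq v ≤ M ∧ nsq v ≠ 0 ∧ L * |μ - √(nsq v : ℝ)| < R ^ (1 / 8 : ℝ) := by
  classical
  unfold nearSet
  rw [Finset.mem_filter, mem_zball]

theorem exists_abs_sub_sum_nearSet_le : ∃ C > 0, ∀ (R L μ : ℝ) (M : ℕ), 1 ≤ R → 1 ≤ L → L ≤ R →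
    R ^ (1 / 8 : ℝ) ≤ L * μ → 1 + μ ≤ R ^ 2 → (μ + R) ^ 2 ≤ M → ∀ T : ℝ,
    HasSum (fun v : ℤ × ℤ × ℤ => testW L μ (√(nsq v : ℝ))) T →
    |T - ∑ v ∈ nearSet R L μ M, L ^ 2 / √(nsq v : ℝ) * cosT (L * (μ - √(nsq v : ℝ)))| ≤ C := by
  obtain ⟨C, hC, hdec⟩ := exists_cosT_sinT_decay 134
  have hsum0 : 0 < ∑' v, latticeWeight v :=
    summable_latticeWeight.tsum_pos (fun v => by unfold latticeWeight; positivity) 0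
      (by unfold latticeWeight; positivity)
  refine ⟨(4 * π * C) * ∑' v, latticeWeight v, by positivity, ?_⟩
  intro R L μ M hR hL hLR hLμ hμ hM T hT
  have hL0 : 0 < L := by linarith
  have hR8 : (1 : ℝ) ≤ R ^ (1 / 8 : ℝ) := Real.one_le_rpow hR (by norm_num)
  have hμ0 : 0 < μ := by
    by_contra h
    have : L * μ ≤ 0 := mul_nonpos_of_nonneg_of_nonpos hL0.le (not_lt.1 h)
    linarith
  have hRR : 1 ≤ R ^ 2 := one_le_pow₀ hR
  obtain ⟨T', h1, h2⟩ := exists_hasSum_testW hL0 μ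
  obtain rfl := hT.unique h1
  set F := nearSet R L μ M
  have h3 : HasSum (fun v : ℤ × ℤ × ℤ => if v ∈ F then
      L ^ 2 / √(nsq v : ℝ) * cosT (L * (μ - √(nsq v : ℝ))) else 0)
      (∑ v ∈ F, L ^ 2 / √(nsq v : ℝ) * cosT (L * (μ - √(nsq v : ℝ)))) := by
    have := hasSum_sum_of_ne_finset_zero (L := SummationFilter.unconditional _) (s := F) (f := fun v : ℤ × ℤ × ℤ => if v ∈ F then
      L ^ 2 / √(nsq v : ℝ) * cosT (L * (μ - √(nsq v : ℝ))) else 0)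
      (fun v hv => by simp only [hv, if_false])
    rwa [Finset.sum_congr rfl fun v hv => if_pos hv] at this
  have h4 := h2.sub h3
  rw [← h4.tsum_eq, ← Real.norm_eq_abs]
  refine tsum_of_norm_bounded (summable_latticeWeight.hasSum.mul_left (4 * π * C)) fun v => ?_
  have hlw : 0 ≤ latticeWeight v := by unfold latticeWeight; positivity
  set ρ := √(nsq v : ℝ) with hρdef
  have hρ0 : 0 ≤ ρ := Real.sqrt_nonneg _
  have hCl : 0 ≤ C * latticeWeight v := by positivity
  have hπ := Real.pi_gt_three
  have hL3 : L ^ 3 ≤ R ^ 3 := by gcongr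
  rw [Real.norm_eq_abs]
  by_cases hv : nsq v = 0
  · have hρ : ρ = 0 := by rw [hρdef, hv]; simp
    have hvF : v ∉ F := fun h => (mem_nearSet.1 h).2.1 hv
    simp only [hvF, if_false, radTerm, hρ, if_true, sub_zero]
    have h5 := rapid_decay_lattice v hR (y := |L * μ|) (q := sinT (L * μ)) (C := C)
      (by rw [abs_of_nonneg (by positivity)]; exact hLμ)
      (by rw [← hρdef, hρ, add_zero]; have := abs_nonneg (L * μ); nlinarith) (hdec _).2
    rw [abs_mul, abs_of_pos (by positivity)]
    calc 4 * π * L ^ 3 * |sinT (L * μ)| ≤ 4 * π * (R ^ 3 * |sinT (L * μ)|) := by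
          rw [mul_assoc]; gcongr
      _ ≤ 4 * π * (C * latticeWeight v) := by gcongr
      _ = _ := by ring
  · have hn1 : (1 : ℝ) ≤ nsq v := by exact_mod_cast Nat.one_le_iff_ne_zero.2 hv
    have hρ1 : 1 ≤ ρ := Real.one_le_sqrt.2 hn1
    have hρne : ρ ≠ 0 := by linarith
    have hco : L ^ 2 / ρ ≤ R ^ 3 := by
      calc L ^ 2 / ρ ≤ L ^ 2 := div_le_self (by positivity) hρ1
        _ ≤ R ^ 2 := by gcongr
        _ ≤ R ^ 3 := pow_le_pow_right₀ hR (by norm_num)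
    have hplus : R ^ 3 * |cosT (L * (μ + ρ))| ≤ C * latticeWeight v := by
      refine rapid_decay_lattice v hR (y := |L * (μ + ρ)|) ?_ ?_ (hdec _).1
      · rw [abs_of_nonneg (by positivity)]; nlinarith
      · rw [abs_of_nonneg (by positivity), ← hρdef]
        have : ρ ≤ L * (μ + ρ) := by nlinarith
        nlinarith
    have hfar : R ^ (1 / 8 : ℝ) ≤ L * |μ - ρ| → R ^ 3 * |cosT (L * (μ - ρ))| ≤ C * latticeWeight v := by
      intro hf
      have e : |L * (μ - ρ)| = L * |μ - ρ| := by rw [abs_mul, abs_of_pos hL0]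
      refine rapid_decay_lattice v hR (y := |L * (μ - ρ)|) (e ▸ hf) ?_ (hdec _).1
      rw [e, ← hρdef]
      have a1 : ρ - μ ≤ |μ - ρ| := by rw [abs_sub_comm]; exact le_abs_self _
      have a2 : |μ - ρ| ≤ L * |μ - ρ| := le_mul_of_one_le_left (abs_nonneg _) hL
      nlinarith [abs_nonneg (μ - ρ)]
    have hb : ∀ x : ℝ, R ^ 3 * |x| ≤ C * latticeWeight v →
        |L ^ 2 / ρ * x| ≤ C * latticeWeight v := by
      intro x hx
      rw [abs_mul, abs_of_nonneg (by positivity)]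
      exact le_trans (by gcongr) hx
    by_cases hvF : v ∈ F
    · simp only [hvF, if_true, radTerm, hρne, if_false]
      rw [show L ^ 2 / ρ * (cosT (L * (μ - ρ)) - cosT (L * (μ + ρ))) -
        L ^ 2 / ρ * cosT (L * (μ - ρ)) = -(L ^ 2 / ρ * cosT (L * (μ + ρ))) by ring, abs_neg]
      nlinarith [hb _ hplus]
    · have hf : R ^ (1 / 8 : ℝ) ≤ L * |μ - ρ| := by
        by_contra hcon
        rw [not_le] at hcon
        apply hvF
        refine mem_nearSet.2 ⟨?_, hv, hcon⟩
        have a1 : ρ - μ ≤ |μ - ρ| := by rw [abs_sub_comm]; exact le_abs_self _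
        have a2 : |μ - ρ| ≤ L * |μ - ρ| := le_mul_of_one_le_left (abs_nonneg _) hL
        have a3 : R ^ (1 / 8 : ℝ) ≤ R := by
          conv_rhs => rw [← Real.rpow_one R]
          exact Real.rpow_le_rpow_of_exponent_le hR (by norm_num)
        have a4 : ρ ≤ μ + R := by linarith
        have a5 : (nsq v : ℝ) ≤ (μ + R) ^ 2 := (Real.sqrt_le_left (by linarith)).1 a4
        exact_mod_cast a5.trans hM
      simp only [hvF, if_false, radTerm, hρne, sub_zero]
      rw [mul_sub]
      have b1 := hb _ hplus
      have b2 := hb _ (hfar hf)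
      have b3 := abs_sub (L ^ 2 / ρ * cosT (L * (μ - ρ))) (L ^ 2 / ρ * cosT (L * (μ + ρ)))
      nlinarith

theorem card_le_of_forall_mem_Icc {s : Finset ℕ} {a b : ℝ} (hab : a ≤ b)
    (h : ∀ n ∈ s, a ≤ n ∧ (n : ℝ) ≤ b) : (s.card : ℝ) ≤ b - a + 1 := by
  have h1 : (s.map Nat.castEmbedding : Finset ℤ) ⊆ Finset.Icc ⌈a⌉ ⌊b⌋ := by
    intro z hz
    obtain ⟨n, hn, rfl⟩ := Finset.mem_map.1 hz
    have := h n hn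
    exact Finset.mem_Icc.2 ⟨Int.ceil_le.2 (by simpa using this.1),
      Int.le_floor.2 (by simpa using this.2)⟩
  have h2 := Finset.card_le_card h1
  rw [Finset.card_map, Int.card_Icc] at h2
  by_cases h3 : 0 ≤ ⌊b⌋ + 1 - ⌈a⌉
  · have h4 : (s.card : ℤ) ≤ ⌊b⌋ + 1 - ⌈a⌉ := by
      have := Int.toNat_of_nonneg h3; omega
    have h5 : (s.card : ℝ) ≤ ⌊b⌋ + 1 - ⌈a⌉ := by exact_mod_cast h4
    linarith [Int.floor_le b, Int.le_ceil a]
  · have : s.card = 0 := by omega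
    rw [this]; push_cast; linarith

theorem sum_nsq_le_sum_r3 (S : Finset (ℤ × ℤ × ℤ)) (f : ℕ → ℝ) (hf : ∀ n, 0 ≤ f n) :
    ∑ v ∈ S, f (nsq v) ≤ ∑ n ∈ S.image nsq, (r3 n : ℝ) * f n := by
  rw [← Finset.sum_fiberwise_of_maps_to (g := nsq) (t := S.image nsq)
    (fun v hv => Finset.mem_image_of_mem nsq hv)]
  refine Finset.sum_le_sum fun n _ => ?_
  rw [Finset.sum_congr rfl (g := fun _ => f n) (fun v hv => by rw [(Finset.mem_filter.1 hv).2]),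
    Finset.sum_const, nsmul_eq_mul]
  have : (S.filter fun v => nsq v = n).card ≤ r3 n := by
    unfold r3
    refine Finset.card_le_card fun v hv => ?_
    have h := (Finset.mem_filter.1 hv).2
    exact Finset.mem_filter.2 ⟨mem_zball.2 h.le, h⟩
  have := hf n
  gcongr

theorem exists_sum_nonresonant_le (P : ℕ) (hP : 1 ≤ P) : ∃ C > 0, ∀ (R : ℝ) (d m M : ℕ), 2 ≤ R →
    1 ≤ d → 1 ≤ m → (d : ℝ) ≤ R → 1 + √(m : ℝ) / P * d ≤ R ^ 2 →
    ∑ v ∈ (nearSet R (R / d) (√(m : ℝ) / P * d) M).filter (fun v => P ^ 2 * nsq v ≠ m * d ^ 2),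
      |(R / d) ^ 2 / √(nsq v : ℝ) * cosT ((R / d) * (√(m : ℝ) / P * d - √(nsq v : ℝ)))| ≤
      C * R ^ (19 / 16 : ℝ) * √(m : ℝ) := by
  obtain ⟨C0, hC0, hdec⟩ := exists_cosT_sinT_decay 0
  obtain ⟨C1, hC1, hr3⟩ := r3_le_rpow (1 / 96) (by norm_num)
  refine ⟨C0 * (2 + P ^ 2) * C1 * 3, by positivity, ?_⟩
  intro R d m M hR hd hm hdR hμR
  have hd1 : (1 : ℝ) ≤ d := by exact_mod_cast hd
  have hP1 : (1 : ℝ) ≤ P := by exact_mod_cast hP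
  have hm1 : (1 : ℝ) ≤ √(m : ℝ) := Real.one_le_sqrt.2 (by exact_mod_cast hm)
  have hR0 : 0 < R := by linarith
  set L := R / d with hL
  set μ := √(m : ℝ) / P * d with hμ
  have hL1 : 1 ≤ L := (one_le_div (by linarith)).2 hdR
  have hμ0 : 0 ≤ μ := by positivity
  set S := (nearSet R L μ M).filter (fun v => P ^ 2 * nsq v ≠ m * d ^ 2)
  set h := R ^ (1 / 8 : ℝ) / L with hh
  have hh0 : 0 ≤ h := by positivity
  set Y := h * (2 * μ + h) with hY
  have hhR : h ≤ R := by
    have a3 : R ^ (1 / 8 : ℝ) ≤ R := by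
      conv_rhs => rw [← Real.rpow_one R]
      exact Real.rpow_le_rpow_of_exponent_le (by linarith) (by norm_num)
    exact (div_le_self (by positivity) hL1).trans a3
  have hmem : ∀ v ∈ S, nsq v ≠ 0 ∧ |μ - √(nsq v : ℝ)| < h ∧ P ^ 2 * nsq v ≠ m * d ^ 2 := by
    intro v hv
    obtain ⟨h1, h2⟩ := Finset.mem_filter.1 hv
    obtain ⟨_, h3, h4⟩ := mem_nearSet.1 h1
    exact ⟨h3, by rw [hh, lt_div_iff₀ (by linarith), mul_comm]; exact h4, h2⟩
  have hYv : ∀ v ∈ S, |(nsq v : ℝ) - μ ^ 2| ≤ Y := by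
    intro v hv
    obtain ⟨_, h2, _⟩ := hmem v hv
    have h3 : √(nsq v : ℝ) ^ 2 = nsq v := Real.sq_sqrt (Nat.cast_nonneg _)
    have h0 := Real.sqrt_nonneg (nsq v : ℝ)
    set ρ := √(nsq v : ℝ)
    rw [← h3, show ρ ^ 2 - μ ^ 2 = -((μ - ρ) * (μ + ρ)) by ring, abs_neg, abs_mul,
      abs_of_nonneg (by positivity : 0 ≤ μ + ρ)]
    have : ρ ≤ μ + h := by linarith [(abs_lt.1 h2).1]
    exact mul_le_mul h2.le (by linarith) (by positivity) hh0
  have hn : ∀ v ∈ S, (nsq v : ℝ) ^ (1 / 96 : ℝ) ≤ R ^ (1 / 16 : ℝ) := by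
    intro v hv
    obtain ⟨_, h2, _⟩ := hmem v hv
    have h3 : √(nsq v : ℝ) ≤ R ^ 3 := by
      have : √(nsq v : ℝ) ≤ μ + h := by linarith [(abs_lt.1 h2).1]
      nlinarith [sq_nonneg R]
    have h4 : (nsq v : ℝ) ≤ R ^ 6 := by
      have := (Real.sqrt_le_left (by positivity)).1 h3
      calc _ ≤ _ := this
        _ = _ := by ring
    calc (nsq v : ℝ) ^ (1 / 96 : ℝ) ≤ (R ^ 6) ^ (1 / 96 : ℝ) := by gcongr
      _ = _ := by
        rw [← Real.rpow_natCast, ← Real.rpow_mul hR0.le]; norm_num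
  have hcard : ((S.image nsq).card : ℝ) ≤ (2 + P ^ 2) * Y := by
    rcases S.eq_empty_or_nonempty with he | ⟨v, hv⟩
    · rw [he]; simp only [Finset.image_empty, Finset.card_empty, Nat.cast_zero]; positivity
    · have h1 : 1 ≤ P ^ 2 * Y := by
        obtain ⟨_, _, h3⟩ := hmem v hv
        have h4 := hYv v hv
        have h5 : (1 : ℝ) ≤ |(P : ℝ) ^ 2 * nsq v - m * d ^ 2| := by
          have : (1 : ℤ) ≤ |(P : ℤ) ^ 2 * nsq v - m * d ^ 2| :=
            Int.one_le_abs (sub_ne_zero.2 (by exact_mod_cast h3))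
          exact_mod_cast this
        have h6 : (P : ℝ) ^ 2 * nsq v - m * d ^ 2 = P ^ 2 * (nsq v - μ ^ 2) := by
          rw [hμ, mul_pow, div_pow, Real.sq_sqrt (Nat.cast_nonneg _)]
          field_simp
        rw [h6, abs_mul, abs_of_nonneg (by positivity)] at h5
        exact h5.trans (by gcongr)
      have h2 := card_le_of_forall_mem_Icc (s := S.image nsq) (a := μ ^ 2 - Y) (b := μ ^ 2 + Y)
        (by have : 0 ≤ Y := by positivity
            linarith) (by
          intro n hn
          obtain ⟨v, hv, rfl⟩ := Finset.mem_image.1 hn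
          have := abs_le.1 (hYv v hv)
          constructor <;> linarith)
      linarith
  have hstep : ∀ v ∈ S, |L ^ 2 / √(nsq v : ℝ) * cosT (L * (μ - √(nsq v : ℝ)))| ≤
      C0 * L ^ 2 * (1 / √(nsq v : ℝ)) := by
    intro v hv
    have := (hdec (L * (μ - √(nsq v : ℝ)))).1
    rw [pow_zero, one_mul] at this
    rw [abs_mul, abs_of_nonneg (by positivity)]
    calc _ ≤ L ^ 2 / √(nsq v : ℝ) * C0 := by gcongr
      _ = _ := by ring
  have hLY : L ^ 2 * Y ≤ R ^ (9 / 8 : ℝ) * (3 * √(m : ℝ)) := by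
    have e1 : L * h = R ^ (1 / 8 : ℝ) := by rw [hh]; field_simp
    have e2 : L * μ = R * (√(m : ℝ) / P) := by rw [hL, hμ]; field_simp
    have e3 : R ^ (9 / 8 : ℝ) = R ^ (1 / 8 : ℝ) * R := by
      rw [show (9 / 8 : ℝ) = 1 / 8 + 1 by norm_num, Real.rpow_add hR0, Real.rpow_one]
    have e4 : √(m : ℝ) / P ≤ √(m : ℝ) := div_le_self (by positivity) hP1
    have e5 : R ^ (1 / 8 : ℝ) ≤ R := by
      conv_rhs => rw [← Real.rpow_one R]
      exact Real.rpow_le_rpow_of_exponent_le (by linarith) (by norm_num)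
    calc L ^ 2 * Y = (L * h) * (2 * (L * μ) + L * h) := by rw [hY]; ring
      _ = R ^ (1 / 8 : ℝ) * (2 * (R * (√(m : ℝ) / P)) + R ^ (1 / 8 : ℝ)) := by rw [e1, e2]
      _ ≤ R ^ (1 / 8 : ℝ) * (2 * (R * √(m : ℝ)) + R * √(m : ℝ)) := by
          gcongr
          nlinarith
      _ = _ := by rw [e3]; ring
  calc _ ≤ ∑ v ∈ S, C0 * L ^ 2 * (1 / √(nsq v : ℝ)) := Finset.sum_le_sum hstep
    _ = C0 * L ^ 2 * ∑ v ∈ S, 1 / √(nsq v : ℝ) := by rw [Finset.mul_sum]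
    _ ≤ C0 * L ^ 2 * ∑ n ∈ S.image nsq, (r3 n : ℝ) * (1 / √(n : ℝ)) := by
        gcongr
        exact sum_nsq_le_sum_r3 S (fun n => 1 / √(n : ℝ)) fun n => by positivity
    _ ≤ C0 * L ^ 2 * ∑ n ∈ S.image nsq, C1 * R ^ (1 / 16 : ℝ) := by
        refine mul_le_mul_of_nonneg_left (Finset.sum_le_sum fun n hn' => ?_) (by positivity)
        obtain ⟨v, hv, rfl⟩ := Finset.mem_image.1 hn'
        have h0 := (hmem v hv).1
        have hpos : (0 : ℝ) < nsq v := by exact_mod_cast Nat.pos_of_ne_zero h0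
        calc (r3 (nsq v) : ℝ) * (1 / √(nsq v : ℝ)) ≤
            (C1 * (nsq v : ℝ) ^ (1 / 2 + 1 / 96 : ℝ)) * (1 / √(nsq v : ℝ)) := by
              gcongr; exact hr3 _ h0
          _ = C1 * (nsq v : ℝ) ^ (1 / 96 : ℝ) := by
              rw [Real.rpow_add hpos, ← Real.sqrt_eq_rpow]
              field_simp
          _ ≤ _ := by exact mul_le_mul_of_nonneg_left (hn v hv) hC1.le
    _ = C0 * L ^ 2 * ((S.image nsq).card * (C1 * R ^ (1 / 16 : ℝ))) := by
        rw [Finset.sum_const, nsmul_eq_mul]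
    _ ≤ C0 * L ^ 2 * (((2 + P ^ 2) * Y) * (C1 * R ^ (1 / 16 : ℝ))) := by gcongr
    _ = C0 * (2 + P ^ 2) * C1 * R ^ (1 / 16 : ℝ) * (L ^ 2 * Y) := by ring
    _ ≤ C0 * (2 + P ^ 2) * C1 * R ^ (1 / 16 : ℝ) * (R ^ (9 / 8 : ℝ) * (3 * √(m : ℝ))) := by
        gcongr
    _ = C0 * (2 + P ^ 2) * C1 * 3 * (R ^ (1 / 16 : ℝ) * R ^ (9 / 8 : ℝ)) * √(m : ℝ) := by ring
    _ = _ := by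
        rw [← Real.rpow_add hR0]; norm_num

theorem dvd_of_sq_mul_eq_mul_sq {P n m d : ℕ} (hP : 1 ≤ P) (hm : Squarefree m)
    (h : P ^ 2 * n = m * d ^ 2) : P ∣ d := by
  obtain ⟨g, a, b, hg, hab, rfl, rfl⟩ := Nat.exists_coprime' (m := P) (n := d)
    (Nat.gcd_pos_of_pos_left d (by omega))
  have h1 : a ^ 2 * n = m * b ^ 2 := by
    have : g ^ 2 * (a ^ 2 * n) = g ^ 2 * (m * b ^ 2) := by linarith [h]
    exact Nat.eq_of_mul_eq_mul_left (by positivity) this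
  have h2 : a ^ 2 ∣ m :=
    (Nat.Coprime.pow 2 2 hab).dvd_of_dvd_mul_right (h1 ▸ dvd_mul_right _ _)
  have h3 : a = 1 := Nat.isUnit_iff.1 (hm a (by rwa [← sq]))
  rw [h3, one_mul]
  exact dvd_mul_left _ _

/-- The contribution of the lattice points `v` with `P ^ 2 * nsq v = m * d ^ 2`. -/
noncomputable def resTerm (P : ℕ) (R : ℝ) (d m : ℕ) : ℝ :=
  if P ∣ d then (r3 (m * (d / P) ^ 2) : ℝ) * ((R / d) ^ 2 / (√(m : ℝ) / P * d) * cosT 0) else 0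

theorem exists_abs_sub_resTerm_le (P : ℕ) (hP : 1 ≤ P) : ∃ C > 0, ∀ (R : ℝ) (d m : ℕ), 2 ≤ R →
    1 ≤ d → Squarefree m → (d : ℝ) ≤ R → 1 + √(m : ℝ) / P * d ≤ R ^ 2 →
    R ^ (1 / 8 : ℝ) ≤ R / P → ∀ T : ℝ,
    HasSum (fun v => testW (R / d) (√(m : ℝ) / P * d) (√(nsq v : ℝ))) T →
    |T - resTerm P R d m| ≤ C * R ^ (19 / 16 : ℝ) * √(m : ℝ) := by
  obtain ⟨C3, hC3, h3⟩ := exists_abs_sub_sum_nearSet_le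
  obtain ⟨C4, hC4, h4⟩ := exists_sum_nonresonant_le P hP
  refine ⟨C3 + C4, by positivity, ?_⟩
  intro R d m hR hd hm hdR hμR hRP T hT
  have hm0 : 1 ≤ m := Nat.one_le_iff_ne_zero.2 hm.ne_zero
  have hd1 : (1 : ℝ) ≤ d := by exact_mod_cast hd
  have hP1 : (1 : ℝ) ≤ P := by exact_mod_cast hP
  have hm1 : (1 : ℝ) ≤ √(m : ℝ) := Real.one_le_sqrt.2 (by exact_mod_cast hm0)
  have hR0 : 0 < R := by linarith
  set L := R / d with hL
  set μ := √(m : ℝ) / P * d with hμ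
  have hL1 : 1 ≤ L := (one_le_div (by linarith)).2 hdR
  have hμ0 : 0 < μ := by positivity
  have hLμ : L * μ = R * (√(m : ℝ) / P) := by rw [hL, hμ]; field_simp
  set M := ⌈(μ + R) ^ 2⌉₊ with hM
  have hMle : (μ + R) ^ 2 ≤ M := Nat.le_ceil _
  have e3 := h3 R L μ M (by linarith) hL1 (div_le_self hR0.le hd1) (by
    rw [hLμ]
    refine hRP.trans ?_
    rw [mul_div_assoc', mul_comm, mul_div_assoc]
    exact le_mul_of_one_le_left (by positivity) hm1) hμR hMle T hT
  have e4 := h4 R d m M hR hd hm0 hdR hμR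
  rw [← hL, ← hμ] at e4
  have hμsq : (P : ℝ) ^ 2 * μ ^ 2 = m * d ^ 2 := by
    rw [hμ, mul_pow, div_pow, Real.sq_sqrt (Nat.cast_nonneg _)]; field_simp
  have hres : ∀ v, P ^ 2 * nsq v = m * d ^ 2 → (nsq v : ℝ) = μ ^ 2 := by
    intro v hv
    have : (P : ℝ) ^ 2 * nsq v = m * d ^ 2 := by exact_mod_cast hv
    rw [← hμsq] at this
    exact mul_left_cancel₀ (by positivity) this
  have hsum : ∑ v ∈ (nearSet R L μ M).filter (fun v => P ^ 2 * nsq v = m * d ^ 2),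
      L ^ 2 / √(nsq v : ℝ) * cosT (L * (μ - √(nsq v : ℝ))) = resTerm P R d m := by
    have a1 : ∀ v ∈ (nearSet R L μ M).filter (fun v => P ^ 2 * nsq v = m * d ^ 2),
        L ^ 2 / √(nsq v : ℝ) * cosT (L * (μ - √(nsq v : ℝ))) = L ^ 2 / μ * cosT 0 := by
      intro v hv
      rw [hres v (Finset.mem_filter.1 hv).2, Real.sqrt_sq hμ0.le, sub_self, mul_zero]
    rw [Finset.sum_congr rfl a1, Finset.sum_const, nsmul_eq_mul]
    unfold resTerm
    split_ifs with hPd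
    · congr 2
      unfold r3
      congr 1
      obtain ⟨k, rfl⟩ := hPd
      rw [Nat.mul_div_cancel_left _ (by omega)]
      have hiff : ∀ v, P ^ 2 * nsq v = m * (P * k) ^ 2 ↔ nsq v = m * k ^ 2 := by
        intro v
        rw [show m * (P * k) ^ 2 = P ^ 2 * (m * k ^ 2) by ring]
        exact Nat.mul_right_inj (by positivity)
      ext v
      rw [Finset.mem_filter, Finset.mem_filter, mem_nearSet, mem_zball, hiff]
      constructor
      · rintro ⟨_, h⟩; exact ⟨h.le, h⟩
      · rintro ⟨_, h⟩
        have hv := hres v ((hiff v).2 h)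
        refine ⟨⟨?_, ?_, ?_⟩, h⟩
        · have : (nsq v : ℝ) ≤ M := by
            rw [hv]; refine le_trans ?_ hMle; gcongr; linarith
          exact_mod_cast this
        · rw [h]
          have : 0 < k := Nat.pos_of_ne_zero (by rintro rfl; simp at hd)
          positivity
        · rw [hv, Real.sqrt_sq hμ0.le, sub_self, abs_zero, mul_zero]; positivity
    · rw [Finset.filter_eq_empty_iff.2, Finset.card_empty, Nat.cast_zero, zero_mul]
      intro v _ hv
      exact hPd (dvd_of_sq_mul_eq_mul_sq hP hm hv)
  have hsplit := Finset.sum_filter_add_sum_filter_not (nearSet R L μ M)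
    (fun v => P ^ 2 * nsq v = m * d ^ 2)
    (fun v => L ^ 2 / √(nsq v : ℝ) * cosT (L * (μ - √(nsq v : ℝ))))
  rw [hsum] at hsplit
  have e5 := (Finset.abs_sum_le_sum_abs _ _).trans e4
  have e6 : 1 ≤ R ^ (19 / 16 : ℝ) * √(m : ℝ) :=
    one_le_mul_of_one_le_of_one_le (Real.one_le_rpow (by linarith) (by norm_num)) hm1
  rw [← hsplit] at e3
  have e7 := abs_le.1 e3
  have e8 := abs_le.1 e5
  rw [abs_le]
  constructor <;> nlinarith

/-- The greatest common divisor of the coordinates of a lattice point. -/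
def vgcd (v : ℤ × ℤ × ℤ) : ℕ := Int.gcd (Int.gcd v.1 v.2.1 : ℤ) v.2.2

theorem dvd_vgcd_iff {d : ℕ} {v : ℤ × ℤ × ℤ} :
    d ∣ vgcd v ↔ (d : ℤ) ∣ v.1 ∧ (d : ℤ) ∣ v.2.1 ∧ (d : ℤ) ∣ v.2.2 := by
  unfold vgcd
  rw [Int.dvd_gcd_iff', Int.natCast_dvd_natCast, Int.dvd_gcd_iff']
  tauto
where
  Int.dvd_gcd_iff' {d : ℕ} {a b : ℤ} : d ∣ Int.gcd a b ↔ (d : ℤ) ∣ a ∧ (d : ℤ) ∣ b := by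
    rw [← Int.natCast_dvd_natCast, Int.dvd_coe_gcd_iff]

theorem vgcd_eq_zero {v : ℤ × ℤ × ℤ} : vgcd v = 0 ↔ v = 0 := by
  unfold vgcd
  rw [Int.gcd_eq_zero_iff, Int.natCast_eq_zero, Int.gcd_eq_zero_iff, Prod.ext_iff, Prod.ext_iff]
  simp only [Prod.fst_zero, Prod.snd_zero]
  tauto

theorem nsq_smul (d : ℕ) (v : ℤ × ℤ × ℤ) : nsq ((d : ℤ) • v) = d ^ 2 * nsq v := by
  have h : (nsq ((d : ℤ) • v) : ℤ) = d ^ 2 * nsq v := by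
    rw [nsq_int, nsq_int]
    simp only [Prod.smul_fst, Prod.smul_snd, smul_eq_mul]
    ring
  exact_mod_cast h

theorem vgcd_le_nsq {v : ℤ × ℤ × ℤ} : vgcd v ≤ nsq v := by
  by_cases hv : v = 0
  · rw [vgcd_eq_zero.2 hv]; exact Nat.zero_le _
  · obtain ⟨⟨a, ha⟩, ⟨b, hb⟩, ⟨c, hc⟩⟩ := dvd_vgcd_iff.1 (dvd_refl (vgcd v))
    have h1 : v = ((vgcd v : ℕ) : ℤ) • (a, b, c) := by
      ext
      · exact ha
      · exact hb
      · exact hc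
    have h2 : nsq v = vgcd v ^ 2 * nsq (a, b, c) := by
      conv_lhs => rw [h1]
      exact nsq_smul _ _
    have h3 : nsq v ≠ 0 := fun h => hv (nsq_eq_zero.1 h)
    rw [h2]
    have h4 : vgcd v ^ 2 * nsq (a, b, c) ≠ 0 := h2 ▸ h3
    have h5 := Nat.pos_of_ne_zero (left_ne_zero_of_mul h4)
    have h6 := Nat.pos_of_ne_zero (right_ne_zero_of_mul h4)
    nlinarith [Nat.le_self_pow two_ne_zero (vgcd v)]

theorem sum_moebius_divisors (n : ℕ) :
    ∑ d ∈ n.divisors, ArithmeticFunction.moebius d = if n = 1 then 1 else 0 := by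
  rw [← ArithmeticFunction.coe_mul_zeta_apply, ArithmeticFunction.moebius_mul_coe_zeta,
    ArithmeticFunction.one_apply]

theorem sum_primitive_eq (M : ℕ) (F : ℤ × ℤ × ℤ → ℝ) (hF : F 0 = 0) :
    ∑ v ∈ (zball M).filter (fun v => vgcd v = 1), F v =
      ∑ d ∈ Finset.Icc 1 M, (ArithmeticFunction.moebius d : ℝ) *
        ∑ v ∈ (zball M).filter (fun v => d ∣ vgcd v), F v := by
  have h : ∀ v ∈ zball M, (if vgcd v = 1 then F v else 0) =
      ∑ d ∈ Finset.Icc 1 M, if d ∣ vgcd v then (ArithmeticFunction.moebius d : ℝ) * F v else 0 := by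
    intro v hv
    by_cases h0 : v = 0
    · subst h0; simp [hF]
    · have h1 : (Finset.Icc 1 M).filter (fun d => d ∣ vgcd v) = (vgcd v).divisors := by
        ext d
        rw [Finset.mem_filter, Finset.mem_Icc, Nat.mem_divisors]
        have hg : vgcd v ≠ 0 := fun h => h0 (vgcd_eq_zero.1 h)
        refine ⟨fun h => ⟨h.2, hg⟩, fun h => ⟨⟨Nat.pos_of_dvd_of_pos h.1 (Nat.pos_of_ne_zero hg), ?_⟩, h.1⟩⟩
        exact (Nat.le_of_dvd (Nat.pos_of_ne_zero hg) h.1).trans (vgcd_le_nsq.trans (mem_zball.1 hv))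
      rw [← Finset.sum_filter, h1, ← Finset.sum_mul]
      have := sum_moebius_divisors (vgcd v)
      have h2 : ∑ d ∈ (vgcd v).divisors, (ArithmeticFunction.moebius d : ℝ) =
          if vgcd v = 1 then 1 else 0 := by exact_mod_cast this
      rw [h2]
      split_ifs <;> simp
  rw [Finset.sum_filter, Finset.sum_congr rfl h, Finset.sum_comm]
  refine Finset.sum_congr rfl fun d _ => ?_
  rw [Finset.mul_sum, Finset.sum_filter]

theorem testW_zero (L μ : ℝ) (hL : 0 < L) : testW L μ 0 = 0 := testW_eq_zero_of_le hL hL.le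

theorem testW_mul {R : ℝ} {d : ℕ} (hd : 1 ≤ d) (lam t : ℝ) :
    testW R lam (d * t) = testW (R / d) (lam * d) t := by
  have : (d : ℝ) ≠ 0 := by exact_mod_cast (by omega : d ≠ 0)
  unfold testW
  congr 2
  · field_simp
  · ring

theorem testW_sqrt_ne_zero {L μ : ℝ} (hL : 0 < L) {v : ℤ × ℤ × ℤ}
    (h : testW L μ (√(nsq v : ℝ)) ≠ 0) : (nsq v : ℝ) ≤ (2 * L) ^ 2 := by
  by_contra h1
  exact h (testW_eq_zero_of_ge hL (Real.le_sqrt_of_sq_le (not_le.1 h1).le))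

theorem sum_dvd_vgcd_eq {R : ℝ} (hR : 0 < R) {d : ℕ} (hd : 1 ≤ d) (lam : ℝ) {M : ℕ}
    (hM : (2 * R) ^ 2 ≤ M) :
    ∑ v ∈ (zball M).filter (fun v => d ∣ vgcd v), testW R lam (√(nsq v : ℝ)) =
      ∑ u ∈ zball M, testW (R / d) (lam * d) (√(nsq u : ℝ)) := by
  have hkey : ∀ u : ℤ × ℤ × ℤ, testW R lam (√(nsq ((d : ℤ) • u) : ℝ)) =
      testW (R / d) (lam * d) (√(nsq u : ℝ)) := by
    intro u
    rw [nsq_smul, ← testW_mul hd]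
    congr 1
    push_cast
    rw [Real.sqrt_mul (by positivity), Real.sqrt_sq (by positivity)]
  have hdz : (d : ℤ) ≠ 0 := by omega
  symm
  refine Finset.sum_bij_ne_zero (fun u _ _ => (d : ℤ) • u) ?_ ?_ ?_ ?_
  · intro u hu hne
    rw [← hkey] at hne
    refine Finset.mem_filter.2 ⟨mem_zball.2 ?_, dvd_vgcd_iff.2 ?_⟩
    · exact_mod_cast (testW_sqrt_ne_zero hR hne).trans hM
    · exact ⟨dvd_mul_right _ _, dvd_mul_right _ _, dvd_mul_right _ _⟩
  · intro u _ _ w _ _ h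
    exact smul_right_injective _ hdz h
  · intro v hv hne
    obtain ⟨h1, h2⟩ := Finset.mem_filter.1 hv
    obtain ⟨⟨a, ha⟩, ⟨b, hb⟩, ⟨c, hc⟩⟩ := dvd_vgcd_iff.1 h2
    have h3 : v = (d : ℤ) • ((a, b, c) : ℤ × ℤ × ℤ) := by
      ext
      · exact ha
      · exact hb
      · exact hc
    refine ⟨(a, b, c), mem_zball.2 ?_, ?_, h3.symm⟩
    · rw [h3, mem_zball, nsq_smul] at h1
      nlinarith [Nat.one_le_pow 2 d hd]
    · rw [h3, hkey] at hne; exact hne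
  · intro u _ _
    exact (hkey u).symm

theorem hasSum_testW_zball {L : ℝ} (hL : 0 < L) (μ : ℝ) {M : ℕ} (hM : (2 * L) ^ 2 ≤ M) :
    HasSum (fun v => testW L μ (√(nsq v : ℝ))) (∑ v ∈ zball M, testW L μ (√(nsq v : ℝ))) := by
  refine hasSum_sum_of_ne_finset_zero (L := SummationFilter.unconditional _) fun v hv => ?_
  by_contra h
  exact hv (mem_zball.2 (by exact_mod_cast (testW_sqrt_ne_zero hL h).trans hM))

theorem card_le_of_nsq_le (S : Finset (ℤ × ℤ × ℤ)) {t : ℝ} (ht : 1 ≤ t)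
    (h : ∀ v ∈ S, (nsq v : ℝ) ≤ t ^ 2) : (S.card : ℝ) ≤ (3 * t) ^ 3 := by
  set b := ⌊t⌋₊ with hb
  have hbt : (b : ℝ) ≤ t := Nat.floor_le (by linarith)
  have hco : ∀ x : ℤ, (x : ℝ) ^ 2 ≤ t ^ 2 → x ∈ Finset.Icc (-(b : ℤ)) b := by
    intro x hx
    have h1 := abs_le_of_sq_le_sq hx (by linarith)
    have h2 : x.natAbs ≤ b := Nat.le_floor (by rw [Nat.cast_natAbs, Int.cast_abs]; exact h1)
    rw [Finset.mem_Icc]; omega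
  have hsub : S ⊆ Finset.Icc (-(b : ℤ)) b ×ˢ Finset.Icc (-(b : ℤ)) b ×ˢ Finset.Icc (-(b : ℤ)) b := by
    intro v hv
    have := h v hv
    rw [nsq_real] at this
    rw [Finset.mem_product, Finset.mem_product]
    exact ⟨hco _ (by nlinarith), hco _ (by nlinarith), hco _ (by nlinarith)⟩
  have h1 := Finset.card_le_card hsub
  rw [Finset.card_product, Finset.card_product, Int.card_Icc,
    show ((b : ℤ) + 1 - -(b : ℤ)).toNat = 2 * b + 1 by omega] at h1
  calc (S.card : ℝ) ≤ ((2 * b + 1) * ((2 * b + 1) * (2 * b + 1)) : ℕ) := by exact_mod_cast h1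
    _ = (2 * (b : ℝ) + 1) ^ 3 := by push_cast; ring
    _ ≤ _ := by gcongr; linarith

theorem abs_sum_testW_le {L : ℝ} (hL : 0 < L) (μ : ℝ) (M : ℕ) :
    |∑ v ∈ zball M, testW L μ (√(nsq v : ℝ))| ≤ (6 * L) ^ 3 := by
  set S := (zball M).filter fun v => testW L μ (√(nsq v : ℝ)) ≠ 0 with hS
  have h1 : ∑ v ∈ zball M, testW L μ (√(nsq v : ℝ)) = ∑ v ∈ S, testW L μ (√(nsq v : ℝ)) :=
    (Finset.sum_filter_ne_zero _).symm
  have h2 : |∑ v ∈ S, testW L μ (√(nsq v : ℝ))| ≤ S.card := by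
    refine (Finset.abs_sum_le_sum_abs _ _).trans ?_
    refine (Finset.sum_le_sum fun v _ => abs_testW_le_one _ _ _).trans ?_
    simp
  rw [h1]
  refine h2.trans ?_
  rcases le_or_gt 1 (2 * L) with h | h
  · have := card_le_of_nsq_le S h fun v hv => testW_sqrt_ne_zero hL (Finset.mem_filter.1 hv).2
    calc _ ≤ _ := this
      _ = _ := by ring
  · have : S = ∅ := by
      rw [hS, Finset.filter_eq_empty_iff]
      intro v _ hne
      have h3 := testW_sqrt_ne_zero hL hne
      have h4 : (nsq v : ℝ) < 1 := by nlinarith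
      have h5 : nsq v = 0 := by
        have : nsq v < 1 := by exact_mod_cast h4
        omega
      rw [h5, Nat.cast_zero, Real.sqrt_zero, testW_zero _ _ hL] at hne
      exact hne rfl
    rw [this, Finset.card_empty, Nat.cast_zero]; positivity

/-- The sum of `testW R lam` over the primitive lattice points. -/
noncomputable def primSum (R lam : ℝ) : ℝ :=
  ∑ v ∈ (zball ⌈(2 * R) ^ 2⌉₊).filter (fun v => vgcd v = 1), testW R lam (√(nsq v : ℝ))

theorem exists_abs_primSum_sub_le (P : ℕ) (hP : 1 ≤ P) : ∃ C > 0, ∀ (R : ℝ) (m : ℕ), 2 ≤ R →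
    (P : ℝ) ^ 2 ≤ R → Squarefree m → (m : ℝ) ≤ R ^ (1 / 16 : ℝ) →
    |primSum R (√(m : ℝ) / P) - ∑ d ∈ Finset.Icc 1 ⌊R ^ (9 / 16 : ℝ)⌋₊,
      (ArithmeticFunction.moebius d : ℝ) * resTerm P R d m| ≤ C * R ^ (15 / 8 : ℝ) := by
  obtain ⟨C, hC, h5⟩ := exists_abs_sub_resTerm_le P hP
  refine ⟨C + 864, by positivity, ?_⟩
  intro R m hR hPR hm hmR
  have hR0 : 0 < R := by linarith
  have hR1 : 1 ≤ R := by linarith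
  have hP1 : (1 : ℝ) ≤ P := by exact_mod_cast hP
  set M := ⌈(2 * R) ^ 2⌉₊ with hMdef
  have hM : (2 * R) ^ 2 ≤ M := Nat.le_ceil _
  set Q := R ^ (9 / 16 : ℝ) with hQ
  have hQ1 : 1 ≤ Q := Real.one_le_rpow hR1 (by norm_num)
  have hQR : Q ≤ R := by
    conv_rhs => rw [← Real.rpow_one R]
    exact Real.rpow_le_rpow_of_exponent_le hR1 (by norm_num)
  set D := ⌊Q⌋₊ with hD
  have hDQ : (D : ℝ) ≤ Q := Nat.floor_le (by linarith)
  have hD1 : 1 ≤ D := Nat.le_floor (by simpa using hQ1)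
  have hQD : Q ≤ 2 * D := by
    have := Nat.lt_floor_add_one Q
    have : (1 : ℝ) ≤ D := by exact_mod_cast hD1
    linarith
  have hDM : D ≤ M := by
    have : (D : ℝ) ≤ M := by nlinarith
    exact_mod_cast this
  set lam := √(m : ℝ) / P with hlam
  set T : ℕ → ℝ := fun d => ∑ u ∈ zball M, testW (R / d) (lam * d) (√(nsq u : ℝ)) with hT
  have hprim : primSum R lam = ∑ d ∈ Finset.Icc 1 M, (ArithmeticFunction.moebius d : ℝ) * T d := by
    unfold primSum
    rw [sum_primitive_eq _ (fun v => testW R lam (√(nsq v : ℝ)))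
      (by simp only [nsq_eq_zero.2, Nat.cast_zero, Real.sqrt_zero]; exact testW_zero _ _ hR0)]
    refine Finset.sum_congr rfl fun d hd => ?_
    rw [sum_dvd_vgcd_eq hR0 (Finset.mem_Icc.1 hd).1 lam hM]
  have hμ : ∀ d, |(ArithmeticFunction.moebius d : ℝ)| ≤ 1 := fun d => by
    exact_mod_cast ArithmeticFunction.abs_moebius_le_one (n := d)
  have hsqm : √(m : ℝ) ≤ R ^ (1 / 16 : ℝ) := by
    have : (m : ℝ) ≤ (m : ℝ) ^ 2 := by
      have : (1 : ℝ) ≤ m := by exact_mod_cast Nat.one_le_iff_ne_zero.2 hm.ne_zero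
      nlinarith
    exact (Real.sqrt_le_left (by positivity)).2 this |>.trans hmR
  have hsmall : ∀ d ∈ Finset.Icc 1 D, |(ArithmeticFunction.moebius d : ℝ) * T d -
      (ArithmeticFunction.moebius d : ℝ) * resTerm P R d m| ≤ C * R ^ (20 / 16 : ℝ) := by
    intro d hd
    obtain ⟨hd1, hd2⟩ := Finset.mem_Icc.1 hd
    have hd1' : (1 : ℝ) ≤ d := by exact_mod_cast hd1
    have hdQ : (d : ℝ) ≤ Q := le_trans (by exact_mod_cast hd2) hDQ
    have hRd : R / d ≤ R := div_le_self hR0.le hd1'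
    have h1 : 1 + lam * d ≤ R ^ 2 := by
      have : lam * d ≤ R := by
        calc lam * d ≤ R ^ (1 / 16 : ℝ) * Q := by
              gcongr
              exact (div_le_self (by positivity) hP1).trans hsqm
          _ = R ^ (10 / 16 : ℝ) := by rw [hQ, ← Real.rpow_add hR0]; norm_num
          _ ≤ R ^ (1 : ℝ) := Real.rpow_le_rpow_of_exponent_le hR1 (by norm_num)
          _ = R := Real.rpow_one R
      nlinarith
    have h2 : R ^ (1 / 8 : ℝ) ≤ R / P := by
      rw [le_div_iff₀ (by linarith)]
      have : (P : ℝ) ≤ R ^ (1 / 2 : ℝ) := by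
        rw [← Real.sqrt_eq_rpow]; exact Real.le_sqrt_of_sq_le hPR
      calc R ^ (1 / 8 : ℝ) * P ≤ R ^ (1 / 8 : ℝ) * R ^ (1 / 2 : ℝ) := by gcongr
        _ = R ^ (5 / 8 : ℝ) := by rw [← Real.rpow_add hR0]; norm_num
        _ ≤ R ^ (1 : ℝ) := Real.rpow_le_rpow_of_exponent_le hR1 (by norm_num)
        _ = R := Real.rpow_one R
    have h3 := h5 R d m hR hd1 hm (hdQ.trans hQR) h1 h2 (T d)
      (hasSum_testW_zball (by positivity) _ (le_trans (by gcongr) hM))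
    rw [← mul_sub, abs_mul]
    calc _ ≤ 1 * (C * R ^ (19 / 16 : ℝ) * R ^ (1 / 16 : ℝ)) := by
          refine mul_le_mul (hμ d) (h3.trans (by gcongr)) (abs_nonneg _) zero_le_one
      _ = C * (R ^ (19 / 16 : ℝ) * R ^ (1 / 16 : ℝ)) := by ring
      _ = _ := by rw [← Real.rpow_add hR0]; norm_num
  have hlarge : ∀ d ∈ Finset.Ioc D M, |(ArithmeticFunction.moebius d : ℝ) * T d| ≤
      216 * R ^ 3 / D * ((d : ℝ) ^ 2)⁻¹ := by
    intro d hd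
    obtain ⟨hd1, _⟩ := Finset.mem_Ioc.1 hd
    have hD0 : (0 : ℝ) < D := by exact_mod_cast hD1
    have hd0 : (D : ℝ) ≤ d := by exact_mod_cast hd1.le
    have hd0' : (0 : ℝ) < d := by linarith
    rw [abs_mul]
    calc _ ≤ 1 * (6 * (R / d)) ^ 3 := by
          refine mul_le_mul (hμ d) (abs_sum_testW_le (by positivity) _ _) (abs_nonneg _) zero_le_one
      _ = 216 * R ^ 3 / d * ((d : ℝ) ^ 2)⁻¹ := by field_simp; norm_num
      _ ≤ _ := by gcongr
  have hIcc : Finset.Icc 1 M = Finset.Icc 1 D ∪ Finset.Ioc D M := by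
    ext d; simp only [Finset.mem_union, Finset.mem_Icc, Finset.mem_Ioc]; omega
  have hdisj : Disjoint (Finset.Icc 1 D) (Finset.Ioc D M) := by
    rw [Finset.disjoint_left]; intro d; simp only [Finset.mem_Icc, Finset.mem_Ioc]; omega
  rw [hprim, hIcc, Finset.sum_union hdisj, add_sub_right_comm, ← Finset.sum_sub_distrib]
  have e1 : |∑ d ∈ Finset.Icc 1 D, ((ArithmeticFunction.moebius d : ℝ) * T d -
      (ArithmeticFunction.moebius d : ℝ) * resTerm P R d m)| ≤ C * R ^ (15 / 8 : ℝ) := by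
    refine (Finset.abs_sum_le_sum_abs _ _).trans ((Finset.sum_le_sum hsmall).trans ?_)
    rw [Finset.sum_const, nsmul_eq_mul, Nat.card_Icc, Nat.add_sub_cancel]
    calc (D : ℝ) * (C * R ^ (20 / 16 : ℝ)) ≤ Q * (C * R ^ (20 / 16 : ℝ)) := by gcongr
      _ = C * (R ^ (9 / 16 : ℝ) * R ^ (20 / 16 : ℝ)) := by rw [hQ]; ring
      _ = C * R ^ (29 / 16 : ℝ) := by rw [← Real.rpow_add hR0]; norm_num
      _ ≤ _ := by
          refine mul_le_mul_of_nonneg_left ?_ hC.le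
          exact Real.rpow_le_rpow_of_exponent_le hR1 (by norm_num)
  have e2 : |∑ d ∈ Finset.Ioc D M, (ArithmeticFunction.moebius d : ℝ) * T d| ≤
      864 * R ^ (15 / 8 : ℝ) := by
    have hD0 : (0 : ℝ) < D := by exact_mod_cast hD1
    refine (Finset.abs_sum_le_sum_abs _ _).trans ((Finset.sum_le_sum hlarge).trans ?_)
    rw [← Finset.mul_sum]
    have h1 := sum_Ioc_inv_sq_le_sub (α := ℝ) (k := D) (n := M) (by omega) hDM
    have h2 : R ^ 3 = R ^ (15 / 8 : ℝ) * Q ^ 2 := by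
      rw [hQ, ← Real.rpow_natCast, ← Real.rpow_natCast, ← Real.rpow_mul hR0.le, ← Real.rpow_add hR0]
      norm_num
    calc _ ≤ 216 * R ^ 3 / D * (D : ℝ)⁻¹ := by
          gcongr
          have : (0 : ℝ) ≤ (M : ℝ)⁻¹ := by positivity
          linarith
      _ = 216 * (R ^ (15 / 8 : ℝ) * Q ^ 2) / D ^ 2 := by rw [h2]; field_simp
      _ ≤ 216 * (R ^ (15 / 8 : ℝ) * (2 * D) ^ 2) / D ^ 2 := by gcongr
      _ = _ := by field_simp; norm_num
  calc _ ≤ _ := abs_add_le _ _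
    _ ≤ _ := add_le_add e1 e2
    _ = _ := by ring

theorem moebius_primorial_mul_eq_zero {n k : ℕ} (hk : 2 ≤ k) (hkn : k ≤ n) :
    ArithmeticFunction.moebius (primorial n * k) = 0 := by
  refine ArithmeticFunction.moebius_eq_zero_of_not_squarefree fun hs => ?_
  obtain ⟨p, hp, hpk⟩ := Nat.exists_prime_and_dvd (n := k) (by omega)
  have h1 : p ∣ primorial n := by
    unfold primorial
    refine Finset.dvd_prod_of_mem (fun p => p) (Finset.mem_filter.2 ⟨Finset.mem_range.2 ?_, hp⟩)
    have := Nat.le_of_dvd (by omega) hpk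
    omega
  exact hp.not_isUnit (hs p (mul_dvd_mul h1 hpk))

theorem log_le_abs_sum_moebius : ∃ P : ℕ, 1 ≤ P ∧ ∃ c > (0 : ℝ), ∃ N0 : ℕ, ∀ N ≥ N0, ∀ K ≥ 1,
    c * Real.log N ≤ |∑ m ∈ (Finset.Icc 1 N).filter Squarefree, ∑ k ∈ Finset.Icc 1 K,
      (ArithmeticFunction.moebius (P * k) : ℝ) *
        ((r3 (m * k ^ 2) : ℝ) * ((m * k ^ 2 : ℕ) : ℝ) ^ (-(3 / 2) : ℝ))| := by
  obtain ⟨c0, hc0, N0, hlow⟩ := log_le_sum_r3_squarefree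
  obtain ⟨C0, hC0, hup⟩ := sum_r3_sq_mul_le
  obtain ⟨J, hJ⟩ := exists_sum_rpow_lt (c0 / (4 * C0)) (by positivity)
  refine ⟨primorial J, primorial_pos J, c0 / 2, by positivity, max N0 3, ?_⟩
  intro N hN K hK
  set S := (Finset.Icc 1 N).filter Squarefree with hS
  have hlogN : 1 ≤ Real.log N := by
    have h3 : (3 : ℝ) ≤ N := by exact_mod_cast (le_max_right _ _).trans hN
    rw [Real.le_log_iff_exp_le (by linarith)]
    linarith [Real.exp_one_lt_d9]
  set G : ℕ → ℝ := fun k => ∑ m ∈ S, (r3 (m * k ^ 2) : ℝ) * ((m * k ^ 2 : ℕ) : ℝ) ^ (-(3 / 2) : ℝ)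
    with hG
  have hG0 : ∀ k, 0 ≤ G k := fun k => Finset.sum_nonneg fun m _ => by positivity
  have hGup : ∀ k, 1 ≤ k → G k ≤ C0 * (k : ℝ) ^ (-(3 / 2) : ℝ) * (1 + Real.log N) := by
    intro k hk
    refine le_trans ?_ (hup k N hk)
    exact Finset.sum_le_sum_of_subset_of_nonneg (Finset.filter_subset _ _)
      fun m _ _ => by positivity
  have hG1 : c0 * Real.log N ≤ G 1 := by
    have := hlow N ((le_max_left _ _).trans hN)
    simpa [hG, hS] using this
  have hsw : ∑ m ∈ S, ∑ k ∈ Finset.Icc 1 K, (ArithmeticFunction.moebius (primorial J * k) : ℝ) *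
        ((r3 (m * k ^ 2) : ℝ) * ((m * k ^ 2 : ℕ) : ℝ) ^ (-(3 / 2) : ℝ)) =
      ∑ k ∈ Finset.Icc 1 K, (ArithmeticFunction.moebius (primorial J * k) : ℝ) * G k := by
    rw [Finset.sum_comm]
    refine Finset.sum_congr rfl fun k _ => ?_
    rw [hG, Finset.mul_sum]
  rw [hsw]
  have hIcc : Finset.Icc 1 K = insert 1 (Finset.Icc 2 K) := by
    ext k; simp only [Finset.mem_insert, Finset.mem_Icc]; omega
  rw [hIcc, Finset.sum_insert (by simp)]
  have h1 : |(ArithmeticFunction.moebius (primorial J * 1) : ℝ) * G 1| = G 1 := by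
    rw [mul_one, abs_mul, abs_of_nonneg (hG0 1)]
    have := ArithmeticFunction.abs_moebius_eq_one_of_squarefree (squarefree_primorial J)
    have h2 : |(ArithmeticFunction.moebius (primorial J) : ℝ)| = 1 := by exact_mod_cast this
    rw [h2, one_mul]
  have h2 : |∑ k ∈ Finset.Icc 2 K, (ArithmeticFunction.moebius (primorial J * k) : ℝ) * G k| ≤
      c0 / 2 * Real.log N := by
    have h3 : ∀ k ∈ Finset.Icc 2 K, |(ArithmeticFunction.moebius (primorial J * k) : ℝ) * G k| ≤
        if J < k then C0 * (k : ℝ) ^ (-(3 / 2) : ℝ) * (1 + Real.log N) else 0 := by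
      intro k hk
      have hk2 := (Finset.mem_Icc.1 hk).1
      split_ifs with hJk
      · rw [abs_mul, abs_of_nonneg (hG0 k)]
        have : |(ArithmeticFunction.moebius (primorial J * k) : ℝ)| ≤ 1 := by
          exact_mod_cast ArithmeticFunction.abs_moebius_le_one (n := primorial J * k)
        calc _ ≤ 1 * G k := mul_le_mul_of_nonneg_right this (hG0 k)
          _ ≤ _ := by rw [one_mul]; exact hGup k (by omega)
      · rw [moebius_primorial_mul_eq_zero hk2 (by omega)]; simp
    refine (Finset.abs_sum_le_sum_abs _ _).trans ((Finset.sum_le_sum h3).trans ?_)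
    rw [← Finset.sum_filter]
    have h4 := hJ ((Finset.Icc 2 K).filter fun k => J < k) fun k hk => (Finset.mem_filter.1 hk).2
    calc _ = C0 * (1 + Real.log N) * ∑ k ∈ (Finset.Icc 2 K).filter (fun k => J < k),
          (k : ℝ) ^ (-(3 / 2) : ℝ) := by
          rw [Finset.mul_sum]; exact Finset.sum_congr rfl fun k _ => by ring
      _ ≤ C0 * (2 * Real.log N) * (c0 / (4 * C0)) := by
          have h5 : 0 ≤ ∑ k ∈ (Finset.Icc 2 K).filter (fun k => J < k),
            (k : ℝ) ^ (-(3 / 2) : ℝ) := Finset.sum_nonneg fun k _ => by positivity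
          refine mul_le_mul ?_ h4.le h5 (by positivity)
          gcongr; linarith
      _ = _ := by field_simp; ring
  have h3 := abs_sub_abs_le_abs_sub ((ArithmeticFunction.moebius (primorial J * 1) : ℝ) * G 1)
    (-∑ k ∈ Finset.Icc 2 K, (ArithmeticFunction.moebius (primorial J * k) : ℝ) * G k)
  rw [abs_neg, sub_neg_eq_add, h1] at h3
  linarith

theorem sum_moebius_resTerm (P : ℕ) (hP : 1 ≤ P) (R : ℝ) (m D : ℕ) (hm : 1 ≤ m) :
    1 / (m : ℝ) * ∑ d ∈ Finset.Icc 1 D, (ArithmeticFunction.moebius d : ℝ) * resTerm P R d m =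
      R ^ 2 * cosT 0 / P ^ 2 * ∑ k ∈ Finset.Icc 1 (D / P),
        (ArithmeticFunction.moebius (P * k) : ℝ) *
        ((r3 (m * k ^ 2) : ℝ) * ((m * k ^ 2 : ℕ) : ℝ) ^ (-(3 / 2) : ℝ)) := by
  have hm0 : (0 : ℝ) < m := by exact_mod_cast hm
  have hP0 : (0 : ℝ) < P := by exact_mod_cast hP
  rw [Finset.mul_sum, Finset.mul_sum]
  symm
  refine Finset.sum_bij_ne_zero (fun k _ _ => P * k) ?_ ?_ ?_ ?_
  · intro k hk _
    obtain ⟨h1, h2⟩ := Finset.mem_Icc.1 hk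
    rw [Nat.le_div_iff_mul_le (by omega)] at h2
    exact Finset.mem_Icc.2 ⟨Nat.mul_pos (by omega) (by omega), by linarith [mul_comm k P]⟩
  · intro k _ _ l _ _ h
    exact Nat.eq_of_mul_eq_mul_left (by omega) h
  · intro d hd hne
    have hdvd : P ∣ d := by
      by_contra h
      exact hne (by simp [resTerm, h])
    obtain ⟨k, rfl⟩ := hdvd
    obtain ⟨h1, h2⟩ := Finset.mem_Icc.1 hd
    refine ⟨k, Finset.mem_Icc.2 ⟨Nat.pos_of_ne_zero (by rintro rfl; simp at h1), ?_⟩, ?_, rfl⟩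
    · rw [Nat.le_div_iff_mul_le (by omega), mul_comm]; exact h2
    · intro h
      apply hne
      rw [resTerm, if_pos (dvd_mul_right _ _), Nat.mul_div_cancel_left _ (by omega)]
      rcases mul_eq_zero.1 h with h | h
      · rcases div_eq_zero_iff.1 h with h | h
        · rcases mul_eq_zero.1 h with h | h
          · have hR : R = 0 := by simpa using h
            simp [hR]
          · simp [h]
        · exact absurd h (by positivity)
      · rcases mul_eq_zero.1 h with h | h
        · simp [h]
        · rcases mul_eq_zero.1 h with h | h
          · simp [h]
          · exfalso
            have hk0 : 0 < k := Nat.pos_of_ne_zero (by rintro rfl; simp at h1)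
            have : (0 : ℝ) < ((m * k ^ 2 : ℕ) : ℝ) := by exact_mod_cast Nat.mul_pos hm (by positivity)
            exact (Real.rpow_pos_of_pos this _).ne' h
  · intro k hk _
    have hk0 : (0 : ℝ) < k := by exact_mod_cast (Finset.mem_Icc.1 hk).1
    rw [resTerm, if_pos (dvd_mul_right _ _), Nat.mul_div_cancel_left _ (by omega)]
    have h1 : ((m * k ^ 2 : ℕ) : ℝ) ^ (-(3 / 2) : ℝ) = 1 / (m * √(m : ℝ) * k ^ 3) := by
      have h2 : ((m * k ^ 2 : ℕ) : ℝ) = (√(m : ℝ) * k) ^ 2 := by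
        push_cast; rw [mul_pow, Real.sq_sqrt hm0.le]
      rw [h2, ← Real.rpow_natCast, ← Real.rpow_mul (by positivity),
        show ((2 : ℕ) : ℝ) * -(3 / 2) = -((3 : ℕ) : ℝ) by norm_num, Real.rpow_neg (by positivity),
        Real.rpow_natCast, one_div]
      congr 1
      rw [mul_pow, show √(m : ℝ) ^ 3 = √(m : ℝ) ^ 2 * √(m : ℝ) by ring, Real.sq_sqrt hm0.le]
    rw [h1]
    push_cast
    have : (0 : ℝ) < √(m : ℝ) := Real.sqrt_pos.2 hm0
    field_simp

theorem exists_sum_primSum_ge : ∃ P : ℕ, 1 ≤ P ∧ ∀ δ : ℝ, 0 < δ → δ ≤ 1 / 16 → ∃ c > (0 : ℝ),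
    ∀ᶠ R : ℝ in Filter.atTop, c * (R ^ 2 * Real.log R) ≤
      |∑ m ∈ (Finset.Icc 1 ⌊R ^ δ⌋₊).filter Squarefree, 1 / (m : ℝ) * primSum R (√(m : ℝ) / P)| := by
  obtain ⟨P, hP, c0, hc0, N0, hlow⟩ := log_le_abs_sum_moebius
  obtain ⟨C, hC, hap⟩ := exists_abs_primSum_sub_le P hP
  have hP0 : (0 : ℝ) < P := by exact_mod_cast hP
  have hcos := cosT_zero_pos
  refine ⟨P, hP, ?_⟩
  intro δ hδ hδ16
  set c1 := cosT 0 / P ^ 2 * c0 * (δ / 2) with hc1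
  have hc1' : 0 < c1 := by positivity
  refine ⟨c1 / 2, by positivity, ?_⟩
  have t1 : Filter.Tendsto (fun R : ℝ => R ^ δ) Filter.atTop Filter.atTop := tendsto_rpow_atTop hδ
  have t2 : Filter.Tendsto (fun R : ℝ => R ^ (9 / 16 : ℝ)) Filter.atTop Filter.atTop :=
    tendsto_rpow_atTop (by norm_num)
  have t3 : Filter.Tendsto (fun R : ℝ => R ^ (1 / 8 : ℝ)) Filter.atTop Filter.atTop :=
    tendsto_rpow_atTop (by norm_num)
  filter_upwards [t1.eventually_ge_atTop (max N0 1 : ℝ), t2.eventually_ge_atTop (P : ℝ),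
    t3.eventually_ge_atTop (4 * C / c1), Real.tendsto_log_atTop.eventually_ge_atTop 1,
    Real.tendsto_log_atTop.eventually_ge_atTop (2 * Real.log 2 / δ),
    Filter.eventually_ge_atTop (2 : ℝ), Filter.eventually_ge_atTop ((P : ℝ) ^ 2)]
    with R h1 h2 h3 hlog1 hlog2 hR2 hRP
  have hR0 : 0 < R := by linarith
  have hR1 : 1 ≤ R := by linarith
  set N := ⌊R ^ δ⌋₊ with hN
  set D := ⌊R ^ (9 / 16 : ℝ)⌋₊ with hD
  set S := (Finset.Icc 1 N).filter Squarefree with hS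
  have hNle : (N : ℝ) ≤ R ^ δ := Nat.floor_le (by positivity)
  have hRδ : R ^ δ ≤ R ^ (1 / 16 : ℝ) := Real.rpow_le_rpow_of_exponent_le hR1 hδ16
  have hNN0 : N0 ≤ N := Nat.le_floor ((le_max_left _ _).trans h1)
  have hN1 : 1 ≤ N := Nat.le_floor (by simpa using (le_max_right _ _).trans h1)
  have hN1' : (1 : ℝ) ≤ N := by exact_mod_cast hN1
  have hlogN : δ / 2 * Real.log R ≤ Real.log N := by
    have e1 : R ^ δ / 2 ≤ N := by
      have := Nat.lt_floor_add_one (R ^ δ)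
      linarith
    have e2 := Real.log_le_log (by positivity) e1
    rw [Real.log_div (by positivity) (by norm_num), Real.log_rpow hR0] at e2
    rw [div_le_iff₀ hδ] at hlog2
    linarith
  have hlogN' : Real.log N ≤ Real.log R := by
    refine Real.log_le_log (by linarith) (hNle.trans (hRδ.trans ?_))
    conv_rhs => rw [← Real.rpow_one R]
    exact Real.rpow_le_rpow_of_exponent_le hR1 (by norm_num)
  have hDP : 1 ≤ D / P := by
    rw [Nat.le_div_iff_mul_le (by omega), one_mul]
    exact Nat.le_floor h2
  have e1 := hlow N hNN0 (D / P) hDP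
  have e2 : ∑ m ∈ S, 1 / (m : ℝ) * ∑ d ∈ Finset.Icc 1 D,
      (ArithmeticFunction.moebius d : ℝ) * resTerm P R d m = R ^ 2 * cosT 0 / P ^ 2 *
      ∑ m ∈ S, ∑ k ∈ Finset.Icc 1 (D / P), (ArithmeticFunction.moebius (P * k) : ℝ) *
        ((r3 (m * k ^ 2) : ℝ) * ((m * k ^ 2 : ℕ) : ℝ) ^ (-(3 / 2) : ℝ)) := by
    rw [Finset.mul_sum]
    refine Finset.sum_congr rfl fun m hm => ?_
    exact sum_moebius_resTerm P hP R m D (Finset.mem_Icc.1 (Finset.mem_filter.1 hm).1).1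
  have e3 : c1 * (R ^ 2 * Real.log R) ≤ |∑ m ∈ S, 1 / (m : ℝ) * ∑ d ∈ Finset.Icc 1 D,
      (ArithmeticFunction.moebius d : ℝ) * resTerm P R d m| := by
    rw [e2, abs_mul, abs_of_nonneg (by positivity)]
    calc _ = R ^ 2 * cosT 0 / P ^ 2 * (c0 * (δ / 2 * Real.log R)) := by rw [hc1]; ring
      _ ≤ R ^ 2 * cosT 0 / P ^ 2 * (c0 * Real.log N) := by gcongr
      _ ≤ _ := by gcongr
  have e4 : |∑ m ∈ S, 1 / (m : ℝ) * primSum R (√(m : ℝ) / P) - ∑ m ∈ S, 1 / (m : ℝ) *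
      ∑ d ∈ Finset.Icc 1 D, (ArithmeticFunction.moebius d : ℝ) * resTerm P R d m| ≤
      c1 / 2 * (R ^ 2 * Real.log R) := by
    rw [← Finset.sum_sub_distrib]
    have f1 : ∀ m ∈ S, |1 / (m : ℝ) * primSum R (√(m : ℝ) / P) - 1 / (m : ℝ) *
        ∑ d ∈ Finset.Icc 1 D, (ArithmeticFunction.moebius d : ℝ) * resTerm P R d m| ≤
        C * R ^ (15 / 8 : ℝ) * (1 / (m : ℝ)) := by
      intro m hm
      obtain ⟨g1, g2⟩ := Finset.mem_filter.1 hm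
      have g3 : (m : ℝ) ≤ N := by exact_mod_cast (Finset.mem_Icc.1 g1).2
      rw [← mul_sub, abs_mul, abs_of_nonneg (by positivity), mul_comm]
      gcongr
      exact hap R m hR2 hRP g2 (g3.trans (hNle.trans hRδ))
    refine (Finset.abs_sum_le_sum_abs _ _).trans ((Finset.sum_le_sum f1).trans ?_)
    rw [← Finset.mul_sum]
    have f2 : ∑ m ∈ S, 1 / (m : ℝ) ≤ 2 * Real.log R := by
      calc _ ≤ ∑ m ∈ Finset.Icc 1 N, 1 / (m : ℝ) :=
            Finset.sum_le_sum_of_subset_of_nonneg (Finset.filter_subset _ _)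
              fun m _ _ => by positivity
        _ ≤ 1 + Real.log N := sum_Icc_inv_le N
        _ ≤ _ := by linarith
    have f3 : C ≤ c1 / 4 * R ^ (1 / 8 : ℝ) := by
      rw [div_le_iff₀ hc1'] at h3; linarith
    calc _ ≤ (c1 / 4 * R ^ (1 / 8 : ℝ)) * R ^ (15 / 8 : ℝ) * (2 * Real.log R) := by gcongr
      _ = c1 / 2 * ((R ^ (1 / 8 : ℝ) * R ^ (15 / 8 : ℝ)) * Real.log R) := by ring
      _ = _ := by
        rw [← Real.rpow_add hR0, show (1 / 8 + 15 / 8 : ℝ) = ((2 : ℕ) : ℝ) by norm_num,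
          Real.rpow_natCast]
  have e5 := abs_sub_abs_le_abs_sub (∑ m ∈ S, 1 / (m : ℝ) * ∑ d ∈ Finset.Icc 1 D,
    (ArithmeticFunction.moebius d : ℝ) * resTerm P R d m)
    (∑ m ∈ S, 1 / (m : ℝ) * primSum R (√(m : ℝ) / P))
  rw [abs_sub_comm] at e5
  linarith

theorem Nstar_eq_sum {t : ℝ} (ht : 0 ≤ t) {M : ℕ} (hM : t ^ 2 ≤ M) :
    (Nstar t : ℝ) = ∑ v ∈ (zball M).filter (fun v => vgcd v = 1),
      if √(nsq v : ℝ) ≤ t then (1 : ℝ) else 0 := by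
  have h : {v : ℤ × ℤ × ℤ | v ≠ 0 ∧ Int.gcd (Int.gcd v.1 v.2.1 : ℤ) v.2.2 = 1 ∧
      (v.1 : ℝ)^2 + (v.2.1 : ℝ)^2 + (v.2.2 : ℝ)^2 ≤ t^2} =
      (((zball M).filter (fun v => vgcd v = 1)).filter (fun v => √(nsq v : ℝ) ≤ t) :
        Finset (ℤ × ℤ × ℤ)) := by
    ext v
    rw [Set.mem_ofPred_eq, Finset.mem_coe, Finset.mem_filter, Finset.mem_filter, mem_zball,
      Real.sqrt_le_left ht, nsq_real]
    constructor
    · rintro ⟨_, h1, h2⟩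
      refine ⟨⟨?_, h1⟩, h2⟩
      rw [← nsq_real] at h2
      exact_mod_cast h2.trans hM
    · rintro ⟨⟨_, h1⟩, h2⟩
      refine ⟨?_, h1, h2⟩
      rintro rfl
      rw [vgcd_eq_zero.2 rfl] at h1
      exact zero_ne_one h1
  rw [Nstar, h, Set.ncard_coe_finset, ← Finset.sum_filter, Finset.sum_const, nsmul_eq_mul, mul_one]

theorem Nstar_monotoneOn : MonotoneOn (fun t => (Nstar t : ℝ)) (Set.Ici 0) := by
  intro s hs t ht hst
  have h1 : t ^ 2 ≤ (⌈t ^ 2⌉₊ : ℝ) := Nat.le_ceil _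
  have h2 : s ^ 2 ≤ (⌈t ^ 2⌉₊ : ℝ) := (pow_le_pow_left₀ hs hst 2).trans h1
  simp only [Nstar_eq_sum hs h2, Nstar_eq_sum ht h1]
  refine Finset.sum_le_sum fun v _ => ?_
  split_ifs with h3 h4
  · exact le_rfl
  · exact (h4 (h3.trans hst)).elim
  · exact zero_le_one
  · exact le_rfl

theorem intervalIntegrable_indicator_deriv {W : ℝ → ℝ} (hW : ContDiff ℝ 1 W) (ρ a b : ℝ) :
    IntervalIntegrable (fun t => (if ρ ≤ t then (1 : ℝ) else 0) * deriv W t) volume a b := by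
  have h1 : IntervalIntegrable (deriv W) volume a b :=
    (hW.continuous_deriv (by simp)).intervalIntegrable _ _
  have h2 : (fun t => (if ρ ≤ t then (1 : ℝ) else 0) * deriv W t) =
      (Set.Ici ρ).indicator (deriv W) := by
    ext t
    by_cases h : ρ ≤ t <;> simp [h]
  rw [h2, intervalIntegrable_iff] at *
  exact h1.indicator measurableSet_Ici

theorem integral_indicator_mul_deriv {W : ℝ → ℝ} (hW : ContDiff ℝ 1 W) {a b : ℝ} (hab : a ≤ b)
    (h1 : ∀ t ≤ a, W t = 0) (h2 : ∀ t, b ≤ t → W t = 0) (ρ : ℝ) :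
    ∫ t in a..b, (if ρ ≤ t then (1 : ℝ) else 0) * deriv W t = -W ρ := by
  have hd : Differentiable ℝ W := hW.differentiable (by simp)
  rw [MeasureTheory.integral_eq_of_hasDerivAt_off_countable (fun t => W (max ρ t)) _
    (s := {ρ}) (Set.countable_singleton ρ) ?_ ?_ (intervalIntegrable_indicator_deriv hW ρ a b)]
  · rw [h2 _ (le_max_right ρ b), zero_sub]
    rcases le_total ρ a with h | h
    · rw [max_eq_right h, h1 a le_rfl, h1 ρ h]
    · rw [max_eq_left h]
  · exact (hd.continuous.comp (continuous_const.max continuous_id)).continuousOn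
  · intro t ht
    have hne : t ≠ ρ := ht.2
    rcases lt_or_gt_of_ne hne with h | h
    · rw [if_neg (not_le.2 h), zero_mul]
      refine (hasDerivAt_const t (W ρ)).congr_of_eventuallyEq ?_
      filter_upwards [Iio_mem_nhds h] with s hs
      rw [max_eq_left (le_of_lt hs)]
    · rw [if_pos h.le, one_mul]
      refine (hd t).hasDerivAt.congr_of_eventuallyEq ?_
      filter_upwards [Ioi_mem_nhds h] with s hs
      rw [max_eq_right (le_of_lt hs)]

theorem integral_Nstar_mul_deriv {W : ℝ → ℝ} (hW : ContDiff ℝ 1 W) {R : ℝ} (hR : 0 < R)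
    (h1 : ∀ t ≤ R, W t = 0) (h2 : ∀ t, 2 * R ≤ t → W t = 0) :
    ∫ t in R..(2 * R), (Nstar t : ℝ) * deriv W t =
      -∑ v ∈ (zball ⌈(2 * R) ^ 2⌉₊).filter (fun v => vgcd v = 1), W (√(nsq v : ℝ)) := by
  have h : ∀ t ∈ Set.uIcc R (2 * R), (Nstar t : ℝ) * deriv W t =
      ∑ v ∈ (zball ⌈(2 * R) ^ 2⌉₊).filter (fun v => vgcd v = 1),
        (if √(nsq v : ℝ) ≤ t then (1 : ℝ) else 0) * deriv W t := by
    intro t ht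
    rw [Set.uIcc_of_le (by linarith)] at ht
    rw [Nstar_eq_sum (by linarith [ht.1]) (M := ⌈(2 * R) ^ 2⌉₊)
      ((pow_le_pow_left₀ (by linarith [ht.1]) ht.2 2).trans (Nat.le_ceil _)), Finset.sum_mul]
  rw [intervalIntegral.integral_congr h, intervalIntegral.integral_finsetSum
    (fun v _ => intervalIntegrable_indicator_deriv hW _ _ _), ← Finset.sum_neg_distrib]
  exact Finset.sum_congr rfl fun v _ => integral_indicator_mul_deriv hW (by linarith) h1 h2 _

theorem intervalIntegrable_Nstar_mul {g : ℝ → ℝ} (hg : Continuous g) {a b : ℝ} (ha : 0 ≤ a)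
    (hab : a ≤ b) : IntervalIntegrable (fun t => (Nstar t : ℝ) * g t) volume a b := by
  refine IntervalIntegrable.mul_continuousOn ?_ hg.continuousOn
  refine MonotoneOn.intervalIntegrable (Nstar_monotoneOn.mono ?_)
  rw [Set.uIcc_of_le hab]
  exact fun t ht => ha.trans ht.1

theorem integral_cube_mul_deriv_testW {R : ℝ} (hR : 0 < R) (lam : ℝ) :
    ∫ t in R..(2 * R), t ^ 3 * deriv (testW R lam) t = -3 * (R ^ 3 * sinT (R * lam)) := by
  have hd : Differentiable ℝ (testW R lam) := (contDiff_testW R lam).differentiable (by simp)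
  have hc : Continuous (deriv (testW R lam)) := (contDiff_testW R lam).continuous_deriv (by simp)
  rw [intervalIntegral.integral_mul_deriv_eq_deriv_mul (u := fun t => t ^ 3)
    (u' := fun t => 3 * t ^ 2) (fun t _ => by simpa using hasDerivAt_pow 3 t)
    (fun t _ => (hd t).hasDerivAt) ((by fun_prop : Continuous fun t : ℝ => 3 * t ^ 2).intervalIntegrable _ _)
    (hc.intervalIntegrable _ _), testW_eq_zero_of_ge hR le_rfl, testW_eq_zero_of_le hR le_rfl]
  have h1 : ∫ t in R..(2 * R), 3 * t ^ 2 * testW R lam t = ∫ t, 3 * t ^ 2 * testW R lam t := by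
    rw [intervalIntegral.integral_of_le (by linarith)]
    refine setIntegral_eq_integral_of_forall_compl_eq_zero fun t ht => ?_
    rw [Set.mem_Ioc, not_and_or, not_lt, not_le] at ht
    rcases ht with h | h
    · rw [testW_eq_zero_of_le hR h, mul_zero]
    · rw [testW_eq_zero_of_ge hR h.le, mul_zero]
  rw [h1, integral_scale _ hR, sinT]
  have h2 : ∀ u : ℝ, 3 * (R * u) ^ 2 * testW R lam (R * u) =
      3 * R ^ 2 * (u ^ 2 * w0 u * Real.sin (2 * π * (R * lam) * u)) := by
    intro u
    rw [testW, mul_div_cancel_left₀ _ hR.ne']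
    ring_nf
  simp_rw [h2]
  rw [integral_const_mul]
  ring

/-- The combination of the test functions with frequencies `√m / P`, `m ≤ N` squarefree. -/
noncomputable def testSum (P N : ℕ) (R t : ℝ) : ℝ :=
  ∑ m ∈ (Finset.Icc 1 N).filter Squarefree, 1 / (m : ℝ) * testW R (√(m : ℝ) / P) t

theorem contDiff_testSum (P N : ℕ) (R : ℝ) : ContDiff ℝ 1 (testSum P N R) := by
  unfold testSum
  refine ContDiff.sum fun m _ => contDiff_const.mul ?_
  exact (contDiff_testW R _).of_le (by exact_mod_cast le_top)

theorem deriv_testSum (P N : ℕ) (R t : ℝ) : deriv (testSum P N R) t =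
    ∑ m ∈ (Finset.Icc 1 N).filter Squarefree, 1 / (m : ℝ) * deriv (testW R (√(m : ℝ) / P)) t := by
  refine HasDerivAt.deriv ?_
  unfold testSum
  refine HasDerivAt.fun_sum fun m _ => HasDerivAt.const_mul _ ?_
  exact ((contDiff_testW R _).differentiable (by simp) t).hasDerivAt

theorem abs_sinT_mul_le : ∃ C > 0, ∀ x : ℝ, 0 < x → x ^ 3 * |sinT x| ≤ C := by
  obtain ⟨C, hC, h⟩ := exists_cosT_sinT_decay 3
  refine ⟨C, hC, fun x hx => le_trans ?_ (h x).2⟩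
  rw [abs_of_pos hx]
  gcongr
  linarith

theorem exists_integral_Estar_mul_ge : ∃ P : ℕ, 1 ≤ P ∧ ∀ δ : ℝ, 0 < δ → δ ≤ 1 / 16 → ∃ c > (0 : ℝ),
    ∀ᶠ R : ℝ in Filter.atTop, c * (R ^ 2 * Real.log R) ≤
      |∫ t in R..(2 * R), Estar t * deriv (testSum P ⌊R ^ δ⌋₊ R) t| := by
  obtain ⟨P, hP, hlow⟩ := exists_sum_primSum_ge
  obtain ⟨C, hC, hsin⟩ := abs_sinT_mul_le
  have hP1 : (1 : ℝ) ≤ P := by exact_mod_cast hP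
  refine ⟨P, hP, fun δ hδ hδ16 => ?_⟩
  obtain ⟨c, hc, hev⟩ := hlow δ hδ hδ16
  refine ⟨c / 2, by positivity, ?_⟩
  set κ := 4 * π / (3 * (riemannZeta 3).re) with hκ
  have t1 : Filter.Tendsto (fun R : ℝ => R ^ 2) Filter.atTop Filter.atTop :=
    Filter.tendsto_pow_atTop two_ne_zero
  filter_upwards [hev, Filter.eventually_ge_atTop (1 : ℝ),
    Real.tendsto_log_atTop.eventually_ge_atTop 1,
    t1.eventually_ge_atTop (2 * (|κ| * (6 * (C * P ^ 3))) / c)] with R h1 hR1 hlog hR2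
  have hR : 0 < R := by linarith
  set N := ⌊R ^ δ⌋₊ with hN
  set S := (Finset.Icc 1 N).filter Squarefree with hS
  have hW1 : ∀ t ≤ R, testSum P N R t = 0 := fun t ht =>
    Finset.sum_eq_zero fun m _ => by rw [testW_eq_zero_of_le hR ht, mul_zero]
  have hW2 : ∀ t, 2 * R ≤ t → testSum P N R t = 0 := fun t ht =>
    Finset.sum_eq_zero fun m _ => by rw [testW_eq_zero_of_ge hR ht, mul_zero]
  have hc1 : Continuous (deriv (testSum P N R)) :=
    (contDiff_testSum P N R).continuous_deriv le_rfl
  have e1 : ∫ t in R..(2 * R), Estar t * deriv (testSum P N R) t =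
      (∫ t in R..(2 * R), (Nstar t : ℝ) * deriv (testSum P N R) t) -
        κ * ∫ t in R..(2 * R), t ^ 3 * deriv (testSum P N R) t := by
    rw [← intervalIntegral.integral_const_mul, ← intervalIntegral.integral_sub
      (intervalIntegrable_Nstar_mul hc1 hR.le (by linarith))
      ((by fun_prop : Continuous fun t : ℝ =>
        κ * (t ^ 3 * deriv (testSum P N R) t)).intervalIntegrable _ _)]
    refine intervalIntegral.integral_congr fun t _ => ?_
    simp only [Estar, ← hκ]
    ring
  have e2 : ∫ t in R..(2 * R), (Nstar t : ℝ) * deriv (testSum P N R) t =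
      -∑ m ∈ S, 1 / (m : ℝ) * primSum R (√(m : ℝ) / P) := by
    rw [integral_Nstar_mul_deriv (contDiff_testSum P N R) hR hW1 hW2]
    unfold testSum primSum
    rw [Finset.sum_comm]
    simp_rw [Finset.mul_sum]
    rfl
  have e3 : ∫ t in R..(2 * R), t ^ 3 * deriv (testSum P N R) t =
      ∑ m ∈ S, 1 / (m : ℝ) * (-3 * (R ^ 3 * sinT (R * (√(m : ℝ) / P)))) := by
    simp_rw [← integral_cube_mul_deriv_testW hR, deriv_testSum, Finset.mul_sum]
    rw [intervalIntegral.integral_finsetSum]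
    · refine Finset.sum_congr rfl fun m _ => ?_
      rw [← intervalIntegral.integral_const_mul]
      refine intervalIntegral.integral_congr fun t _ => ?_
      ring
    · intro m _
      have : Continuous (deriv (testW R (√(m : ℝ) / P))) :=
        (contDiff_testW R _).continuous_deriv (by simp)
      exact (by fun_prop : Continuous fun t : ℝ => t ^ 3 * (1 / (m : ℝ) *
        deriv (testW R (√(m : ℝ) / P)) t)).intervalIntegrable _ _
  have hN' : Real.log N ≤ Real.log R := by
    rcases Nat.eq_zero_or_pos N with h | h
    · rw [h, Nat.cast_zero, Real.log_zero]; linarith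
    · refine Real.log_le_log (by exact_mod_cast h) ((Nat.floor_le (by positivity)).trans ?_)
      conv_rhs => rw [← Real.rpow_one R]
      exact Real.rpow_le_rpow_of_exponent_le hR1 (by linarith)
  have e4 : |∑ m ∈ S, 1 / (m : ℝ) * (-3 * (R ^ 3 * sinT (R * (√(m : ℝ) / P))))| ≤
      6 * (C * P ^ 3) * Real.log R := by
    have f1 : ∀ m ∈ S, |1 / (m : ℝ) * (-3 * (R ^ 3 * sinT (R * (√(m : ℝ) / P))))| ≤
        3 * (C * P ^ 3) * (1 / (m : ℝ)) := by
      intro m hm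
      have hm1 : 1 ≤ m := (Finset.mem_Icc.1 (Finset.mem_filter.1 hm).1).1
      have hm2 : (1 : ℝ) ≤ √(m : ℝ) := Real.one_le_sqrt.2 (by exact_mod_cast hm1)
      have g1 := hsin (R * (√(m : ℝ) / P)) (by positivity)
      have g2 : R ^ 3 * |sinT (R * (√(m : ℝ) / P))| ≤ C * P ^ 3 := by
        have g3 : R / P ≤ R * (√(m : ℝ) / P) := by
          rw [mul_div_assoc']; gcongr; exact le_mul_of_one_le_right hR.le hm2
        have g4 : (R / P) ^ 3 * |sinT (R * (√(m : ℝ) / P))| ≤ C :=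
          le_trans (by gcongr) g1
        calc _ = (R / P) ^ 3 * |sinT (R * (√(m : ℝ) / P))| * P ^ 3 := by field_simp
          _ ≤ _ := by gcongr
      rw [abs_mul, abs_mul, abs_mul, abs_of_nonneg (by positivity : 0 ≤ 1 / (m : ℝ)),
        abs_of_nonneg (by positivity : 0 ≤ R ^ 3), abs_neg, abs_of_pos (by norm_num : (0 : ℝ) < 3),
        mul_comm]
      gcongr
    refine (Finset.abs_sum_le_sum_abs _ _).trans ((Finset.sum_le_sum f1).trans ?_)
    rw [← Finset.mul_sum]
    have f2 : ∑ m ∈ S, 1 / (m : ℝ) ≤ 2 * Real.log R := by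
      calc _ ≤ ∑ m ∈ Finset.Icc 1 N, 1 / (m : ℝ) :=
            Finset.sum_le_sum_of_subset_of_nonneg (Finset.filter_subset _ _)
              fun m _ _ => by positivity
        _ ≤ 1 + Real.log N := sum_Icc_inv_le N
        _ ≤ _ := by linarith
    calc _ ≤ 3 * (C * P ^ 3) * (2 * Real.log R) := by gcongr
      _ = _ := by ring
  rw [e1, e2, e3]
  set A := ∑ m ∈ S, 1 / (m : ℝ) * primSum R (√(m : ℝ) / P)
  set B := ∑ m ∈ S, 1 / (m : ℝ) * (-3 * (R ^ 3 * sinT (R * (√(m : ℝ) / P))))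
  have e5 : |κ * B| ≤ c / 2 * (R ^ 2 * Real.log R) := by
    rw [abs_mul]
    rw [div_le_iff₀ hc] at hR2
    calc |κ| * |B| ≤ |κ| * (6 * (C * P ^ 3) * Real.log R) := by gcongr
      _ = (|κ| * (6 * (C * P ^ 3))) * Real.log R := by ring
      _ ≤ (R ^ 2 * c / 2) * Real.log R := by gcongr; linarith
      _ = _ := by ring
  have e6 := abs_sub_abs_le_abs_sub (-A) (κ * B)
  rw [abs_neg] at e6
  linarith

theorem deriv_testW (R lam t : ℝ) : deriv (testW R lam) t =
    R⁻¹ * deriv w0 (t / R) * Real.sin (2 * π * lam * t) +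
      w0 (t / R) * (2 * π * lam * Real.cos (2 * π * lam * t)) := by
  have h0 : HasDerivAt w0 (deriv w0 (t / R)) (t / R) :=
    (contDiff_w0.differentiable (by simp) (t / R)).hasDerivAt
  have h1 : HasDerivAt (fun t => w0 (t / R)) (deriv w0 (t / R) * R⁻¹) t := by
    have := h0.comp t ((hasDerivAt_id t).div_const R)
    simpa [Function.comp_def] using this
  have h2 : HasDerivAt (fun t => Real.sin (2 * π * lam * t))
      (Real.cos (2 * π * lam * t) * (2 * π * lam)) t := by
    have := ((hasDerivAt_id t).const_mul (2 * π * lam)).sin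
    simpa using this
  rw [show testW R lam = fun t => w0 (t / R) * Real.sin (2 * π * lam * t) from rfl,
    (h1.fun_mul h2).deriv]
  ring

theorem exists_abs_deriv_testSum_le : ∃ M > 0, ∀ (P N : ℕ) (R t : ℝ), 1 ≤ P → 0 < R →
    |deriv (testSum P N R) t| ≤ M / R * (1 + Real.log N) + 2 * π *
      |∑ m ∈ (Finset.Icc 1 N).filter Squarefree, (√(m : ℝ))⁻¹ * Real.cos (2 * π / P * √(m : ℝ) * t)| := by
  obtain ⟨M, hM, hder⟩ := exists_abs_deriv_w0_le
  refine ⟨M, hM, ?_⟩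
  intro P N R t hP hR
  have hP1 : (1 : ℝ) ≤ P := by exact_mod_cast hP
  set S := (Finset.Icc 1 N).filter Squarefree with hS
  have h1 : deriv (testSum P N R) t =
      (∑ m ∈ S, 1 / (m : ℝ) * (R⁻¹ * deriv w0 (t / R) * Real.sin (2 * π * (√(m : ℝ) / P) * t))) +
      w0 (t / R) * (2 * π / P) * ∑ m ∈ S, (√(m : ℝ))⁻¹ * Real.cos (2 * π / P * √(m : ℝ) * t) := by
    rw [deriv_testSum, Finset.mul_sum, ← Finset.sum_add_distrib]
    refine Finset.sum_congr rfl fun m hm => ?_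
    have hm1 : (0 : ℝ) < m := by exact_mod_cast (Finset.mem_Icc.1 (Finset.mem_filter.1 hm).1).1
    have hs : (√(m : ℝ))⁻¹ = √(m : ℝ) / m := by
      rw [eq_div_iff hm1.ne', inv_mul_eq_iff_eq_mul₀ (Real.sqrt_pos.2 hm1).ne',
        Real.mul_self_sqrt hm1.le]
    rw [deriv_testW, hs, show 2 * π / P * √(m : ℝ) * t = 2 * π * (√(m : ℝ) / P) * t by ring]
    ring
  have h2 : |∑ m ∈ S, 1 / (m : ℝ) * (R⁻¹ * deriv w0 (t / R) *
      Real.sin (2 * π * (√(m : ℝ) / P) * t))| ≤ M / R * (1 + Real.log N) := by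
    have h3 : ∀ m ∈ S, |1 / (m : ℝ) * (R⁻¹ * deriv w0 (t / R) *
      Real.sin (2 * π * (√(m : ℝ) / P) * t))| ≤ M / R * (1 / (m : ℝ)) := by
      intro m _
      rw [abs_mul, abs_mul, abs_mul, abs_of_nonneg (by positivity : 0 ≤ 1 / (m : ℝ)),
        abs_of_pos (inv_pos.2 hR), mul_comm]
      have := Real.abs_sin_le_one (2 * π * (√(m : ℝ) / P) * t)
      have h4 := hder (t / R)
      gcongr
      calc _ ≤ R⁻¹ * M * 1 := by gcongr
        _ = _ := by ring
    refine (Finset.abs_sum_le_sum_abs _ _).trans ((Finset.sum_le_sum h3).trans ?_)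
    rw [← Finset.mul_sum]
    gcongr
    exact (Finset.sum_le_sum_of_subset_of_nonneg (Finset.filter_subset _ _)
              fun m _ _ => by positivity).trans (sum_Icc_inv_le N)
  rw [h1]
  refine (abs_add_le _ _).trans (add_le_add h2 ?_)
  rw [abs_mul]
  gcongr
  rw [abs_of_nonneg (mul_nonneg (w0_nonneg _) (by positivity))]
  calc _ ≤ 1 * (2 * π / P) := by gcongr; exact w0_le_one _
    _ ≤ _ := by rw [one_mul]; exact div_le_self (by positivity) hP1

theorem exists_integral_deriv_testSum_pow_le (P k : ℕ) (hP : 1 ≤ P) : ∃ δ : ℝ, 0 < δ ∧ δ ≤ 1 / 16 ∧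
    ∃ C > 0, ∀ᶠ R : ℝ in Filter.atTop,
      ∫ t in R..(2 * R), |deriv (testSum P ⌊R ^ δ⌋₊ R) t| ^ (2 * k) ≤ C * R * Real.log R ^ k := by
  obtain ⟨e, he⟩ := moment_le k
  obtain ⟨M, hM, hder⟩ := exists_abs_deriv_testSum_le
  have hP1 : (1 : ℝ) ≤ P := by exact_mod_cast hP
  have hδ : (0 : ℝ) < 1 / (16 * (e + 1)) := by positivity
  refine ⟨1 / (16 * (e + 1)), hδ, ?_, ?_⟩
  · gcongr
    have : (0 : ℝ) ≤ e := Nat.cast_nonneg e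
    linarith
  set δ : ℝ := 1 / (16 * (e + 1)) with hδdef
  refine ⟨2 ^ (2 * k - 1) * ((2 * M) ^ (2 * k) + (2 * π) ^ (2 * k) *
    (k.factorial * 2 ^ k + 2 / (2 * π / P) * 2 ^ e)), by positivity, ?_⟩
  filter_upwards [Filter.eventually_ge_atTop (1 : ℝ),
    Real.tendsto_log_atTop.eventually_ge_atTop 1] with R hR1 hlog
  have hR : 0 < R := by linarith
  set N := ⌊R ^ δ⌋₊ with hN
  have hRδ1 : 1 ≤ R ^ δ := Real.one_le_rpow hR1 hδ.le
  have hN1 : 1 ≤ N := Nat.le_floor (by simpa using hRδ1)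
  have hNle : (N : ℝ) ≤ R ^ δ := Nat.floor_le (by positivity)
  have hlogN : Real.log N ≤ Real.log R := by
    refine Real.log_le_log (by exact_mod_cast hN1) (hNle.trans ?_)
    conv_rhs => rw [← Real.rpow_one R]
    refine Real.rpow_le_rpow_of_exponent_le hR1 ?_
    rw [hδdef, div_le_one (by positivity)]
    have : (0 : ℝ) ≤ e := Nat.cast_nonneg e
    linarith
  set S := (Finset.Icc 1 N).filter Squarefree with hS
  set F : ℝ → ℝ := fun t => ∑ m ∈ S, (√(m : ℝ))⁻¹ * Real.cos (2 * π / P * √(m : ℝ) * t) with hF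
  have hFc : Continuous F := by fun_prop
  have hmom := he N S (fun m => (√(m : ℝ))⁻¹) (2 * π / P) R (2 * R) hN1
    (fun m hm => ⟨(Finset.mem_filter.1 hm).2, (Finset.mem_Icc.1 (Finset.mem_filter.1 hm).1).2⟩)
    (fun m hm => by
      have hm1 : 1 ≤ m := (Finset.mem_Icc.1 (Finset.mem_filter.1 hm).1).1
      rw [abs_of_nonneg (by positivity)]
      exact inv_le_one_of_one_le₀ (Real.one_le_sqrt.2 (by exact_mod_cast hm1)))
    (by positivity) (by linarith)
  have hF1 : ∫ t in R..(2 * R), |F t| ^ (2 * k) ≤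
      (k.factorial * 2 ^ k + 2 / (2 * π / P) * 2 ^ e) * (R * Real.log R ^ k) := by
    refine hmom.trans ?_
    have g1 : ∑ m ∈ S, (√(m : ℝ))⁻¹ ^ 2 ≤ 2 * Real.log R := by
      calc _ = ∑ m ∈ S, 1 / (m : ℝ) := Finset.sum_congr rfl fun m _ => by
            rw [inv_pow, Real.sq_sqrt (Nat.cast_nonneg _), one_div]
        _ ≤ ∑ m ∈ Finset.Icc 1 N, 1 / (m : ℝ) :=
            Finset.sum_le_sum_of_subset_of_nonneg (Finset.filter_subset _ _)
              fun m _ _ => by positivity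
        _ ≤ 1 + Real.log N := sum_Icc_inv_le N
        _ ≤ _ := by linarith
    have g2 : ((1 + N : ℕ) : ℝ) ^ e ≤ 2 ^ e * R := by
      calc ((1 + N : ℕ) : ℝ) ^ e ≤ (2 * R ^ δ) ^ e := by
            gcongr; push_cast; linarith
        _ = 2 ^ e * (R ^ (δ * e)) := by
            rw [mul_pow, Real.rpow_mul hR.le, Real.rpow_natCast]
        _ ≤ 2 ^ e * R ^ (1 : ℝ) := by
            refine mul_le_mul_of_nonneg_left ?_ (by positivity)
            refine Real.rpow_le_rpow_of_exponent_le hR1 ?_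
            rw [hδdef, div_mul_eq_mul_div, div_le_one (by positivity)]
            have : (0 : ℝ) ≤ e := Nat.cast_nonneg e
            linarith
        _ = _ := by rw [Real.rpow_one]
    have g3 : 1 ≤ Real.log R ^ k := one_le_pow₀ hlog
    have g0 : 0 ≤ ∑ m ∈ S, (√(m : ℝ))⁻¹ ^ 2 := Finset.sum_nonneg fun m _ => by positivity
    calc _ ≤ k.factorial * (2 * R - R) * (2 * Real.log R) ^ k + 2 / (2 * π / P) * (2 ^ e * R) := by
          have : 0 ≤ 2 * R - R := by linarith
          gcongr
      _ = (k.factorial * 2 ^ k) * (R * Real.log R ^ k) + (2 / (2 * π / P) * 2 ^ e) * (R * 1) := by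
          rw [mul_pow]; ring
      _ ≤ (k.factorial * 2 ^ k) * (R * Real.log R ^ k) +
            (2 / (2 * π / P) * 2 ^ e) * (R * Real.log R ^ k) := by gcongr
      _ = _ := by ring
  have hc1 : Continuous (deriv (testSum P N R)) :=
    (contDiff_testSum P N R).continuous_deriv le_rfl
  have hpt : ∀ t ∈ Set.Icc R (2 * R), |deriv (testSum P N R) t| ^ (2 * k) ≤
      2 ^ (2 * k - 1) * ((2 * M) ^ (2 * k) + (2 * π) ^ (2 * k) * |F t| ^ (2 * k)) := by
    intro t _
    have g1 := hder P N R t hP hR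
    have g2 : M / R * (1 + Real.log N) ≤ 2 * M := by
      have : Real.log R ≤ R := (Real.log_le_sub_one_of_pos hR).trans (by linarith)
      calc M / R * (1 + Real.log N) ≤ M / R * (2 * R) := by gcongr; linarith
        _ = _ := by field_simp
    calc _ ≤ (2 * M + 2 * π * |F t|) ^ (2 * k) := by gcongr; linarith
      _ ≤ 2 ^ (2 * k - 1) * ((2 * M) ^ (2 * k) + (2 * π * |F t|) ^ (2 * k)) :=
          add_pow_le (by positivity) (by positivity) _
      _ = _ := by rw [mul_pow (2 * π)]
  have i1 : IntervalIntegrable (fun t => |deriv (testSum P N R) t| ^ (2 * k)) volume R (2 * R) :=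
    (by fun_prop : Continuous fun t => |deriv (testSum P N R) t| ^ (2 * k)).intervalIntegrable _ _
  have i2 : IntervalIntegrable (fun t => 2 ^ (2 * k - 1) * ((2 * M) ^ (2 * k) +
      (2 * π) ^ (2 * k) * |F t| ^ (2 * k))) volume R (2 * R) :=
    (by fun_prop : Continuous fun t => 2 ^ (2 * k - 1) * ((2 * M) ^ (2 * k) +
      (2 * π) ^ (2 * k) * |F t| ^ (2 * k))).intervalIntegrable _ _
  refine (intervalIntegral.integral_mono_on (by linarith) i1 i2 hpt).trans ?_
  rw [intervalIntegral.integral_const_mul, intervalIntegral.integral_add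
    intervalIntegrable_const ((by fun_prop : Continuous fun t =>
      (2 * π) ^ (2 * k) * |F t| ^ (2 * k)).intervalIntegrable _ _),
    intervalIntegral.integral_const_mul, intervalIntegral.integral_const, smul_eq_mul]
  have g3 : 1 ≤ Real.log R ^ k := one_le_pow₀ hlog
  calc _ ≤ 2 ^ (2 * k - 1) * ((R * Real.log R ^ k) * (2 * M) ^ (2 * k) + (2 * π) ^ (2 * k) *
        ((k.factorial * 2 ^ k + 2 / (2 * π / P) * 2 ^ e) * (R * Real.log R ^ k))) := by
        gcongr
        rw [two_mul, add_sub_cancel_left]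
        exact le_mul_of_one_le_right hR.le g3
    _ = _ := by ring

theorem intervalIntegrable_Estar {a b : ℝ} (ha : 0 ≤ a) (hab : a ≤ b) :
    IntervalIntegrable Estar volume a b := by
  have h1 := intervalIntegrable_Nstar_mul continuous_one ha hab
  simp only [Pi.one_apply, mul_one] at h1
  exact h1.sub ((by fun_prop : Continuous fun R : ℝ =>
    (4 * π / (3 * (riemannZeta 3).re)) * R ^ 3).intervalIntegrable _ _)

theorem intervalIntegrable_abs_Estar_rpow {p a b : ℝ} (hp : 0 ≤ p) (ha : 0 ≤ a) (hab : a ≤ b) :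
    IntervalIntegrable (fun t => |Estar t| ^ p) volume a b := by
  have hc : Continuous fun x : ℝ => |x| ^ p := continuous_abs.rpow_const fun _ => Or.inr hp
  have hm : AEStronglyMeasurable (fun t => |Estar t| ^ p) (volume.restrict (Set.Ioc a b)) :=
    hc.comp_aestronglyMeasurable
      ((intervalIntegrable_iff_integrableOn_Ioc_of_le hab).1
        (intervalIntegrable_Estar ha hab)).aestronglyMeasurable
  rw [intervalIntegrable_iff_integrableOn_Ioc_of_le hab]
  set κ := 4 * π / (3 * (riemannZeta 3).re) with hκ
  refine (integrable_const (((Nstar b : ℝ) + |κ| * b ^ 3) ^ p)).mono' hm ?_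
  refine (ae_restrict_iff' measurableSet_Ioc).2 (Filter.Eventually.of_forall fun t ht => ?_)
  have ht0 : 0 ≤ t := ha.trans ht.1.le
  have h1 : |Estar t| ≤ (Nstar b : ℝ) + |κ| * b ^ 3 := by
    have h2 : (Nstar t : ℝ) ≤ Nstar b := Nstar_monotoneOn ht0 (ha.trans hab) ht.2
    have h3 : |κ * t ^ 3| ≤ |κ| * b ^ 3 := by
      rw [abs_mul, abs_of_nonneg (by positivity : 0 ≤ t ^ 3)]
      have := ht.2
      gcongr
    rw [Estar, ← hκ]
    refine (abs_sub _ _).trans (add_le_add ?_ h3)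
    rwa [abs_of_nonneg (Nat.cast_nonneg _)]
  rw [Real.norm_eq_abs, abs_of_nonneg (by positivity)]
  gcongr

theorem mul_le_rpow_add_one_add_pow {p x y : ℝ} (hp : 1 < p) (hx : 0 ≤ x) (hy : 0 ≤ y) {k : ℕ}
    (hk : p / (p - 1) ≤ 2 * k) : x * y ≤ x ^ p + 1 + y ^ (2 * k) := by
  have hpq : p.HolderConjugate (p / (p - 1)) := Real.HolderConjugate.conjExponent hp
  have h1 := Real.young_inequality_of_nonneg hx hy hpq
  have h2 : x ^ p / p ≤ x ^ p := div_le_self (by positivity) hp.le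
  have h3 : y ^ (p / (p - 1)) / (p / (p - 1)) ≤ y ^ (p / (p - 1)) :=
    div_le_self (by positivity) hpq.symm.lt.le
  have h4 : y ^ (p / (p - 1)) ≤ 1 + y ^ (2 * k) := by
    rcases le_total y 1 with h | h
    · have : y ^ (p / (p - 1)) ≤ 1 := Real.rpow_le_one hy h hpq.symm.nonneg
      have : 0 ≤ y ^ (2 * k) := by positivity
      linarith
    · have : y ^ (p / (p - 1)) ≤ y ^ ((2 * k : ℕ) : ℝ) :=
        Real.rpow_le_rpow_of_exponent_le h (by push_cast; exact hk)
      rw [Real.rpow_natCast] at this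
      linarith
  linarith
theorem lower_bound_moments_Estar (p : ℝ) (hp : 1 < p) :
    ∃ c > (0:ℝ), ∃ R₀ > (1:ℝ), ∀ R ≥ R₀,
      c * R ^ (p + 1) * (Real.log R) ^ (p / 2) ≤ ∫ t in R..(2 * R), |Estar t| ^ p := by
  obtain ⟨P, hP, hlow⟩ := exists_integral_Estar_mul_ge
  obtain ⟨k, hk⟩ := exists_nat_ge (p / (p - 1))
  have hk2 : p / (p - 1) ≤ 2 * k := hk.trans (by linarith [Nat.cast_nonneg (α := ℝ) k])
  obtain ⟨δ, hδ, hδ16, C, hC, hup⟩ := exists_integral_deriv_testSum_pow_le P k hP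
  obtain ⟨c, hc, hlow⟩ := hlow δ hδ hδ16
  set σ := c / (2 * (1 + C)) with hσ
  have hσ0 : 0 < σ := by positivity
  obtain ⟨R₁, hR₁⟩ := Filter.eventually_atTop.1 (hlow.and (hup.and
    (Real.tendsto_log_atTop.eventually_ge_atTop 1)))
  refine ⟨(1 + C) * σ ^ p, by positivity, max R₁ 2, lt_max_of_lt_right one_lt_two, ?_⟩
  intro R hR
  obtain ⟨h1, h2, hlog⟩ := hR₁ R ((le_max_left _ _).trans hR)
  have hR0 : 0 < R := by linarith [(le_max_right R₁ 2).trans hR]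
  have hlog0 : 0 < Real.log R := by linarith
  set N := ⌊R ^ δ⌋₊
  set W' := deriv (testSum P N R) with hW'
  have hWc : Continuous W' := (contDiff_testSum P N R).continuous_deriv le_rfl
  set B := √(Real.log R) with hB
  have hB0 : 0 < B := Real.sqrt_pos.2 hlog0
  have hB2 : B ^ 2 = Real.log R := Real.sq_sqrt hlog0.le
  set A := σ * R * B with hA
  have hA0 : 0 < A := by positivity
  have hEp := intervalIntegrable_abs_Estar_rpow (p := p) (by linarith) hR0.le
    (by linarith : R ≤ 2 * R)
  have hW2 : IntervalIntegrable (fun t => (B ^ (2 * k))⁻¹ * |W' t| ^ (2 * k)) volume R (2 * R) :=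
    (by fun_prop : Continuous fun t => (B ^ (2 * k))⁻¹ * |W' t| ^ (2 * k)).intervalIntegrable _ _
  have hpt : ∀ t ∈ Set.Icc R (2 * R), |Estar t * W' t| ≤
      A * B * ((A ^ p)⁻¹ * |Estar t| ^ p + 1 + (B ^ (2 * k))⁻¹ * |W' t| ^ (2 * k)) := by
    intro t _
    have := mul_le_rpow_add_one_add_pow hp (x := |Estar t| / A) (y := |W' t| / B)
      (by positivity) (by positivity) hk2
    rw [Real.div_rpow (abs_nonneg _) hA0.le, div_pow, div_eq_inv_mul (|Estar t| ^ p),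
      div_eq_inv_mul (|W' t| ^ (2 * k))] at this
    calc |Estar t * W' t| = A * B * (|Estar t| / A * (|W' t| / B)) := by
          rw [abs_mul]; field_simp
      _ ≤ _ := by gcongr
  have hEW : IntervalIntegrable (fun t => |Estar t * W' t|) volume R (2 * R) :=
    ((intervalIntegrable_Estar hR0.le (by linarith)).mul_continuousOn hWc.continuousOn).abs
  have h3 := intervalIntegral.integral_mono_on (by linarith) hEW
    ((((hEp.const_mul (A ^ p)⁻¹).add intervalIntegrable_const).add hW2).const_mul (A * B)) hpt
  rw [intervalIntegral.integral_const_mul, intervalIntegral.integral_add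
    ((hEp.const_mul (A ^ p)⁻¹).add intervalIntegrable_const) hW2, intervalIntegral.integral_add
    (hEp.const_mul (A ^ p)⁻¹) intervalIntegrable_const, intervalIntegral.integral_const_mul,
    intervalIntegral.integral_const_mul, intervalIntegral.integral_const, smul_eq_mul] at h3
  have h4 := intervalIntegral.abs_integral_le_integral_abs (f := fun t => Estar t * W' t)
    (μ := volume) (by linarith : R ≤ 2 * R)
  set I := ∫ t in R..(2 * R), |Estar t| ^ p with hI
  set J := ∫ t in R..(2 * R), |W' t| ^ (2 * k) with hJ
  have h5 : (B ^ (2 * k))⁻¹ * J ≤ C * R := by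
    rw [pow_mul, hB2, inv_mul_le_iff₀ (by positivity)]
    calc J ≤ _ := h2
      _ = _ := by ring
  have h6 : c * (R ^ 2 * Real.log R) ≤ A * B * ((A ^ p)⁻¹ * I + (1 + C) * R) := by
    refine h1.trans (h4.trans (h3.trans ?_))
    exact mul_le_mul_of_nonneg_left (by linarith) (by positivity)
  have h7 : c = 2 * (1 + C) * σ := by rw [hσ]; field_simp
  have h8 : 2 * (1 + C) * R ≤ (A ^ p)⁻¹ * I + (1 + C) * R := by
    have e1 : A * B = σ * R * Real.log R := by rw [hA, ← hB2]; ring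
    rw [e1, h7] at h6
    refine le_of_mul_le_mul_left ?_ (by positivity : 0 < σ * R * Real.log R)
    calc _ = 2 * (1 + C) * σ * (R ^ 2 * Real.log R) := by ring
      _ ≤ _ := h6
  have h9 : A ^ p * ((1 + C) * R) ≤ I := by
    rw [← le_inv_mul_iff₀ (by positivity)]
    linarith
  calc _ = A ^ p * ((1 + C) * R) := by
        rw [hA, Real.mul_rpow (by positivity) hB0.le, Real.mul_rpow hσ0.le hR0.le,
          Real.rpow_add hR0, Real.rpow_one, hB, Real.sqrt_eq_rpow, ← Real.rpow_mul hlog0.le]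
        rw [show 1 / 2 * p = p / 2 by ring]
        ring
    _ ≤ _ := h9
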